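/- arXiv:1003.4203 — 2 statements merged into one kernel-verified Lean document; each statement's English description precedes it below -/
import Mathlib

section
/- (Hypocoercive decay in H¹, periodic case.) Assume V ∈ C²(𝕋^d). There exist constants C, λ > 0, depending only on d, m, β, the α_j, λ_j and V, with the following property: if h : [0,∞) × X → ℝ is smooth, for every t all spatial partial derivatives of h(t,·) belong to L²(μ_β) with locally uniform-in-t bounds, h solves the backward Kolmogorov equation ∂_t h = −𝓛 h, and ∫_X h(0,·) dμ_β = 0, then for all t ≥ 0, ‖h(t,·)‖_{H¹(μ_β)} ≤ C e^{−λ t} ‖h(0,·)‖_{H¹(μ_β)}, where ‖u‖²_{H¹(μ_β)} = ∫_X (u² + |∇_q u|² + |∇_p u|² + |∇_z u|²) dμ_β. -/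
open MeasureTheory Real Filter

noncomputable section

/-- The state space `X = 𝕋^d × ℝ^d × ℝ^{dm}`, realised as
`ℝ^d × ℝ^d × (ℝ^d)^m` with functions that are `ℤ^d`-periodic in the first variable. -/
abbrev Xsp (d m : ℕ) := (Fin d → ℝ) × (Fin d → ℝ) × (Fin m → Fin d → ℝ)

/-- The direction in the `z_j`-block given by the vector `v`. -/
def zdir (d m : ℕ) (j : Fin m) (v : Fin d → ℝ) : Xsp d m :=
  (0, 0, Function.update 0 j v)

/-- The partial derivative `∂_{z_{j,k}} φ`. -/
def pZ (d m : ℕ) (j : Fin m) (k : Fin d) (φ : Xsp d m → ℝ) (x : Xsp d m) : ℝ :=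
  fderiv ℝ φ x (zdir d m j (Pi.single k 1))

/-- The partial derivative `∂_{p_k} φ`. -/
def pP (d m : ℕ) (k : Fin d) (φ : Xsp d m → ℝ) (x : Xsp d m) : ℝ :=
  fderiv ℝ φ x (0, Pi.single k 1, 0)

/-- The partial derivative `∂_{q_k} φ`. -/
def pQ (d m : ℕ) (k : Fin d) (φ : Xsp d m → ℝ) (x : Xsp d m) : ℝ :=
  fderiv ℝ φ x (Pi.single k 1, 0, 0)

/-- The operator `𝓛` (negative of the generator of the Markovian GLE dynamics):
`𝓛φ = −p·∇_qφ + ∇V·∇_pφ − Σ_j λ_j z_j·∇_pφ + Σ_j λ_j p·∇_{z_j}φ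
      + Σ_j α_j z_j·∇_{z_j}φ − β⁻¹ Σ_j α_j Δ_{z_j}φ`. -/
def gen (d m : ℕ) (β : ℝ) (α lam : Fin m → ℝ) (V : (Fin d → ℝ) → ℝ)
    (φ : Xsp d m → ℝ) (x : Xsp d m) : ℝ :=
  - fderiv ℝ φ x (x.2.1, 0, 0)
  + fderiv ℝ φ x (0, (fun i => fderiv ℝ V x.1 (Pi.single i 1)), 0)
  - fderiv ℝ φ x (0, ∑ j, lam j • x.2.2 j, 0)
  + ∑ j, lam j * fderiv ℝ φ x (zdir d m j x.2.1)
  + ∑ j, α j * fderiv ℝ φ x (zdir d m j (x.2.2 j))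
  - β⁻¹ * ∑ j, α j * ∑ k, fderiv ℝ (pZ d m j k φ) x (zdir d m j (Pi.single k 1))

/-- The (unnormalised) Gibbs density `exp(−β(V(q) + |p|²/2 + |z|²/2))`. -/
def gdens (d m : ℕ) (β : ℝ) (V : (Fin d → ℝ) → ℝ) (x : Xsp d m) : ℝ :=
  Real.exp (-β * (V x.1 + (∑ i, (x.2.1 i) ^ 2) / 2 + (∑ j, ∑ i, (x.2.2 j i) ^ 2) / 2))

/-- The fundamental domain `[0,1)^d` for the torus in the `q`-variable. -/
def cube (d : ℕ) : Set (Fin d → ℝ) := {q | ∀ i, q i ∈ Set.Ico (0 : ℝ) 1}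

/-- Lebesgue measure on `X = 𝕋^d × ℝ^d × ℝ^{dm}` (the `q`-variable being
restricted to a fundamental domain of the torus). -/
def volX (d m : ℕ) : Measure (Xsp d m) :=
  (volume : Measure (Xsp d m)).restrict {x | x.1 ∈ cube d}

/-- The Gibbs measure `μ_β`, with density `Z⁻¹ exp(−β(V(q)+|p|²/2+|z|²/2))`. -/
def gibbs (d m : ℕ) (β Z : ℝ) (V : (Fin d → ℝ) → ℝ) : Measure (Xsp d m) :=
  (volX d m).withDensity fun x => ENNReal.ofReal (Z⁻¹ * gdens d m β V x)

/-- `ℤ^d`-periodicity in the `q`-variable. -/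
def PerQ (d m : ℕ) (φ : Xsp d m → ℝ) : Prop :=
  ∀ (k : Fin d → ℤ) (x : Xsp d m), φ (x.1 + (fun i => (k i : ℝ)), x.2) = φ x

/-- `ℤ^d`-periodicity of the potential. -/
def PerV (d : ℕ) (V : (Fin d → ℝ) → ℝ) : Prop :=
  ∀ (k : Fin d → ℤ) (q : Fin d → ℝ), V (q + fun i => (k i : ℝ)) = V q

/-- A test function: smooth, periodic in `q`, compactly supported in `(p,z)`. -/
def IsTest (d m : ℕ) (φ : Xsp d m → ℝ) : Prop :=
  ContDiff ℝ (⊤ : ℕ∞) φ ∧ PerQ d m φ ∧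
    ∃ K : Set ((Fin d → ℝ) × (Fin m → Fin d → ℝ)),
      IsCompact K ∧ ∀ x : Xsp d m, x.2 ∉ K → φ x = 0

/-- The squared `H¹(μ)` norm `∫ (u² + |∇_q u|² + |∇_p u|² + |∇_z u|²) dμ`. -/
def H1sq (d m : ℕ) (μ : Measure (Xsp d m)) (u : Xsp d m → ℝ) : ℝ :=
  ∫ x, ((u x) ^ 2 + ∑ i, (pQ d m i u x) ^ 2 + ∑ i, (pP d m i u x) ^ 2
    + ∑ j, ∑ k, (pZ d m j k u x) ^ 2) ∂μ

section Periodic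

variable {d m : ℕ}

theorem cube_eq_fundamentalDomain (d : ℕ) :
    cube d = ZSpan.fundamentalDomain (Pi.basisFun ℝ (Fin d)) := by
  ext q
  simp [cube, ZSpan.mem_fundamentalDomain]

theorem measurableSet_cube (d : ℕ) : MeasurableSet (cube d) := by
  rw [cube_eq_fundamentalDomain]
  exact ZSpan.fundamentalDomain_measurableSet _

theorem exists_int_of_mem_span {v : Fin d → ℝ}
    (hv : v ∈ Submodule.span ℤ (Set.range (Pi.basisFun ℝ (Fin d)))) :
    ∃ k : Fin d → ℤ, v = fun i => (k i : ℝ) := by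
  rw [Module.Basis.mem_span_iff_repr_mem] at hv
  choose k hk using hv
  refine ⟨k, funext fun i => ?_⟩
  have := hk i
  simpa using this.symm

/-- The integral of a periodic function over the unit cube is translation invariant. -/
theorem lintegral_cube_translate (F : (Fin d → ℝ) → ENNReal)
    (hF : ∀ (k : Fin d → ℤ) q, F (q + fun i => (k i : ℝ)) = F q) (w : Fin d → ℝ) :
    ∫⁻ q in cube d, F (q + w) = ∫⁻ q in cube d, F q := by
  have h1 := ZSpan.isAddFundamentalDomain' (Pi.basisFun ℝ (Fin d))
    (volume : Measure (Fin d → ℝ))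
  have h2 := h1.vadd_of_comm (G' := Fin d → ℝ) w
  rw [← cube_eq_fundamentalDomain] at h1 h2
  have : Countable (Submodule.span ℤ (Set.range (Pi.basisFun ℝ (Fin d)))).toAddSubgroup :=
    inferInstanceAs (Countable (Submodule.span ℤ (Set.range (Pi.basisFun ℝ (Fin d)))))
  have h3 := h1.setLIntegral_eq h2 F (by
    intro g x
    obtain ⟨k, hk⟩ := exists_int_of_mem_span (v := g.1) g.2
    change F ((g : Fin d → ℝ) + x) = F x
    rw [hk, add_comm, hF])
  rw [h3]
  have hmp : MeasurePreserving (fun q : Fin d → ℝ => q + w) volume volume :=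
    measurePreserving_add_right volume w
  have he : MeasurableEmbedding (fun q : Fin d → ℝ => q + w) :=
    (MeasurableEquiv.addRight w).measurableEmbedding
  have h4 := hmp.setLIntegral_comp_emb he F (cube d)
  rw [h4]
  have h5 : (fun q : Fin d → ℝ => w +ᵥ q) '' cube d = (fun q : Fin d → ℝ => q + w) '' cube d :=
    Set.image_congr fun q _ => add_comm w q
  exact congrArg (fun s => ∫⁻ q in s, F q) h5.symm

instance (m d : ℕ) : (volume : Measure (Fin m → Fin d → ℝ)).IsAddHaarMeasure :=
  Measure.pi.isAddHaarMeasure _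

instance (m d : ℕ) :
    (volume : Measure ((Fin d → ℝ) × (Fin m → Fin d → ℝ))).IsAddHaarMeasure :=
  inferInstanceAs (Measure.prod volume volume).IsAddHaarMeasure

theorem volX_eq_prod (d m : ℕ) :
    volX d m = ((volume : Measure (Fin d → ℝ)).restrict (cube d)).prod volume := by
  have : ({x | x.1 ∈ cube d} : Set (Xsp d m)) = cube d ×ˢ Set.univ := by
    ext x; simp
  rw [volX, this, Measure.volume_eq_prod, ← Measure.prod_restrict, Measure.restrict_univ]

instance (d m : ℕ) : SFinite (volX d m) := by
  rw [volX_eq_prod]; infer_instance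

theorem lintegral_volX_translate {F : Xsp d m → ENNReal} (hFm : Measurable F)
    (hF : ∀ (k : Fin d → ℤ) (x : Xsp d m), F (x.1 + (fun i => (k i : ℝ)), x.2) = F x)
    (v : Xsp d m) :
    ∫⁻ x, F (x + v) ∂volX d m = ∫⁻ x, F x ∂volX d m := by
  rw [volX_eq_prod, lintegral_prod_symm' _ (by fun_prop), lintegral_prod_symm' _ hFm]
  have h1 : ∀ y, ∫⁻ q in cube d, F ((q, y) + v) = ∫⁻ q in cube d, F (q, y + v.2) := by
    intro y
    exact lintegral_cube_translate (fun q => F (q, y + v.2)) (fun k q => hF k (q, y + v.2)) v.1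
  simp_rw [h1]
  exact lintegral_add_right_eq_self (fun y => ∫⁻ q in cube d, F (q, y)) v.2

theorem integrable_volX_translate {F : Xsp d m → ℝ} (hFc : Continuous F)
    (hF : PerQ d m F) (hi : Integrable F (volX d m)) (v : Xsp d m) :
    Integrable (fun x => F (x + v)) (volX d m) := by
  refine ⟨by fun_prop, ?_⟩
  have h := hi.2
  rw [HasFiniteIntegral] at h ⊢
  rwa [lintegral_volX_translate (F := fun x => ‖F x‖ₑ) (by fun_prop)
    (fun k x => by simp only [hF k x])]

theorem integral_volX_translate {F : Xsp d m → ℝ} (hFc : Continuous F)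
    (hF : PerQ d m F) (hi : Integrable F (volX d m)) (v : Xsp d m) :
    ∫ x, F (x + v) ∂volX d m = ∫ x, F x ∂volX d m := by
  rw [integral_eq_lintegral_pos_part_sub_lintegral_neg_part hi,
    integral_eq_lintegral_pos_part_sub_lintegral_neg_part (integrable_volX_translate hFc hF hi v),
    lintegral_volX_translate (F := fun x => ENNReal.ofReal (F x)) (by fun_prop)
      (fun k x => by simp only [hF k x]),
    lintegral_volX_translate (F := fun x => ENNReal.ofReal (-F x)) (by fun_prop)
      (fun k x => by simp only [hF k x])]

theorem PerQ.fderiv_eq {f : Xsp d m → ℝ} (hf : PerQ d m f) (k : Fin d → ℤ) (x : Xsp d m) :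
    fderiv ℝ f (x.1 + (fun i => (k i : ℝ)), x.2) = fderiv ℝ f x := by
  have h : (fun y : Xsp d m => f (y + ((fun i => (k i : ℝ)), 0))) = f := by
    funext y
    have := hf k y
    rw [← this]
    congr 1
    ext <;> simp
  have h2 := fderiv_comp_add_right (𝕜 := ℝ) (f := f) (x := x) ((fun i => (k i : ℝ)), 0)
  rw [h] at h2
  rw [h2]
  congr 1
  ext <;> simp

theorem PerQ.fderiv_apply {f : Xsp d m → ℝ} (hf : PerQ d m f) (v : Xsp d m) :
    PerQ d m (fun x => fderiv ℝ f x v) := fun k x => by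
  simp only [hf.fderiv_eq k x]

theorem PerQ.mul {f g : Xsp d m → ℝ} (hf : PerQ d m f) (hg : PerQ d m g) :
    PerQ d m (fun x => f x * g x) := fun k x => by simp only [hf k x, hg k x]

/-- The integral of a directional derivative of an integrable periodic function vanishes. -/
theorem integral_fderiv_volX_eq_zero {F : Xsp d m → ℝ} (hF : ContDiff ℝ 1 F)
    (hp : PerQ d m F) (v : Xsp d m) (hi : Integrable F (volX d m))
    (hi' : Integrable (fun x => fderiv ℝ F x v) (volX d m)) :
    ∫ x, fderiv ℝ F x v ∂volX d m = 0 := by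
  have hFc := hF.continuous
  have hDc : Continuous (fun x => fderiv ℝ F x v) :=
    (hF.continuous_fderiv (by norm_num)).clm_apply continuous_const
  have hftc : ∀ x, F (x + v) - F x = ∫ r in (0:ℝ)..1, fderiv ℝ F (x + r • v) v := by
    intro x
    have hd : ∀ r ∈ Set.uIcc (0:ℝ) 1, HasDerivAt (fun r : ℝ => F (x + r • v))
        (fderiv ℝ F (x + r • v) v) r := by
      intro r _
      have h1 : HasDerivAt (fun r : ℝ => x + r • v) v r := by
        simpa using ((hasDerivAt_id r).smul_const v).const_add x
      exact ((hF.differentiable (by norm_num)).differentiableAt.hasFDerivAt).comp_hasDerivAt r h1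
    rw [intervalIntegral.integral_eq_sub_of_hasDerivAt hd
      (Continuous.intervalIntegrable (by fun_prop) _ _)]
    simp
  have h0 : ∫ x, (F (x + v) - F x) ∂volX d m = 0 := by
    rw [integral_sub (integrable_volX_translate hFc hp hi v) hi,
      integral_volX_translate hFc hp hi v, sub_self]
  simp_rw [hftc, intervalIntegral.integral_of_le zero_le_one] at h0
  have hint : Integrable (Function.uncurry fun (x : Xsp d m) (r : ℝ) =>
      fderiv ℝ F (x + r • v) v) ((volX d m).prod (volume.restrict (Set.Ioc (0:ℝ) 1))) := by
    have hc : Continuous (Function.uncurry fun (x : Xsp d m) (r : ℝ) =>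
      fderiv ℝ F (x + r • v) v) := by
      refine hDc.comp (f := fun p : Xsp d m × ℝ => p.1 + p.2 • v) (by fun_prop)
    refine ⟨hc.aestronglyMeasurable, ?_⟩
    have h := hi'.2
    rw [HasFiniteIntegral] at h ⊢
    rw [lintegral_prod_symm' _ hc.measurable.enorm]
    simp only [Function.uncurry]
    have h1 : ∀ r : ℝ, ∫⁻ x, ‖fderiv ℝ F (x + r • v) v‖ₑ ∂volX d m =
        ∫⁻ x, ‖fderiv ℝ F x v‖ₑ ∂volX d m := fun r =>
      lintegral_volX_translate (F := fun x => ‖fderiv ℝ F x v‖ₑ) hDc.measurable.enorm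
        (fun k x => by simp only [hp.fderiv_eq k x]) (r • v)
    simp_rw [h1]
    simpa using h
  rw [integral_integral_swap hint] at h0
  have h1 : ∀ r : ℝ, ∫ x, fderiv ℝ F (x + r • v) v ∂volX d m =
      ∫ x, fderiv ℝ F x v ∂volX d m := fun r =>
    integral_volX_translate hDc (hp.fderiv_apply v) hi' (r • v)
  simp_rw [h1] at h0
  simpa using h0

/-- A continuous periodic function is bounded. -/
theorem exists_bound_of_periodic {g : (Fin d → ℝ) → ℝ} (hg : Continuous g)
    (hp : ∀ (k : Fin d → ℤ) q, g (q + fun i => (k i : ℝ)) = g q) :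
    ∃ M : ℝ, 0 ≤ M ∧ ∀ q, |g q| ≤ M := by
  obtain ⟨M, hM⟩ := (isCompact_Icc (a := (0 : Fin d → ℝ)) (b := 1)).exists_bound_of_continuousOn
    hg.continuousOn
  refine ⟨|M|, abs_nonneg _, fun q => ?_⟩
  have h1 := hp (fun i => ⌊q i⌋) (fun i => Int.fract (q i))
  have h2 : ((fun i => Int.fract (q i)) + fun i => ((⌊q i⌋ : ℤ) : ℝ)) = q := by
    funext i; simp
  rw [h2] at h1
  rw [h1]
  refine (hM _ ⟨fun i => Int.fract_nonneg _, fun i => (Int.fract_lt_one _).le⟩).trans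
    (le_abs_self _)

end Periodic

section Gibbs

variable {d m : ℕ}

/-- The directional derivative of the Hamiltonian `V(q) + |p|²/2 + |z|²/2`. -/
def dHam (V : (Fin d → ℝ) → ℝ) (x v : Xsp d m) : ℝ :=
  fderiv ℝ V x.1 v.1 + ∑ i, x.2.1 i * v.2.1 i + ∑ j, ∑ i, x.2.2 j i * v.2.2 j i

theorem contDiff_gdens {V : (Fin d → ℝ) → ℝ} (hV : ContDiff ℝ 2 V) (β : ℝ) :
    ContDiff ℝ 2 (gdens d m β V) := by
  unfold gdens
  have h1 : ContDiff ℝ 2 fun x : Xsp d m => V x.1 := hV.comp contDiff_fst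
  have h2 : ∀ i, ContDiff ℝ 2 fun x : Xsp d m => x.2.1 i := fun i => by fun_prop
  have h3 : ∀ j i, ContDiff ℝ 2 fun x : Xsp d m => x.2.2 j i := fun j i => by fun_prop
  refine ContDiff.exp (ContDiff.mul contDiff_const (ContDiff.add (ContDiff.add h1 ?_) ?_))
  · exact (ContDiff.sum fun i _ => (h2 i).pow 2).div_const 2
  · exact (ContDiff.sum fun j _ => ContDiff.sum fun i _ => (h3 j i).pow 2).div_const 2

theorem gdens_pos (β : ℝ) (V : (Fin d → ℝ) → ℝ) (x : Xsp d m) : 0 < gdens d m β V x :=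
  Real.exp_pos _

theorem perQ_gdens {V : (Fin d → ℝ) → ℝ} (hV : PerV d V) (β : ℝ) :
    PerQ d m (gdens d m β V) := fun k x => by
  simp only [gdens, hV k x.1]

theorem fderiv_gdens {V : (Fin d → ℝ) → ℝ} (hV : ContDiff ℝ 2 V) (β : ℝ) (x v : Xsp d m) :
    fderiv ℝ (gdens d m β V) x v = -β * dHam V x v * gdens d m β V x := by
  have hd : HasDerivAt (fun r : ℝ => x + r • v) v 0 := by
    simpa using ((hasDerivAt_id (0:ℝ)).smul_const v).const_add x
  have hl : HasDerivAt (fun r : ℝ => gdens d m β V (x + r • v))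
      (fderiv ℝ (gdens d m β V) x v) 0 := by
    have h1 : HasFDerivAt (gdens d m β V) (fderiv ℝ (gdens d m β V) x) (x + (0:ℝ) • v) := by
      simpa using ((contDiff_gdens hV β).differentiable (by norm_num) x).hasFDerivAt
    exact h1.comp_hasDerivAt (0:ℝ) hd
  have hV1 : HasDerivAt (fun r : ℝ => V (x + r • v).1) (fderiv ℝ V x.1 v.1) 0 := by
    have h1 : HasFDerivAt V (fderiv ℝ V x.1) (x + (0:ℝ) • v).1 := by
      simpa using (hV.differentiable (by norm_num) x.1).hasFDerivAt
    exact h1.comp_hasDerivAt (0:ℝ) hd.fst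
  have hp : ∀ i, HasDerivAt (fun r : ℝ => ((x + r • v).2.1 i) ^ 2) (2 * (x.2.1 i * v.2.1 i)) 0 := by
    intro i
    have h1 : HasDerivAt (fun r : ℝ => x.2.1 i + r * v.2.1 i) (v.2.1 i) 0 := by
      simpa using ((hasDerivAt_id (0:ℝ)).mul_const (v.2.1 i)).const_add (x.2.1 i)
    convert! h1.pow 2 using 1
    simp; ring
  have hz : ∀ j i, HasDerivAt (fun r : ℝ => ((x + r • v).2.2 j i) ^ 2)
      (2 * (x.2.2 j i * v.2.2 j i)) 0 := by
    intro j i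
    have h1 : HasDerivAt (fun r : ℝ => x.2.2 j i + r * v.2.2 j i) (v.2.2 j i) 0 := by
      simpa using ((hasDerivAt_id (0:ℝ)).mul_const (v.2.2 j i)).const_add (x.2.2 j i)
    convert! h1.pow 2 using 1
    simp; ring
  have hr := (((hV1.add ((HasDerivAt.fun_sum fun i (_ : i ∈ Finset.univ) => hp i).div_const 2)).add
    ((HasDerivAt.fun_sum fun j (_ : j ∈ Finset.univ) =>
      HasDerivAt.fun_sum fun i (_ : i ∈ Finset.univ) => hz j i).div_const 2)).const_mul (-β)).exp
  have he := hl.unique hr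
  rw [he]
  simp only [gdens, dHam, zero_smul, add_zero, ← Finset.mul_sum, Pi.add_apply]
  ring

variable {β Z : ℝ} {V : (Fin d → ℝ) → ℝ}

theorem measurable_gibbs_density (hV : ContDiff ℝ 2 V) (β Z : ℝ) :
    Measurable fun x : Xsp d m => ENNReal.ofReal (Z⁻¹ * gdens d m β V x) := by
  have := (contDiff_gdens (m := m) hV β).continuous
  fun_prop

theorem integral_gibbs (hV : ContDiff ℝ 2 V) (hZ : 0 < Z) (f : Xsp d m → ℝ) :
    ∫ x, f x ∂gibbs d m β Z V = Z⁻¹ * ∫ x, gdens d m β V x * f x ∂volX d m := by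
  rw [gibbs, integral_withDensity_eq_integral_toReal_smul (measurable_gibbs_density hV β Z)
    (by simp), ← integral_const_mul]
  refine integral_congr_ae (Eventually.of_forall fun x => ?_)
  have := gdens_pos β V x
  simp only [smul_eq_mul]
  rw [ENNReal.toReal_ofReal (by positivity)]
  ring

theorem integrable_gibbs_iff (hV : ContDiff ℝ 2 V) (hZ : 0 < Z) (f : Xsp d m → ℝ) :
    Integrable f (gibbs d m β Z V) ↔ Integrable (fun x => gdens d m β V x * f x) (volX d m) := by
  rw [gibbs, integrable_withDensity_iff_integrable_smul' (measurable_gibbs_density hV β Z)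
    (by simp)]
  have : (fun x => (ENNReal.ofReal (Z⁻¹ * gdens d m β V x)).toReal • f x) =
      fun x => Z⁻¹ * (gdens d m β V x * f x) := by
    funext x
    have := gdens_pos β V x
    simp only [smul_eq_mul]
    rw [ENNReal.toReal_ofReal (by positivity)]
    ring
  rw [this, integrable_const_mul_iff (IsUnit.mk0 _ (inv_pos.2 hZ).ne.symm)]

/-- Integration by parts with respect to the Gibbs measure. -/
theorem integral_fderiv_gibbs (hV : ContDiff ℝ 2 V) (hVp : PerV d V) (hZ : 0 < Z)
    {f : Xsp d m → ℝ} (hf : ContDiff ℝ 1 f) (hp : PerQ d m f) (v : Xsp d m)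
    (hi : Integrable f (gibbs d m β Z V))
    (hi' : Integrable (fun x => fderiv ℝ f x v) (gibbs d m β Z V))
    (hiU : Integrable (fun x => f x * dHam V x v) (gibbs d m β Z V)) :
    ∫ x, fderiv ℝ f x v ∂gibbs d m β Z V = β * ∫ x, f x * dHam V x v ∂gibbs d m β Z V := by
  have hg := (contDiff_gdens (m := m) hV β).of_le (m := 1) (by norm_num)
  have hF : ContDiff ℝ 1 (fun x => gdens d m β V x * f x) := hg.mul hf
  have hder : ∀ x, fderiv ℝ (fun x => gdens d m β V x * f x) x v =
      gdens d m β V x * fderiv ℝ f x v - β * (gdens d m β V x * (f x * dHam V x v)) := by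
    intro x
    rw [fderiv_fun_mul (hg.differentiable (by norm_num) x) (hf.differentiable (by norm_num) x)]
    simp only [_root_.add_apply, _root_.smul_apply, smul_eq_mul, fderiv_gdens hV]
    ring
  rw [integrable_gibbs_iff hV hZ] at hi hi' hiU
  have h0 := integral_fderiv_volX_eq_zero hF ((perQ_gdens hVp β).mul hp) v hi (by
    simp_rw [hder]; exact hi'.sub (hiU.const_mul β))
  simp_rw [hder] at h0
  rw [integral_sub hi' (hiU.const_mul β), integral_const_mul] at h0
  rw [integral_gibbs hV hZ, integral_gibbs hV hZ]
  linear_combination Z⁻¹ * h0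

theorem weighted_sq_truncated (hβ : 0 < β) (hV : ContDiff ℝ 2 V) (hVp : PerV d V) (hZ : 0 < Z)
    {c : Xsp d m →L[ℝ] ℝ} {v : Xsp d m} (hcv : c v = 1) (hcp : PerQ d m c)
    (hc : ∀ x, dHam V x v = c x) {φ : Xsp d m → ℝ} (hφ : ContDiff ℝ 1 φ) (hp : PerQ d m φ)
    (hi : Integrable (fun x => φ x ^ 2) (gibbs d m β Z V))
    (hi' : Integrable (fun x => fderiv ℝ φ x v ^ 2) (gibbs d m β Z V)) {ε : ℝ} (hε : 0 < ε) :
    Integrable (fun x => c x ^ 2 / (1 + ε * c x ^ 2) * φ x ^ 2) (gibbs d m β Z V) ∧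
    ∫ x, c x ^ 2 / (1 + ε * c x ^ 2) * φ x ^ 2 ∂gibbs d m β Z V ≤
      2 / β * ∫ x, φ x ^ 2 ∂gibbs d m β Z V +
        4 / β ^ 2 * ∫ x, fderiv ℝ φ x v ^ 2 ∂gibbs d m β Z V := by
  have hpos : ∀ y : ℝ, 0 < 1 + ε * y ^ 2 := fun y => by positivity
  have hηd : ∀ y : ℝ, HasDerivAt (fun y : ℝ => y / (1 + ε * y ^ 2))
      ((1 - ε * y ^ 2) / (1 + ε * y ^ 2) ^ 2) y := by
    intro y
    have h1 : HasDerivAt (fun y : ℝ => 1 + ε * y ^ 2) (ε * (2 * y)) y := by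
      simpa using ((hasDerivAt_pow 2 y).const_mul ε).const_add 1
    convert! (hasDerivAt_id y).div h1 (hpos y).ne' using 1
    simp; ring
  have hη1 : ∀ y : ℝ, |y / (1 + ε * y ^ 2)| ≤ 1 + 1 / ε := by
    intro y
    rw [abs_div, abs_of_pos (hpos y), div_le_iff₀ (hpos y)]
    have h2 : (1 + 1 / ε) * (1 + ε * y ^ 2) = 1 + 1 / ε + ε * y ^ 2 + y ^ 2 := by
      field_simp; ring
    have h3 : 0 < 1 / ε := by positivity
    have h4 : 0 ≤ ε * y ^ 2 := by positivity
    nlinarith [sq_nonneg (|y| - 1), sq_abs y]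
  have hη2 : ∀ y : ℝ, |(1 - ε * y ^ 2) / (1 + ε * y ^ 2) ^ 2| ≤ 1 := by
    intro y
    rw [abs_div, abs_of_pos (pow_pos (hpos y) 2), div_le_one (pow_pos (hpos y) 2), abs_le]
    have h4 : 0 ≤ ε * y ^ 2 := by positivity
    constructor <;> nlinarith
  have hη3 : ∀ y : ℝ, |y ^ 2 / (1 + ε * y ^ 2)| ≤ 1 / ε := by
    intro y
    rw [abs_of_nonneg (by have := hpos y; positivity), div_le_div_iff₀ (hpos y) hε]
    nlinarith
  have hη4 : ∀ y : ℝ, (y / (1 + ε * y ^ 2)) ^ 2 ≤ y ^ 2 / (1 + ε * y ^ 2) := by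
    intro y
    rw [div_pow, div_le_div_iff₀ (pow_pos (hpos y) 2) (hpos y)]
    have h4 : 0 ≤ ε * y ^ 2 := by positivity
    have : y ^ 2 * (1 + ε * y ^ 2) * 1 ≤ y ^ 2 * (1 + ε * y ^ 2) * (1 + ε * y ^ 2) := by
      gcongr; linarith
    nlinarith
  have hcc : ContDiff ℝ 1 (fun x : Xsp d m => c x) := c.contDiff
  have hηc : ContDiff ℝ 1 (fun x : Xsp d m => c x / (1 + ε * c x ^ 2)) :=
    hcc.div (contDiff_const.add (contDiff_const.mul (hcc.pow 2))) fun x => (hpos _).ne'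
  have hf : ContDiff ℝ 1 (fun x : Xsp d m => c x / (1 + ε * c x ^ 2) * φ x ^ 2) :=
    hηc.mul (hφ.pow 2)
  have hder : ∀ x, fderiv ℝ (fun x : Xsp d m => c x / (1 + ε * c x ^ 2) * φ x ^ 2) x v =
      (1 - ε * c x ^ 2) / (1 + ε * c x ^ 2) ^ 2 * φ x ^ 2 +
        c x / (1 + ε * c x ^ 2) * (2 * (φ x * fderiv ℝ φ x v)) := by
    intro x
    have h1 := (hηd (c x)).comp_hasFDerivAt x c.hasFDerivAt
    have h2 := ((hφ.differentiable (by norm_num) x).hasFDerivAt).pow 2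
    have h3 := h1.mul h2
    have h4 := h3.fderiv
    have h5 : (((fun y : ℝ => y / (1 + ε * y ^ 2)) ∘ ⇑c) * fun x => φ x ^ 2) =
      fun x : Xsp d m => c x / (1 + ε * c x ^ 2) * φ x ^ 2 := rfl
    rw [h5] at h4
    rw [h4]
    simp [hcv]
    ring
  have hφc := hφ.continuous
  have hDc : Continuous (fun x => fderiv ℝ φ x v) :=
    (hφ.continuous_fderiv (by norm_num)).clm_apply continuous_const
  have hcross : Integrable (fun x => φ x * fderiv ℝ φ x v) (gibbs d m β Z V) := by
    refine (hi.add hi').mono' (by fun_prop) (Eventually.of_forall fun x => ?_)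
    simp only [Pi.add_apply, Real.norm_eq_abs]
    rw [abs_le]
    constructor <;> nlinarith [sq_nonneg (φ x + fderiv ℝ φ x v), sq_nonneg (φ x - fderiv ℝ φ x v),
      sq_nonneg (φ x), sq_nonneg (fderiv ℝ φ x v)]
  have hbd : ∀ {g k : Xsp d m → ℝ} {C : ℝ}, Continuous g → (∀ x, |g x| ≤ C) →
      Integrable k (gibbs d m β Z V) → Integrable (fun x => g x * k x) (gibbs d m β Z V) :=
    fun {g k C} hg hC hk => hk.bdd_mul hg.aestronglyMeasurable (c := C)
      (Eventually.of_forall fun x => by simpa using hC x)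
  have hc1 : Continuous fun x : Xsp d m => (1 - ε * c x ^ 2) / (1 + ε * c x ^ 2) ^ 2 :=
    Continuous.div (by fun_prop) (by fun_prop) fun x => (pow_pos (hpos _) 2).ne'
  have hc3 : Continuous fun x : Xsp d m => c x ^ 2 / (1 + ε * c x ^ 2) :=
    Continuous.div (by fun_prop) (by fun_prop) fun x => (hpos _).ne'
  have i1 := hbd hηc.continuous (fun x => hη1 (c x)) hi
  have i2 := hbd hc1 (fun x => hη2 (c x)) hi
  have i3 := hbd hηc.continuous (fun x => hη1 (c x)) (hcross.const_mul 2)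
  have i4 := hbd hc3 (fun x => hη3 (c x)) hi
  refine ⟨i4, ?_⟩
  have hibp := integral_fderiv_gibbs hV hVp hZ (β := β) hf
    (fun k x => by simp only [hcp k x, hp k x]) v i1
    (by simp_rw [hder]; exact i2.add i3)
    (by
      refine i4.congr (Eventually.of_forall fun x => ?_)
      simp only [hc]; ring)
  have e1 : ∫ x, c x / (1 + ε * c x ^ 2) * φ x ^ 2 * dHam V x v ∂gibbs d m β Z V =
      ∫ x, c x ^ 2 / (1 + ε * c x ^ 2) * φ x ^ 2 ∂gibbs d m β Z V := by
    congr 1; funext x; rw [hc]; ring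
  rw [e1] at hibp
  simp_rw [hder] at hibp
  have hle : ∫ x, ((1 - ε * c x ^ 2) / (1 + ε * c x ^ 2) ^ 2 * φ x ^ 2 +
        c x / (1 + ε * c x ^ 2) * (2 * (φ x * fderiv ℝ φ x v))) ∂gibbs d m β Z V ≤
      ∫ x, (φ x ^ 2 + β / 2 * (c x ^ 2 / (1 + ε * c x ^ 2) * φ x ^ 2) +
        2 / β * fderiv ℝ φ x v ^ 2) ∂gibbs d m β Z V := by
    refine integral_mono (i2.add i3) ((hi.add (i4.const_mul _)).add (hi'.const_mul _)) fun x => ?_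
    have a1 : (1 - ε * c x ^ 2) / (1 + ε * c x ^ 2) ^ 2 * φ x ^ 2 ≤ 1 * φ x ^ 2 :=
      mul_le_mul_of_nonneg_right ((le_abs_self _).trans (hη2 _)) (sq_nonneg _)
    have a2 := mul_le_mul_of_nonneg_right (hη4 (c x)) (sq_nonneg (φ x))
    set η := c x / (1 + ε * c x ^ 2)
    have a3 : η * (2 * (φ x * fderiv ℝ φ x v)) ≤
        β / 2 * (η ^ 2 * φ x ^ 2) + 2 / β * fderiv ℝ φ x v ^ 2 := by
      have : β / 2 * (η ^ 2 * φ x ^ 2) + 2 / β * fderiv ℝ φ x v ^ 2 -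
        η * (2 * (φ x * fderiv ℝ φ x v)) = β / 2 * (η * φ x - 2 / β * fderiv ℝ φ x v) ^ 2 := by
        field_simp; ring
      have h0 : 0 ≤ β / 2 * (η * φ x - 2 / β * fderiv ℝ φ x v) ^ 2 := by positivity
      linarith
    have a4 := mul_le_mul_of_nonneg_left a2 (by positivity : 0 ≤ β / 2)
    dsimp only
    linarith
  have i5 : Integrable (fun x => φ x ^ 2 + β / 2 * (c x ^ 2 / (1 + ε * c x ^ 2) * φ x ^ 2))
    (gibbs d m β Z V) := hi.add (i4.const_mul _)
  rw [integral_add i5 (hi'.const_mul _), integral_add hi (i4.const_mul _),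
    integral_const_mul, integral_const_mul, hibp] at hle
  set A := ∫ x, c x ^ 2 / (1 + ε * c x ^ 2) * φ x ^ 2 ∂gibbs d m β Z V
  set B := ∫ x, φ x ^ 2 ∂gibbs d m β Z V
  set D := ∫ x, fderiv ℝ φ x v ^ 2 ∂gibbs d m β Z V
  have h6 : A - (2 / β * B + 4 / β ^ 2 * D) =
      2 / β * (β * A - (B + β / 2 * A + 2 / β * D)) := by
    field_simp; ring
  have h7 : 2 / β * (β * A - (B + β / 2 * A + 2 / β * D)) ≤ 0 :=
    mul_nonpos_of_nonneg_of_nonpos (by positivity) (by linarith)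
  linarith

/-- Multiplication by a coordinate is controlled by the `H¹(μ_β)` norm. -/
theorem lintegral_weighted_sq_le (hβ : 0 < β) (hV : ContDiff ℝ 2 V) (hVp : PerV d V) (hZ : 0 < Z)
    {c : Xsp d m →L[ℝ] ℝ} {v : Xsp d m} (hcv : c v = 1) (hcp : PerQ d m c)
    (hc : ∀ x, dHam V x v = c x) {φ : Xsp d m → ℝ} (hφ : ContDiff ℝ 1 φ) (hp : PerQ d m φ) :
    ∫⁻ x, ENNReal.ofReal ((c x * φ x) ^ 2) ∂gibbs d m β Z V ≤
      ENNReal.ofReal (2 / β) * ∫⁻ x, ENNReal.ofReal (φ x ^ 2) ∂gibbs d m β Z V +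
      ENNReal.ofReal (4 / β ^ 2) *
        ∫⁻ x, ENNReal.ofReal (fderiv ℝ φ x v ^ 2) ∂gibbs d m β Z V := by
  have hφc := hφ.continuous
  have hDc : Continuous (fun x => fderiv ℝ φ x v) :=
    (hφ.continuous_fderiv (by norm_num)).clm_apply continuous_const
  by_cases h1 : ∫⁻ x, ENNReal.ofReal (φ x ^ 2) ∂gibbs d m β Z V = ⊤
  · rw [h1, ENNReal.mul_top (by simp [hβ])]; simp
  by_cases h2 : ∫⁻ x, ENNReal.ofReal (fderiv ℝ φ x v ^ 2) ∂gibbs d m β Z V = ⊤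
  · rw [h2, ENNReal.mul_top (by simp; positivity)]; simp
  have hi : Integrable (fun x => φ x ^ 2) (gibbs d m β Z V) := by
    refine ⟨by fun_prop, ?_⟩
    rw [hasFiniteIntegral_iff_ofReal (Eventually.of_forall fun x => sq_nonneg _)]
    exact lt_top_iff_ne_top.2 h1
  have hi' : Integrable (fun x => fderiv ℝ φ x v ^ 2) (gibbs d m β Z V) := by
    refine ⟨by fun_prop, ?_⟩
    rw [hasFiniteIntegral_iff_ofReal (Eventually.of_forall fun x => sq_nonneg _)]
    exact lt_top_iff_ne_top.2 h2
  rw [← ofReal_integral_eq_lintegral_ofReal hi (Eventually.of_forall fun x => sq_nonneg _),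
    ← ofReal_integral_eq_lintegral_ofReal hi' (Eventually.of_forall fun x => sq_nonneg _),
    ← ENNReal.ofReal_mul (by positivity), ← ENNReal.ofReal_mul (by positivity),
    ← ENNReal.ofReal_add (mul_nonneg (by positivity) (integral_nonneg fun x => sq_nonneg _))
      (mul_nonneg (by positivity) (integral_nonneg fun x => sq_nonneg _))]
  have hlim : ∀ x, Tendsto (fun n : ℕ => ENNReal.ofReal
      (c x ^ 2 / (1 + (1 / ((n : ℝ) + 1)) * c x ^ 2) * φ x ^ 2)) atTop
      (nhds (ENNReal.ofReal ((c x * φ x) ^ 2))) := by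
    intro x
    refine (ENNReal.continuous_ofReal.tendsto _).comp ?_
    have h3 : Tendsto (fun n : ℕ => c x ^ 2 / (1 + (1 / ((n : ℝ) + 1)) * c x ^ 2) * φ x ^ 2) atTop
        (nhds (c x ^ 2 / (1 + 0 * c x ^ 2) * φ x ^ 2)) := by
      refine Tendsto.mul_const _ (Tendsto.div tendsto_const_nhds (tendsto_const_nhds.add
        (Tendsto.mul_const _ tendsto_one_div_add_atTop_nhds_zero_nat)) (by simp))
    convert! h3 using 2
    simp; ring
  have hfatou := lintegral_liminf_le (u := atTop) (μ := gibbs d m β Z V)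
    (f := fun (n : ℕ) (x : Xsp d m) =>
      ENNReal.ofReal (c x ^ 2 / (1 + (1 / ((n : ℝ) + 1)) * c x ^ 2) * φ x ^ 2)) (fun n => by
      have : Measurable fun x : Xsp d m => c x := c.continuous.measurable
      fun_prop)
  have e : ∀ x, liminf (fun n : ℕ => ENNReal.ofReal
      (c x ^ 2 / (1 + (1 / ((n : ℝ) + 1)) * c x ^ 2) * φ x ^ 2)) atTop =
      ENNReal.ofReal ((c x * φ x) ^ 2) := fun x => (hlim x).liminf_eq
  simp_rw [e] at hfatou
  refine hfatou.trans ?_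
  refine (liminf_le_liminf (v := fun _ => ENNReal.ofReal
      (2 / β * ∫ x, φ x ^ 2 ∂gibbs d m β Z V +
        4 / β ^ 2 * ∫ x, fderiv ℝ φ x v ^ 2 ∂gibbs d m β Z V))
    (Eventually.of_forall fun n => ?_)).trans (by simp)
  have h4 := weighted_sq_truncated hβ hV hVp hZ hcv hcp hc hφ hp hi hi'
    (ε := 1 / ((n : ℝ) + 1)) (by positivity)
  rw [← ofReal_integral_eq_lintegral_ofReal h4.1 (Eventually.of_forall fun x => by positivity)]
  exact ENNReal.ofReal_le_ofReal h4.2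

end Gibbs

section Directions

variable {d m : ℕ}

/-- The unit vector in the direction `q_k`. -/
def eQ (d m : ℕ) (k : Fin d) : Xsp d m := (Pi.single k 1, 0, 0)

/-- The unit vector in the direction `p_k`. -/
def eP (d m : ℕ) (k : Fin d) : Xsp d m := (0, Pi.single k 1, 0)

/-- The unit vector in the direction `z_{j,k}`. -/
def eZ (d m : ℕ) (j : Fin m) (k : Fin d) : Xsp d m := zdir d m j (Pi.single k 1)

theorem sum_smul_basis (v : Xsp d m) :
    v = ∑ k, v.1 k • eQ d m k + ∑ k, v.2.1 k • eP d m k + ∑ j, ∑ k, v.2.2 j k • eZ d m j k := by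
  refine Prod.ext ?_ (Prod.ext ?_ ?_)
  · ext i
    simp [eQ, eP, eZ, zdir, Prod.fst_sum, Finset.sum_apply, Pi.single_apply]
  · ext i
    simp [eQ, eP, eZ, zdir, Prod.fst_sum, Prod.snd_sum, Finset.sum_apply, Pi.single_apply]
  · ext j i
    simp [eQ, eP, eZ, zdir, Prod.snd_sum, Finset.sum_apply, Function.update_apply, Pi.single_apply]

theorem apply_eq_sum (L : Xsp d m →L[ℝ] ℝ) (v : Xsp d m) :
    L v = ∑ k, v.1 k * L (eQ d m k) + ∑ k, v.2.1 k * L (eP d m k) +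
      ∑ j, ∑ k, v.2.2 j k * L (eZ d m j k) := by
  conv_lhs => rw [sum_smul_basis v]
  simp [map_add, map_sum]

theorem zdir_fst (j : Fin m) (v : Fin d → ℝ) : (zdir d m j v).1 = 0 := rfl

theorem zdir_snd_fst (j : Fin m) (v : Fin d → ℝ) : (zdir d m j v).2.1 = 0 := rfl

theorem apply_zdir (L : Xsp d m →L[ℝ] ℝ) (j : Fin m) (v : Fin d → ℝ) :
    L (zdir d m j v) = ∑ k, v k * L (eZ d m j k) := by
  rw [apply_eq_sum L]
  simp only [zdir_fst, zdir_snd_fst, Pi.zero_apply, zero_mul, Finset.sum_const_zero, zero_add]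
  rw [Finset.sum_eq_single j]
  · simp [zdir]
  · intro i _ hi
    simp [zdir, Function.update_of_ne hi]
  · simp

theorem apply_eQ_dir (L : Xsp d m →L[ℝ] ℝ) (v : Fin d → ℝ) :
    L (v, 0, 0) = ∑ k, v k * L (eQ d m k) := by
  rw [apply_eq_sum L]; simp

theorem apply_eP_dir (L : Xsp d m →L[ℝ] ℝ) (v : Fin d → ℝ) :
    L (0, v, 0) = ∑ k, v k * L (eP d m k) := by
  rw [apply_eq_sum L]; simp

theorem dHam_eQ (V : (Fin d → ℝ) → ℝ) (x : Xsp d m) (k : Fin d) :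
    dHam V x (eQ d m k) = fderiv ℝ V x.1 (Pi.single k 1) := by
  simp [dHam, eQ]

theorem dHam_eP (V : (Fin d → ℝ) → ℝ) (x : Xsp d m) (k : Fin d) :
    dHam V x (eP d m k) = x.2.1 k := by
  simp [dHam, eP, Pi.single_apply]

theorem dHam_eZ (V : (Fin d → ℝ) → ℝ) (x : Xsp d m) (j : Fin m) (k : Fin d) :
    dHam V x (eZ d m j k) = x.2.2 j k := by
  simp [dHam, eZ, zdir, Function.update_apply, Pi.single_apply, ite_apply]

/-- The generator in coordinates, as a Hamiltonian part plus a diffusive part. -/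
theorem gen_eq (β : ℝ) (α lam : Fin m → ℝ) (V : (Fin d → ℝ) → ℝ) (φ : Xsp d m → ℝ)
    (x : Xsp d m) :
    gen d m β α lam V φ x =
      ∑ k, (dHam V x (eQ d m k) * fderiv ℝ φ x (eP d m k) -
        dHam V x (eP d m k) * fderiv ℝ φ x (eQ d m k)) +
      ∑ j, ∑ k, lam j * (dHam V x (eP d m k) * fderiv ℝ φ x (eZ d m j k) -
        dHam V x (eZ d m j k) * fderiv ℝ φ x (eP d m k)) +
      ∑ j, ∑ k, α j * (dHam V x (eZ d m j k) * fderiv ℝ φ x (eZ d m j k) -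
        β⁻¹ * fderiv ℝ (fun y => fderiv ℝ φ y (eZ d m j k)) x (eZ d m j k)) := by
  have hz : ∀ j k, fderiv ℝ (pZ d m j k φ) x (zdir d m j (Pi.single k 1)) =
    fderiv ℝ (fun y => fderiv ℝ φ y (eZ d m j k)) x (eZ d m j k) := fun j k => rfl
  simp only [gen, hz, apply_zdir, apply_eQ_dir, apply_eP_dir, dHam_eQ, dHam_eP, dHam_eZ,
    Finset.sum_sub_distrib, mul_sub, Finset.mul_sum, Finset.sum_apply, Pi.smul_apply, smul_eq_mul,
    Finset.sum_mul]
  rw [Finset.sum_comm (f := fun (i : Fin d) (j : Fin m) =>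
    lam j * x.2.2 j i * fderiv ℝ φ x (eP d m i))]
  simp only [mul_assoc, mul_left_comm β⁻¹]
  ring

theorem contDiff_dHam {V : (Fin d → ℝ) → ℝ} (hV : ContDiff ℝ 2 V) (v : Xsp d m) :
    ContDiff ℝ 1 fun x : Xsp d m => dHam V x v := by
  unfold dHam
  have h1 : ContDiff ℝ 1 fun x : Xsp d m => fderiv ℝ V x.1 v.1 :=
    ((hV.fderiv_right (m := 1) (by norm_num)).comp contDiff_fst).clm_apply contDiff_const
  have h2 : ∀ i, ContDiff ℝ 1 fun x : Xsp d m => x.2.1 i * v.2.1 i := fun i => by fun_prop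
  have h3 : ∀ j i, ContDiff ℝ 1 fun x : Xsp d m => x.2.2 j i * v.2.2 j i := fun j i => by fun_prop
  exact (h1.add (ContDiff.sum fun i _ => h2 i)).add
    (ContDiff.sum fun j _ => ContDiff.sum fun i _ => h3 j i)

theorem PerV.fderiv_eq {V : (Fin d → ℝ) → ℝ} (hV : PerV d V) (k : Fin d → ℤ) (q : Fin d → ℝ) :
    fderiv ℝ V (q + fun i => (k i : ℝ)) = fderiv ℝ V q := by
  have h2 := fderiv_comp_add_right (𝕜 := ℝ) (f := V) (x := q) (fun i => (k i : ℝ))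
  have h : (fun y => V (y + fun i => (k i : ℝ))) = V := funext fun y => hV k y
  rw [← h2, h]

theorem perQ_dHam {V : (Fin d → ℝ) → ℝ} (hV : PerV d V) (v : Xsp d m) :
    PerQ d m fun x => dHam V x v := fun k x => by
  simp only [dHam, hV.fderiv_eq k x.1]

theorem fderiv_eq_zero_of_line {f : Xsp d m → ℝ} {x v : Xsp d m} (hf : DifferentiableAt ℝ f x)
    (h : ∀ r : ℝ, f (x + r • v) = f x) : fderiv ℝ f x v = 0 := by
  have hd : HasDerivAt (fun r : ℝ => x + r • v) v 0 := by
    simpa using ((hasDerivAt_id (0:ℝ)).smul_const v).const_add x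
  have h1 : HasFDerivAt f (fderiv ℝ f x) (x + (0:ℝ) • v) := by simpa using hf.hasFDerivAt
  have h2 := h1.comp_hasDerivAt (0:ℝ) hd
  have h3 : (f ∘ fun r : ℝ => x + r • v) = fun _ => f x := funext h
  rw [h3] at h2
  exact h2.unique (hasDerivAt_const _ _)

/-- The directions along which the Hamiltonian vector fields are divergence free. -/
def Conj (V : (Fin d → ℝ) → ℝ) (v w : Xsp d m) : Prop :=
  (∀ (x : Xsp d m) (r : ℝ), dHam V (x + r • v) w = dHam V x w) ∧
    ∀ (x : Xsp d m) (r : ℝ), dHam V (x + r • w) v = dHam V x v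

theorem conj_eP_eQ (V : (Fin d → ℝ) → ℝ) (k : Fin d) : Conj V (eP d m k) (eQ d m k) := by
  constructor <;> intro x r
  · simp only [dHam_eQ]; simp [eP]
  · simp only [dHam_eP]; simp [eQ]

theorem conj_eP_eZ (V : (Fin d → ℝ) → ℝ) (j : Fin m) (k : Fin d) :
    Conj V (eP d m k) (eZ d m j k) := by
  constructor <;> intro x r
  · simp only [dHam_eZ]; simp [eP]
  · simp only [dHam_eP]; simp [eZ, zdir]

end Directions

section Slices

variable {d m : ℕ} {β Z : ℝ} {V : (Fin d → ℝ) → ℝ}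

/-- The squared `L²` norm, as an extended nonnegative number. -/
def sqNorm (μ : Measure (Xsp d m)) (f : Xsp d m → ℝ) : ENNReal :=
  ∫⁻ x, ENNReal.ofReal (f x ^ 2) ∂μ

/-- Multiplication by the derivative of the Hamiltonian along `v` costs one derivative. -/
def Tame (μ : Measure (Xsp d m)) (V : (Fin d → ℝ) → ℝ) (v : Xsp d m) : Prop :=
  ∃ C : NNReal, ∀ φ : Xsp d m → ℝ, ContDiff ℝ 1 φ → PerQ d m φ →
    sqNorm μ (fun x => dHam V x v * φ x) ≤ C * (sqNorm μ φ + sqNorm μ (fun x => fderiv ℝ φ x v))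

theorem memLp_two_of_sqNorm {μ : Measure (Xsp d m)} {f : Xsp d m → ℝ}
    (hf : AEStronglyMeasurable f μ) (h : sqNorm μ f < ⊤) : MemLp f 2 μ := by
  rw [memLp_two_iff_integrable_sq hf]
  refine ⟨hf.pow 2, ?_⟩
  rwa [hasFiniteIntegral_iff_ofReal (Eventually.of_forall fun x => sq_nonneg _)]

theorem sqNorm_eq_ofReal {μ : Measure (Xsp d m)} {f : Xsp d m → ℝ}
    (h : Integrable (fun x => f x ^ 2) μ) : sqNorm μ f = ENNReal.ofReal (∫ x, f x ^ 2 ∂μ) :=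
  (ofReal_integral_eq_lintegral_ofReal h (Eventually.of_forall fun _ => sq_nonneg _)).symm

theorem MeasureTheory.MemLp.sqNorm_lt_top {μ : Measure (Xsp d m)} {f : Xsp d m → ℝ}
    (h : MemLp f 2 μ) : sqNorm μ f < ⊤ := by
  rw [sqNorm_eq_ofReal h.integrable_sq]
  exact ENNReal.ofReal_lt_top

theorem sqNorm_mul_le {μ : Measure (Xsp d m)} {c f : Xsp d m → ℝ} {M : ℝ}
    (hc : ∀ x, |c x| ≤ M) :
    sqNorm μ (fun x => c x * f x) ≤ (M ^ 2).toNNReal * sqNorm μ f := by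
  rw [sqNorm, sqNorm, ← lintegral_const_mul' _ _ ENNReal.coe_ne_top]
  refine lintegral_mono fun x => ?_
  change _ ≤ ENNReal.ofReal (M ^ 2) * _
  rw [← ENNReal.ofReal_mul (sq_nonneg M), mul_pow]
  refine ENNReal.ofReal_le_ofReal (mul_le_mul_of_nonneg_right ?_ (sq_nonneg _))
  exact sq_le_sq' (abs_le.1 (hc x)).1 (abs_le.1 (hc x)).2

theorem sqNorm_add_le {μ : Measure (Xsp d m)} {f g : Xsp d m → ℝ}
    (hf : AEStronglyMeasurable f μ) :
    sqNorm μ (fun x => f x + g x) ≤ 2 * (sqNorm μ f + sqNorm μ g) := by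
  rw [sqNorm, sqNorm, sqNorm, ← lintegral_add_left' (by fun_prop),
    ← lintegral_const_mul' _ _ (by simp)]
  refine lintegral_mono fun x => ?_
  rw [← ENNReal.ofReal_add (sq_nonneg _) (sq_nonneg _),
    show (2 : ENNReal) = ENNReal.ofReal 2 by simp, ← ENNReal.ofReal_mul (by norm_num)]
  refine ENNReal.ofReal_le_ofReal ?_
  nlinarith [sq_nonneg (f x - g x)]

theorem exists_bound_fderiv (hV : ContDiff ℝ 2 V) (hVp : PerV d V) (k : Fin d) :
    ∃ M : ℝ, 0 ≤ M ∧ ∀ q, |fderiv ℝ V q (Pi.single k 1)| ≤ M :=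
  exists_bound_of_periodic
    ((hV.continuous_fderiv (by norm_num)).clm_apply continuous_const)
    fun k q => by rw [hVp.fderiv_eq]

theorem tame_eQ (hV : ContDiff ℝ 2 V) (hVp : PerV d V) (k : Fin d) :
    Tame (gibbs d m β Z V) V (eQ d m k) := by
  obtain ⟨M, -, hM⟩ := exists_bound_fderiv hV hVp k
  refine ⟨(M ^ 2).toNNReal, fun φ _ _ => ?_⟩
  refine (sqNorm_mul_le fun _ => by rw [dHam_eQ]; exact hM _).trans ?_
  gcongr
  exact le_self_add

theorem tame_of_linear (hβ : 0 < β) (hV : ContDiff ℝ 2 V) (hVp : PerV d V) (hZ : 0 < Z)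
    {c : Xsp d m →L[ℝ] ℝ} {v : Xsp d m} (hcv : c v = 1) (hcp : PerQ d m c)
    (hc : ∀ x, dHam V x v = c x) : Tame (gibbs d m β Z V) V v := by
  refine ⟨(2 / β + 4 / β ^ 2).toNNReal, fun φ hφ hp => ?_⟩
  simp only [hc]
  refine (lintegral_weighted_sq_le hβ hV hVp hZ hcv hcp hc hφ hp).trans ?_
  change _ ≤ ENNReal.ofReal _ * _
  rw [mul_add]
  have h1 : 0 < 2 / β := by positivity
  have h2 : 0 < 4 / β ^ 2 := by positivity
  refine add_le_add (mul_le_mul_left (ENNReal.ofReal_le_ofReal ?_) _)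
    (mul_le_mul_left (ENNReal.ofReal_le_ofReal ?_) _) <;> linarith

theorem tame_eP (hβ : 0 < β) (hV : ContDiff ℝ 2 V) (hVp : PerV d V) (hZ : 0 < Z) (k : Fin d) :
    Tame (gibbs d m β Z V) V (eP d m k) := by
  refine tame_of_linear hβ hV hVp hZ (c := (ContinuousLinearMap.proj k).comp
    ((ContinuousLinearMap.fst ℝ _ _).comp (ContinuousLinearMap.snd ℝ _ _))) ?_ ?_ ?_
  · simp [eP]
  · intro k x; rfl
  · intro x; rw [dHam_eP]; rfl

theorem tame_eZ (hβ : 0 < β) (hV : ContDiff ℝ 2 V) (hVp : PerV d V) (hZ : 0 < Z) (j : Fin m)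
    (k : Fin d) : Tame (gibbs d m β Z V) V (eZ d m j k) := by
  refine tame_of_linear hβ hV hVp hZ (c :=
    ((ContinuousLinearMap.proj (R := ℝ) (φ := fun _ : Fin d => ℝ) k).comp
    (ContinuousLinearMap.proj (R := ℝ) (φ := fun _ : Fin m => Fin d → ℝ) j)).comp
    ((ContinuousLinearMap.snd ℝ _ _).comp (ContinuousLinearMap.snd ℝ _ _))) ?_ ?_ ?_
  · simp [eZ, zdir]
  · intro k x; rfl
  · intro x; rw [dHam_eZ]; rfl

theorem Tame.memLp {v : Xsp d m} (h : Tame (gibbs d m β Z V) V v) (hV : ContDiff ℝ 2 V)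
    {φ : Xsp d m → ℝ} (hφ : ContDiff ℝ 1 φ) (hp : PerQ d m φ)
    (h0 : MemLp φ 2 (gibbs d m β Z V))
    (h1 : MemLp (fun x => fderiv ℝ φ x v) 2 (gibbs d m β Z V)) :
    MemLp (fun x => dHam V x v * φ x) 2 (gibbs d m β Z V) := by
  obtain ⟨C, hC⟩ := h
  refine memLp_two_of_sqNorm
    (((contDiff_dHam hV v).continuous.mul hφ.continuous).aestronglyMeasurable) ?_
  refine (hC φ hφ hp).trans_lt (ENNReal.mul_lt_top ENNReal.coe_lt_top ?_)
  exact ENNReal.add_lt_top.2 ⟨h0.sqNorm_lt_top, h1.sqNorm_lt_top⟩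

/-- A function with two periodic square integrable derivatives. -/
structure TwiceL2 (μ : Measure (Xsp d m)) (φ : Xsp d m → ℝ) : Prop where
  contDiff : ContDiff ℝ 2 φ
  perQ : PerQ d m φ
  memLp : MemLp φ 2 μ
  memLp_fderiv : ∀ v, MemLp (fun x => fderiv ℝ φ x v) 2 μ
  memLp_fderiv_fderiv : ∀ v w, MemLp (fun x => fderiv ℝ (fun y => fderiv ℝ φ y v) x w) 2 μ

theorem contDiff_fderiv_apply {φ : Xsp d m → ℝ} (h : ContDiff ℝ 2 φ) (v : Xsp d m) :
    ContDiff ℝ 1 fun x => fderiv ℝ φ x v :=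
  (h.fderiv_right (m := 1) (by norm_num)).clm_apply contDiff_const

theorem integral_dHam_mul_mul_fderiv (hV : ContDiff ℝ 2 V) (hVp : PerV d V) (hZ : 0 < Z)
    {φ : Xsp d m → ℝ} (h : TwiceL2 (gibbs d m β Z V) φ) {v w : Xsp d m}
    (hv : Tame (gibbs d m β Z V) V v) (hw : Tame (gibbs d m β Z V) V w)
    (hvw : ∀ (x : Xsp d m) (r : ℝ), dHam V (x + r • v) w = dHam V x w) :
    2 * ∫ x, φ x * (dHam V x w * fderiv ℝ φ x v) ∂gibbs d m β Z V =
      β * ∫ x, dHam V x w * φ x * (dHam V x v * φ x) ∂gibbs d m β Z V := by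
  have hφ1 := h.contDiff.of_le (m := 1) (by norm_num)
  have hD : ∀ x, fderiv ℝ (fun y => dHam V y w * (φ y * φ y)) x v =
      2 * (φ x * (dHam V x w * fderiv ℝ φ x v)) := fun x => by
    have h1 : DifferentiableAt ℝ φ x := hφ1.differentiable (by norm_num) x
    have h2 : DifferentiableAt ℝ (fun y => dHam V y w) x :=
      (contDiff_dHam hV w).differentiable (by norm_num) x
    have h3 := fderiv_eq_zero_of_line h2 (hvw x)
    rw [fderiv_fun_mul h2 (h1.fun_mul h1), fderiv_fun_mul h1 h1]
    simp only [add_apply, smul_apply, smul_eq_mul, h3]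
    ring
  have hwφ := hw.memLp hV hφ1 h.perQ h.memLp (h.memLp_fderiv w)
  have hvφ := hv.memLp hV hφ1 h.perQ h.memLp (h.memLp_fderiv v)
  have := integral_fderiv_gibbs (β := β) hV hVp hZ (f := fun y => dHam V y w * (φ y * φ y))
    ((contDiff_dHam hV w).mul (hφ1.mul hφ1))
    ((perQ_dHam hVp w).mul (h.perQ.mul h.perQ)) v ?_ ?_ ?_
  · simp_rw [hD] at this
    rw [← integral_const_mul, this]
    congr 2
    funext x
    ring
  · refine (hwφ.integrable_mul h.memLp).congr (Eventually.of_forall fun x => ?_)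
    simp only [Pi.mul_apply]; ring
  · simp_rw [hD]
    refine ((hwφ.integrable_mul (h.memLp_fderiv v)).const_mul 2).congr
      (Eventually.of_forall fun x => ?_)
    simp only [Pi.mul_apply]; ring
  · refine (hwφ.integrable_mul hvφ).congr (Eventually.of_forall fun x => ?_)
    simp only [Pi.mul_apply]; ring

theorem integrable_mul_dHam_mul_fderiv (hV : ContDiff ℝ 2 V)
    {φ : Xsp d m → ℝ} (h : TwiceL2 (gibbs d m β Z V) φ) (v : Xsp d m) {w : Xsp d m}
    (hw : Tame (gibbs d m β Z V) V w) :
    Integrable (fun x => φ x * (dHam V x w * fderiv ℝ φ x v)) (gibbs d m β Z V) :=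
  h.memLp.integrable_mul (hw.memLp hV (contDiff_fderiv_apply h.contDiff v)
    (h.perQ.fderiv_apply v) (h.memLp_fderiv v) (h.memLp_fderiv_fderiv v w))

theorem integral_mul_poisson_bracket (hV : ContDiff ℝ 2 V) (hVp : PerV d V) (hZ : 0 < Z)
    {φ : Xsp d m → ℝ} (h : TwiceL2 (gibbs d m β Z V) φ) {v w : Xsp d m}
    (hv : Tame (gibbs d m β Z V) V v) (hw : Tame (gibbs d m β Z V) V w) (hvw : Conj V v w) :
    ∫ x, (φ x * (dHam V x w * fderiv ℝ φ x v) - φ x * (dHam V x v * fderiv ℝ φ x w))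
      ∂gibbs d m β Z V = 0 := by
  rw [integral_sub (integrable_mul_dHam_mul_fderiv hV h v hw)
    (integrable_mul_dHam_mul_fderiv hV h w hv)]
  have h1 := integral_dHam_mul_mul_fderiv hV hVp hZ h hv hw hvw.1
  have h2 := integral_dHam_mul_mul_fderiv hV hVp hZ h hw hv hvw.2
  have h3 : ∫ x, dHam V x w * φ x * (dHam V x v * φ x) ∂gibbs d m β Z V =
      ∫ x, dHam V x v * φ x * (dHam V x w * φ x) ∂gibbs d m β Z V := by
    congr 1; funext x; ring
  rw [h3] at h1
  linarith

theorem integral_mul_diffusion (hβ : 0 < β) (hV : ContDiff ℝ 2 V) (hVp : PerV d V) (hZ : 0 < Z)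
    {φ : Xsp d m → ℝ} (h : TwiceL2 (gibbs d m β Z V) φ) {v : Xsp d m}
    (hv : Tame (gibbs d m β Z V) V v) :
    ∫ x, (φ x * (dHam V x v * fderiv ℝ φ x v) -
      β⁻¹ * (φ x * fderiv ℝ (fun y => fderiv ℝ φ y v) x v)) ∂gibbs d m β Z V =
      β⁻¹ * ∫ x, fderiv ℝ φ x v ^ 2 ∂gibbs d m β Z V := by
  have hφ1 := h.contDiff.of_le (m := 1) (by norm_num)
  have hφ2 := contDiff_fderiv_apply h.contDiff v
  have hi2 : Integrable (fun x => φ x * fderiv ℝ (fun y => fderiv ℝ φ y v) x v)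
      (gibbs d m β Z V) := h.memLp.integrable_mul (h.memLp_fderiv_fderiv v v)
  have hi1 := (h.memLp_fderiv v).integrable_sq
  have hD : ∀ x, fderiv ℝ (fun y => φ y * fderiv ℝ φ y v) x v =
      φ x * fderiv ℝ (fun y => fderiv ℝ φ y v) x v + fderiv ℝ φ x v ^ 2 := fun x => by
    rw [fderiv_fun_mul (hφ1.differentiable (by norm_num) x)
      (hφ2.differentiable (by norm_num) x)]
    simp only [add_apply, smul_apply, smul_eq_mul]
    ring
  have := integral_fderiv_gibbs (β := β) hV hVp hZ (f := fun y => φ y * fderiv ℝ φ y v)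
    (hφ1.mul hφ2) (h.perQ.mul (h.perQ.fderiv_apply v)) v
    (h.memLp.integrable_mul (h.memLp_fderiv v)) (by simp_rw [hD]; exact hi2.add hi1) ?_
  · simp_rw [hD] at this
    rw [integral_add hi2 hi1] at this
    rw [integral_sub (integrable_mul_dHam_mul_fderiv hV h v hv) (hi2.const_mul _),
      integral_const_mul]
    have e : ∫ x, φ x * fderiv ℝ φ x v * dHam V x v ∂gibbs d m β Z V =
        ∫ x, φ x * (dHam V x v * fderiv ℝ φ x v) ∂gibbs d m β Z V := by
      congr 1; funext x; ring
    rw [e] at this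
    rw [eq_inv_mul_iff_mul_eq₀ hβ.ne', mul_sub, mul_inv_cancel_left₀ hβ.ne']
    linarith
  · refine (integrable_mul_dHam_mul_fderiv hV h v hv).congr (Eventually.of_forall fun x => ?_)
    ring

/-- The Dirichlet form of the generator. -/
def dirichlet (β : ℝ) (α : Fin m → ℝ) (μ : Measure (Xsp d m)) (φ : Xsp d m → ℝ) : ℝ :=
  ∑ j, ∑ k, α j * (β⁻¹ * ∫ x, fderiv ℝ φ x (eZ d m j k) ^ 2 ∂μ)

/-- The transport part of the generator is antisymmetric, the diffusive part is symmetric. -/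
theorem integral_mul_gen (hβ : 0 < β) (hV : ContDiff ℝ 2 V) (hVp : PerV d V) (hZ : 0 < Z)
    (α lam : Fin m → ℝ) {φ : Xsp d m → ℝ} (h : TwiceL2 (gibbs d m β Z V) φ) :
    Integrable (fun x => φ x * gen d m β α lam V φ x) (gibbs d m β Z V) ∧
    ∫ x, φ x * gen d m β α lam V φ x ∂gibbs d m β Z V =
      dirichlet β α (gibbs d m β Z V) φ := by
  have tQ : ∀ k, Tame (gibbs d m β Z V) V (eQ d m k) := tame_eQ hV hVp
  have tP : ∀ k, Tame (gibbs d m β Z V) V (eP d m k) := tame_eP hβ hV hVp hZ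
  have tZ : ∀ j k, Tame (gibbs d m β Z V) V (eZ d m j k) := tame_eZ hβ hV hVp hZ
  have hg : ∀ x, φ x * gen d m β α lam V φ x =
      ∑ k, (φ x * (dHam V x (eQ d m k) * fderiv ℝ φ x (eP d m k)) -
        φ x * (dHam V x (eP d m k) * fderiv ℝ φ x (eQ d m k))) +
      ∑ j, ∑ k, lam j * -(φ x * (dHam V x (eZ d m j k) * fderiv ℝ φ x (eP d m k)) -
        φ x * (dHam V x (eP d m k) * fderiv ℝ φ x (eZ d m j k))) +
      ∑ j, ∑ k, α j * (φ x * (dHam V x (eZ d m j k) * fderiv ℝ φ x (eZ d m j k)) -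
        β⁻¹ * (φ x * fderiv ℝ (fun y => fderiv ℝ φ y (eZ d m j k)) x (eZ d m j k))) := fun x => by
    rw [gen_eq, mul_add, mul_add]
    simp only [Finset.mul_sum]
    congr 1
    · congr 1
      · exact Finset.sum_congr rfl fun k _ => by ring
      · exact Finset.sum_congr rfl fun j _ => Finset.sum_congr rfl fun k _ => by ring
    · exact Finset.sum_congr rfl fun j _ => Finset.sum_congr rfl fun k _ => by ring
  have i1 : ∀ k, Integrable (fun x => φ x * (dHam V x (eQ d m k) * fderiv ℝ φ x (eP d m k)) -
        φ x * (dHam V x (eP d m k) * fderiv ℝ φ x (eQ d m k))) (gibbs d m β Z V) := fun k =>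
    (integrable_mul_dHam_mul_fderiv hV h _ (tQ k)).sub
      (integrable_mul_dHam_mul_fderiv hV h _ (tP k))
  have i2 : ∀ j k, Integrable (fun x => lam j *
      -(φ x * (dHam V x (eZ d m j k) * fderiv ℝ φ x (eP d m k)) -
        φ x * (dHam V x (eP d m k) * fderiv ℝ φ x (eZ d m j k)))) (gibbs d m β Z V) := fun j k =>
    ((integrable_mul_dHam_mul_fderiv hV h _ (tZ j k)).sub
      (integrable_mul_dHam_mul_fderiv hV h _ (tP k))).neg.const_mul _
  have i3 : ∀ j k, Integrable (fun x => α j *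
      (φ x * (dHam V x (eZ d m j k) * fderiv ℝ φ x (eZ d m j k)) -
        β⁻¹ * (φ x * fderiv ℝ (fun y => fderiv ℝ φ y (eZ d m j k)) x (eZ d m j k))))
      (gibbs d m β Z V) := fun j k =>
    ((integrable_mul_dHam_mul_fderiv hV h _ (tZ j k)).sub
      ((h.memLp.integrable_mul (h.memLp_fderiv_fderiv _ _)).const_mul _)).const_mul _
  have I1 := integrable_finsetSum Finset.univ fun k _ => i1 k
  have I2 := integrable_finsetSum Finset.univ fun j _ =>
    integrable_finsetSum Finset.univ fun k _ => i2 j k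
  have I3 := integrable_finsetSum Finset.univ fun j _ =>
    integrable_finsetSum Finset.univ fun k _ => i3 j k
  simp_rw [hg]
  refine ⟨(I1.fun_add I2).add I3, ?_⟩
  rw [integral_add (I1.fun_add I2) I3, integral_add I1 I2, integral_finsetSum _ fun k _ => i1 k,
    integral_finsetSum _ fun j _ => integrable_finsetSum Finset.univ fun k _ => i2 j k,
    integral_finsetSum _ fun j _ => integrable_finsetSum Finset.univ fun k _ => i3 j k]
  have e2 : ∀ j, ∫ x, ∑ k, lam j * -(φ x * (dHam V x (eZ d m j k) * fderiv ℝ φ x (eP d m k)) -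
        φ x * (dHam V x (eP d m k) * fderiv ℝ φ x (eZ d m j k))) ∂gibbs d m β Z V = 0 := fun j => by
    rw [integral_finsetSum _ fun k _ => i2 j k]
    refine Finset.sum_eq_zero fun k _ => ?_
    rw [integral_const_mul, integral_neg, integral_mul_poisson_bracket hV hVp hZ h (tP k) (tZ j k)
      (conj_eP_eZ V j k)]
    simp
  have e1 : ∀ k, ∫ x, (φ x * (dHam V x (eQ d m k) * fderiv ℝ φ x (eP d m k)) -
        φ x * (dHam V x (eP d m k) * fderiv ℝ φ x (eQ d m k))) ∂gibbs d m β Z V = 0 := fun k =>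
    integral_mul_poisson_bracket hV hVp hZ h (tP k) (tQ k) (conj_eP_eQ V k)
  simp only [e1, e2, Finset.sum_const_zero, zero_add]
  refine Finset.sum_congr rfl fun j _ => ?_
  rw [integral_finsetSum _ fun k _ => i3 j k]
  refine Finset.sum_congr rfl fun k _ => ?_
  rw [integral_const_mul, integral_mul_diffusion hβ hV hVp hZ h (tZ j k)]

end Slices

section Families

theorem fderiv_fderiv_comm {E : Type*} [NormedAddCommGroup E] [NormedSpace ℝ E] {f : E → ℝ}
    (hf : ContDiff ℝ 2 f) (x v w : E) :
    fderiv ℝ (fun y => fderiv ℝ f y v) x w = fderiv ℝ (fun y => fderiv ℝ f y w) x v := by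
  have hd : DifferentiableAt ℝ (fderiv ℝ f) x :=
    (hf.fderiv_right (m := 1) (by norm_num)).differentiable (by norm_num) x
  have h := (hf.contDiffAt (x := x)).isSymmSndFDerivAt (by simp)
  have e : ∀ v w, fderiv ℝ (fun y => fderiv ℝ f y v) x w = fderiv ℝ (fderiv ℝ f) x w v :=
    fun v w => by
      rw [fderiv_clm_apply hd (differentiableAt_const v)]
      simp
  rw [e, e, h w v]

variable {d m : ℕ} {φ : ℝ → Xsp d m → ℝ}

/-- Joint smoothness in time and space. -/
def SmoothFamily (φ : ℝ → Xsp d m → ℝ) : Prop :=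
  ContDiff ℝ (⊤ : ℕ∞) fun tx : ℝ × Xsp d m => φ tx.1 tx.2

theorem SmoothFamily.slice (h : SmoothFamily φ) (t : ℝ) : ContDiff ℝ (⊤ : ℕ∞) (φ t) :=
  ContDiff.comp (g := fun tx : ℝ × Xsp d m => φ tx.1 tx.2) h
    (contDiff_const.prodMk contDiff_id)

theorem SmoothFamily.contDiff (h : SmoothFamily φ) (t : ℝ) {n : ℕ} : ContDiff ℝ n (φ t) :=
  (h.slice t).of_le (mod_cast le_top)

theorem SmoothFamily.differentiable (h : SmoothFamily φ) :
    Differentiable ℝ fun tx : ℝ × Xsp d m => φ tx.1 tx.2 :=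
  ContDiff.differentiable h (by simp)

theorem SmoothFamily.fderiv_eq (h : SmoothFamily φ) (t : ℝ) (x v : Xsp d m) :
    fderiv ℝ (φ t) x v = fderiv ℝ (fun tx : ℝ × Xsp d m => φ tx.1 tx.2) (t, x) (0, v) := by
  have h1 := (h.differentiable (t, x)).hasFDerivAt.comp x (hasFDerivAt_prodMk_right t x)
  have h2 : (fun tx : ℝ × Xsp d m => φ tx.1 tx.2) ∘ (fun y => (t, y)) = φ t := rfl
  rw [h2] at h1
  rw [h1.fderiv]
  simp

theorem SmoothFamily.hasDerivAt (h : SmoothFamily φ) (t : ℝ) (x : Xsp d m) :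
    HasDerivAt (fun s => φ s x)
      (fderiv ℝ (fun tx : ℝ × Xsp d m => φ tx.1 tx.2) (t, x) (1, 0)) t := by
  have h1 : HasDerivAt (fun s : ℝ => (s, x)) ((1 : ℝ), (0 : Xsp d m)) t :=
    (hasDerivAt_id t).prodMk (hasDerivAt_const t x)
  exact (h.differentiable (t, x)).hasFDerivAt.comp_hasDerivAt t h1

theorem SmoothFamily.deriv_eq (h : SmoothFamily φ) (t : ℝ) (x : Xsp d m) :
    deriv (fun s => φ s x) t = fderiv ℝ (fun tx : ℝ × Xsp d m => φ tx.1 tx.2) (t, x) (1, 0) :=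
  (h.hasDerivAt t x).deriv

theorem SmoothFamily.fderiv (h : SmoothFamily φ) (v : Xsp d m) :
    SmoothFamily fun t x => fderiv ℝ (φ t) x v := by
  unfold SmoothFamily
  simp_rw [h.fderiv_eq]
  exact (ContDiff.fderiv_right (m := (⊤ : ℕ∞)) h (by simp)).clm_apply contDiff_const

theorem SmoothFamily.deriv (h : SmoothFamily φ) :
    SmoothFamily fun t x => deriv (fun s => φ s x) t := by
  unfold SmoothFamily
  simp_rw [h.deriv_eq]
  exact (ContDiff.fderiv_right (m := (⊤ : ℕ∞)) h (by simp)).clm_apply contDiff_const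

theorem SmoothFamily.continuous (h : SmoothFamily φ) :
    Continuous fun tx : ℝ × Xsp d m => φ tx.1 tx.2 :=
  ContDiff.continuous h

theorem SmoothFamily.deriv_fderiv (h : SmoothFamily φ) (t : ℝ) (x v : Xsp d m) :
    _root_.deriv (fun s => _root_.fderiv ℝ (φ s) x v) t =
      _root_.fderiv ℝ (fun y => _root_.deriv (fun s => φ s y) t) x v := by
  rw [(h.fderiv v).deriv_eq, h.deriv.fderiv_eq]
  simp_rw [h.fderiv_eq, h.deriv_eq]
  exact fderiv_fderiv_comm (ContDiff.of_le h
    (WithTop.coe_le_coe.2 (le_top : (2 : ℕ∞) ≤ ⊤))) _ _ _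

/-- Square integrability, locally uniformly in nonnegative times. -/
def LocL2 (μ : Measure (Xsp d m)) (φ : ℝ → Xsp d m → ℝ) : Prop :=
  ∀ T : ℝ, 0 < T → ∃ M : NNReal, ∀ t ∈ Set.Icc 0 T, MemLp (φ t) 2 μ ∧ sqNorm μ (φ t) ≤ M

variable {μ : Measure (Xsp d m)} {ψ : ℝ → Xsp d m → ℝ}

theorem LocL2.memLp (h : LocL2 μ φ) {t : ℝ} (ht : 0 ≤ t) : MemLp (φ t) 2 μ := by
  obtain ⟨M, hM⟩ := h (t + 1) (by linarith)
  exact (hM t ⟨ht, by linarith⟩).1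

theorem LocL2.congr (h : LocL2 μ φ) (hψ : ∀ t, 0 ≤ t → ψ t = φ t) : LocL2 μ ψ := fun T hT => by
  obtain ⟨M, hM⟩ := h T hT
  exact ⟨M, fun t ht => by rw [hψ t ht.1]; exact hM t ht⟩

theorem LocL2.bdd_mul (h : LocL2 μ φ) {c : Xsp d m → ℝ} (hc : Continuous c) {B : ℝ}
    (hB : ∀ x, |c x| ≤ B) : LocL2 μ fun t x => c x * φ t x := fun T hT => by
  obtain ⟨M, hM⟩ := h T hT
  refine ⟨(B ^ 2).toNNReal * M, fun t ht => ?_⟩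
  have h1 : sqNorm μ (fun x => c x * φ t x) ≤ ((B ^ 2).toNNReal * M : NNReal) := by
    refine (sqNorm_mul_le hB).trans ?_
    rw [ENNReal.coe_mul]
    gcongr
    exact (hM t ht).2
  exact ⟨memLp_two_of_sqNorm (hc.aestronglyMeasurable.mul (hM t ht).1.1)
    (h1.trans_lt ENNReal.coe_lt_top), h1⟩

theorem LocL2.const_mul (h : LocL2 μ φ) (c : ℝ) : LocL2 μ fun t x => c * φ t x :=
  h.bdd_mul (c := fun _ => c) continuous_const fun _ => le_rfl

theorem LocL2.add (h : LocL2 μ φ) (h' : LocL2 μ ψ) : LocL2 μ fun t x => φ t x + ψ t x :=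
  fun T hT => by
  obtain ⟨M, hM⟩ := h T hT
  obtain ⟨M', hM'⟩ := h' T hT
  refine ⟨2 * (M + M'), fun t ht => ⟨(hM t ht).1.add (hM' t ht).1, ?_⟩⟩
  refine (sqNorm_add_le (hM t ht).1.1).trans ?_
  push_cast
  gcongr
  exacts [(hM t ht).2, (hM' t ht).2]

theorem LocL2.sub (h : LocL2 μ φ) (h' : LocL2 μ ψ) : LocL2 μ fun t x => φ t x - ψ t x := by
  simpa [sub_eq_add_neg] using h.add (h'.const_mul (-1))

theorem locL2_const [IsFiniteMeasure μ] (c : ℝ) : LocL2 μ fun _ _ => c := fun T _ => by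
  have h : MemLp (fun _ : Xsp d m => c) 2 μ := memLp_const c
  exact ⟨(sqNorm μ fun _ => c).toNNReal, fun t _ => ⟨h, by
    rw [ENNReal.coe_toNNReal h.sqNorm_lt_top.ne]⟩⟩

theorem LocL2.sum {ι : Type*} [IsFiniteMeasure μ] {s : Finset ι} {φ : ι → ℝ → Xsp d m → ℝ}
    (h : ∀ i, LocL2 μ (φ i)) : LocL2 μ fun t x => ∑ i ∈ s, φ i t x := by
  classical
  induction s using Finset.induction_on with
  | empty => simpa using locL2_const 0
  | insert i s hi ih =>
    simp_rw [Finset.sum_insert hi]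
    exact (h i).add ih

/-- Smooth periodic families all of whose spatial derivatives are square integrable, locally
uniformly in time. -/
structure SobolevFamily (μ : Measure (Xsp d m)) (φ : ℝ → Xsp d m → ℝ) : Prop where
  smooth : SmoothFamily φ
  perQ : ∀ t, 0 ≤ t → PerQ d m (φ t)
  locL2_iteratedFDeriv : ∀ (n : ℕ) (v : Fin n → Xsp d m),
    LocL2 μ fun t x => iteratedFDeriv ℝ n (φ t) x v

theorem SobolevFamily.locL2 (h : SobolevFamily μ φ) : LocL2 μ φ :=
  (h.locL2_iteratedFDeriv 0 default).congr fun t _ => by funext x; simp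

theorem SobolevFamily.fderiv (h : SobolevFamily μ φ) (v : Xsp d m) :
    SobolevFamily μ fun t x => fderiv ℝ (φ t) x v where
  smooth := h.smooth.fderiv v
  perQ t ht := (h.perQ t ht).fderiv_apply v
  locL2_iteratedFDeriv n w :=
    (h.locL2_iteratedFDeriv (n + 1) (Fin.snoc w v)).congr fun t _ => by
      funext x
      have h1 : ContDiffAt ℝ n (_root_.fderiv ℝ (φ t)) x :=
        ((h.smooth.contDiff (n := n + 1) t).fderiv_right (by norm_cast)).contDiffAt
      have h2 := (ContinuousLinearMap.apply ℝ ℝ v).iteratedFDeriv_comp_left h1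
        (i := n) le_rfl
      have h3 : (ContinuousLinearMap.apply ℝ ℝ v) ∘ (_root_.fderiv ℝ (φ t)) =
        fun x => _root_.fderiv ℝ (φ t) x v := rfl
      rw [h3] at h2
      rw [h2, iteratedFDeriv_succ_apply_right]
      simp

theorem SobolevFamily.add_const [IsFiniteMeasure μ] (h : SobolevFamily μ φ) (c : ℝ) :
    SobolevFamily μ fun t x => φ t x + c where
  smooth := ContDiff.add h.smooth contDiff_const
  perQ t ht k x := by simp only [h.perQ t ht k x]
  locL2_iteratedFDeriv n w := by
    refine ((h.locL2_iteratedFDeriv n w).add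
      (locL2_const (iteratedFDeriv ℝ n (fun _ : Xsp d m => c) 0 w))).congr fun t _ => ?_
    funext x
    rw [fun_iteratedFDeriv_add_apply (h.smooth.contDiff t).contDiffAt contDiff_const.contDiffAt]
    rcases n with _ | n
    · simp
    · simp [iteratedFDeriv_succ_const]

theorem SobolevFamily.twiceL2 (h : SobolevFamily μ φ) {t : ℝ} (ht : 0 ≤ t) :
    TwiceL2 μ (φ t) where
  contDiff := h.smooth.contDiff t
  perQ := h.perQ t ht
  memLp := h.locL2.memLp ht
  memLp_fderiv v := (h.fderiv v).locL2.memLp ht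
  memLp_fderiv_fderiv v w := ((h.fderiv v).fderiv w).locL2.memLp ht

variable {β Z : ℝ} {V : (Fin d → ℝ) → ℝ}

theorem SobolevFamily.locL2_dHam_mul (hV : ContDiff ℝ 2 V)
    (h : SobolevFamily (gibbs d m β Z V) φ) {v : Xsp d m} (hv : Tame (gibbs d m β Z V) V v) :
    LocL2 (gibbs d m β Z V) fun t x => dHam V x v * φ t x := fun T hT => by
  obtain ⟨C, hC⟩ := id hv
  obtain ⟨M, hM⟩ := h.locL2 T hT
  obtain ⟨M', hM'⟩ := (h.fderiv v).locL2 T hT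
  refine ⟨C * (M + M'), fun t ht => ⟨hv.memLp hV (h.smooth.contDiff (n := 1) t) (h.perQ t ht.1)
    (hM t ht).1 (hM' t ht).1, ?_⟩⟩
  refine (hC _ (h.smooth.contDiff (n := 1) t) (h.perQ t ht.1)).trans ?_
  push_cast
  gcongr
  exacts [(hM t ht).2, (hM' t ht).2]

theorem SobolevFamily.locL2_gen [IsFiniteMeasure (gibbs d m β Z V)] (hβ : 0 < β)
    (hV : ContDiff ℝ 2 V) (hVp : PerV d V) (hZ : 0 < Z) (α lam : Fin m → ℝ)
    (h : SobolevFamily (gibbs d m β Z V) φ) :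
    LocL2 (gibbs d m β Z V) fun t x => gen d m β α lam V (φ t) x := by
  have tQ : ∀ k, Tame (gibbs d m β Z V) V (eQ d m k) := tame_eQ hV hVp
  have tP : ∀ k, Tame (gibbs d m β Z V) V (eP d m k) := tame_eP hβ hV hVp hZ
  have tZ : ∀ j k, Tame (gibbs d m β Z V) V (eZ d m j k) := tame_eZ hβ hV hVp hZ
  simp_rw [gen_eq]
  refine ((LocL2.sum fun k => ?_).add (LocL2.sum fun j => LocL2.sum fun k => ?_)).add
    (LocL2.sum fun j => LocL2.sum fun k => ?_)
  · exact ((h.fderiv _).locL2_dHam_mul hV (tQ k)).sub ((h.fderiv _).locL2_dHam_mul hV (tP k))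
  · exact (((h.fderiv _).locL2_dHam_mul hV (tP k)).sub
      ((h.fderiv _).locL2_dHam_mul hV (tZ j k))).const_mul _
  · exact (((h.fderiv _).locL2_dHam_mul hV (tZ j k)).sub
      (((h.fderiv _).fderiv _).locL2.const_mul _)).const_mul _

/-- The `L²` norm of a smooth family is absolutely continuous in time. -/
theorem integral_sq_sub_integral_sq [IsFiniteMeasure μ] (h : SmoothFamily φ) (h0 : LocL2 μ φ)
    (h1 : LocL2 μ fun t x => deriv (fun s => φ s x) t) {s t : ℝ} (hs : 0 ≤ s) (hst : s ≤ t) :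
    IntervalIntegrable (fun r => ∫ x, 2 * (φ r x * deriv (fun s => φ s x) r) ∂μ) volume s t ∧
    ∫ x, φ t x ^ 2 ∂μ - ∫ x, φ s x ^ 2 ∂μ =
      ∫ r in s..t, ∫ x, 2 * (φ r x * deriv (fun s => φ s x) r) ∂μ := by
  obtain ⟨M, hM⟩ := h0 (t + 1) (by linarith)
  obtain ⟨M', hM'⟩ := h1 (t + 1) (by linarith)
  set G : ℝ × Xsp d m → ℝ := fun z => 2 * (φ z.1 z.2 * deriv (fun s => φ s z.2) z.1) with hG
  have hGc : Continuous G := continuous_const.mul (h.continuous.mul h.deriv.continuous)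
  have hmem : ∀ r ∈ Set.Ioc s t, r ∈ Set.Icc 0 (t + 1) := fun r hr =>
    ⟨hs.trans hr.1.le, by linarith [hr.2]⟩
  have hsl : ∀ r ∈ Set.Ioc s t, Integrable (fun x => G (r, x)) μ := fun r hr =>
    ((hM r (hmem r hr)).1.integrable_mul (hM' r (hmem r hr)).1).const_mul 2
  have hGi : Integrable G ((volume.restrict (Set.Ioc s t)).prod μ) := by
    rw [integrable_prod_iff hGc.aestronglyMeasurable]
    refine ⟨(ae_restrict_iff' measurableSet_Ioc).2 (Eventually.of_forall hsl), ?_⟩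
    refine Integrable.of_bound (C := M + M')
      (hGc.norm.aestronglyMeasurable.integral_prod_right' (μ := volume.restrict (Set.Ioc s t)))
      ((ae_restrict_iff' measurableSet_Ioc).2 (Eventually.of_forall fun r hr => ?_))
    have i1 := (hM r (hmem r hr)).1.integrable_sq
    have i2 := (hM' r (hmem r hr)).1.integrable_sq
    have b1 : ∫ x, φ r x ^ 2 ∂μ ≤ M := by
      have := (hM r (hmem r hr)).2
      rw [sqNorm_eq_ofReal i1] at this
      exact (ENNReal.ofReal_le_iff_le_toReal ENNReal.coe_ne_top).1 this
    have b2 : ∫ x, deriv (fun s => φ s x) r ^ 2 ∂μ ≤ M' := by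
      have := (hM' r (hmem r hr)).2
      rw [sqNorm_eq_ofReal i2] at this
      exact (ENNReal.ofReal_le_iff_le_toReal ENNReal.coe_ne_top).1 this
    rw [Real.norm_of_nonneg (integral_nonneg fun x => norm_nonneg _)]
    refine le_trans ?_ (add_le_add b1 b2)
    rw [← integral_add i1 i2]
    refine integral_mono (hsl r hr).norm (i1.add i2) fun x => ?_
    simp only [hG, Real.norm_eq_abs]
    rw [abs_le]
    constructor <;> nlinarith [sq_nonneg (φ r x + deriv (fun s => φ s x) r),
      sq_nonneg (φ r x - deriv (fun s => φ s x) r)]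
  constructor
  · rw [intervalIntegrable_iff_integrableOn_Ioc_of_le hst]
    exact hGi.integral_prod_left
  rw [intervalIntegral.integral_of_le hst]
  have swap : ∫ r in Set.Ioc s t, ∫ x, 2 * (φ r x * deriv (fun s => φ s x) r) ∂μ =
      ∫ x, (∫ r in Set.Ioc s t, G (r, x)) ∂μ :=
    integral_integral_swap (f := fun r x => G (r, x)) hGi
  rw [swap]
  rw [← integral_sub (h0.memLp (hs.trans hst)).integrable_sq (h0.memLp hs).integrable_sq]
  congr 1
  funext x
  rw [← intervalIntegral.integral_of_le hst]
  refine (intervalIntegral.integral_eq_sub_of_hasDerivAt (f := fun r => φ r x ^ 2)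
    (fun r _ => ?_) ?_).symm
  · have := (h.hasDerivAt r x).pow 2
    rw [← h.deriv_eq] at this
    convert! this using 1
    simp only [hG]; ring
  · exact (hGc.comp (by fun_prop : Continuous fun r : ℝ => (r, x))).intervalIntegrable _ _

/-- Energy identity for the backward Kolmogorov equation with a source term. -/
theorem SobolevFamily.energy [IsFiniteMeasure (gibbs d m β Z V)] (hβ : 0 < β)
    (hV : ContDiff ℝ 2 V) (hVp : PerV d V) (hZ : 0 < Z) {α lam : Fin m → ℝ}
    (h : SobolevFamily (gibbs d m β Z V) φ) {R : ℝ → Xsp d m → ℝ}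
    (hR : LocL2 (gibbs d m β Z V) R)
    (heq : ∀ t, 0 ≤ t → ∀ x, deriv (fun s => φ s x) t = - gen d m β α lam V (φ t) x + R t x)
    {s t : ℝ} (hs : 0 ≤ s) (hst : s ≤ t) :
    IntervalIntegrable (fun r => 2 * ∫ x, φ r x * R r x ∂gibbs d m β Z V -
      2 * dirichlet β α (gibbs d m β Z V) (φ r)) volume s t ∧
    ∫ x, φ t x ^ 2 ∂gibbs d m β Z V - ∫ x, φ s x ^ 2 ∂gibbs d m β Z V =
      ∫ r in s..t, (2 * ∫ x, φ r x * R r x ∂gibbs d m β Z V -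
        2 * dirichlet β α (gibbs d m β Z V) (φ r)) := by
  have hd : LocL2 (gibbs d m β Z V) fun t x => deriv (fun s => φ s x) t :=
    (((h.locL2_gen hβ hV hVp hZ α lam).const_mul (-1)).add hR).congr fun t ht => by
      funext x; rw [heq t ht x]; ring
  have key := integral_sq_sub_integral_sq h.smooth h.locL2 hd hs hst
  have e : ∀ r ∈ Set.uIcc s t,
      ∫ x, 2 * (φ r x * deriv (fun s => φ s x) r) ∂gibbs d m β Z V =
        2 * ∫ x, φ r x * R r x ∂gibbs d m β Z V -
          2 * dirichlet β α (gibbs d m β Z V) (φ r) := fun r hr => by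
    rw [Set.uIcc_of_le hst] at hr
    have hr0 := hs.trans hr.1
    obtain ⟨gi, ge⟩ := integral_mul_gen hβ hV hVp hZ α lam (h.twiceL2 hr0)
    have iR : Integrable (fun x => φ r x * R r x) (gibbs d m β Z V) :=
      (h.locL2.memLp hr0).integrable_mul (hR.memLp hr0)
    have e1 : ∀ x, 2 * (φ r x * deriv (fun s => φ s x) r) =
        2 * (φ r x * R r x) - 2 * (φ r x * gen d m β α lam V (φ r) x) := fun x => by
      rw [heq r hr0 x]; ring
    simp_rw [e1]
    rw [integral_sub (iR.const_mul 2) (gi.const_mul 2), integral_const_mul, integral_const_mul, ge]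
  refine ⟨key.1.congr fun r hr => e r (Set.uIoc_subset_uIcc hr), ?_⟩
  rw [key.2]
  exact intervalIntegral.integral_congr e

end Families

section Gradient

variable {d m : ℕ} {β Z : ℝ} {V : (Fin d → ℝ) → ℝ}

/-- The commutator of the generator with the directional derivative along `e`. -/
def genComm (α lam : Fin m → ℝ) (V : (Fin d → ℝ) → ℝ) (e : Xsp d m) (φ : Xsp d m → ℝ)
    (x : Xsp d m) : ℝ :=
  ∑ k, (e.2.1 k * fderiv ℝ φ x (eQ d m k) -
    fderiv ℝ (fun y => dHam V y (eQ d m k)) x e * fderiv ℝ φ x (eP d m k)) +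
  ∑ j, ∑ k, lam j * (e.2.2 j k * fderiv ℝ φ x (eP d m k) -
    e.2.1 k * fderiv ℝ φ x (eZ d m j k)) -
  ∑ j, ∑ k, α j * (e.2.2 j k * fderiv ℝ φ x (eZ d m j k))

theorem fderiv_dHam_eP (V : (Fin d → ℝ) → ℝ) (x e : Xsp d m) (k : Fin d) :
    fderiv ℝ (fun y => dHam V y (eP d m k)) x e = e.2.1 k := by
  simp only [dHam_eP]
  exact congrArg (fun L : Xsp d m →L[ℝ] ℝ => L e)
    (((ContinuousLinearMap.proj (R := ℝ) (φ := fun _ : Fin d => ℝ) k).comp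
      ((ContinuousLinearMap.fst ℝ (Fin d → ℝ) (Fin m → Fin d → ℝ)).comp
        (ContinuousLinearMap.snd ℝ (Fin d → ℝ) _))).fderiv (x := x))

theorem fderiv_dHam_eZ (V : (Fin d → ℝ) → ℝ) (x e : Xsp d m) (j : Fin m) (k : Fin d) :
    fderiv ℝ (fun y => dHam V y (eZ d m j k)) x e = e.2.2 j k := by
  simp only [dHam_eZ]
  exact congrArg (fun L : Xsp d m →L[ℝ] ℝ => L e)
    ((((ContinuousLinearMap.proj (R := ℝ) (φ := fun _ : Fin d => ℝ) k).comp
      (ContinuousLinearMap.proj (R := ℝ) (φ := fun _ : Fin m => Fin d → ℝ) j)).comp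
      ((ContinuousLinearMap.snd ℝ (Fin d → ℝ) (Fin m → Fin d → ℝ)).comp
        (ContinuousLinearMap.snd ℝ (Fin d → ℝ) _))).fderiv (x := x))

theorem fderiv_gen (hV : ContDiff ℝ 2 V) (β : ℝ) (α lam : Fin m → ℝ) {φ : Xsp d m → ℝ}
    (hφ : ContDiff ℝ 3 φ) (x e : Xsp d m) :
    fderiv ℝ (gen d m β α lam V φ) x e =
      gen d m β α lam V (fun y => fderiv ℝ φ y e) x - genComm α lam V e φ x := by
  have hφ2 : ContDiff ℝ 2 φ := hφ.of_le (by norm_num)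
  have hD : ∀ v, ContDiff ℝ 2 fun y => fderiv ℝ φ y v := fun v =>
    (hφ.fderiv_right (m := 2) (by norm_num)).clm_apply contDiff_const
  have dd : ∀ v w, DifferentiableAt ℝ (fun y => dHam V y w * fderiv ℝ φ y v) x := fun v w =>
    ((contDiff_dHam hV w).differentiable (by norm_num) x).mul
      ((hD v).differentiable (by norm_num) x)
  have d3 : ∀ v, DifferentiableAt ℝ (fun y => fderiv ℝ (fun y => fderiv ℝ φ y v) y v) x :=
    fun v => (contDiff_fderiv_apply (hD v) v).differentiable (by norm_num) x
  have f2 : ∀ v w, fderiv ℝ (fun y => dHam V y w * fderiv ℝ φ y v) x e =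
      fderiv ℝ (fun y => dHam V y w) x e * fderiv ℝ φ x v +
        dHam V x w * fderiv ℝ (fun y => fderiv ℝ φ y e) x v := fun v w => by
    rw [fderiv_fun_mul ((contDiff_dHam hV w).differentiable (by norm_num) x)
      ((hD v).differentiable (by norm_num) x)]
    simp only [add_apply, smul_apply, smul_eq_mul]
    rw [fderiv_fderiv_comm hφ2 x v e]
    ring
  have f3 : ∀ v, fderiv ℝ (fun y => fderiv ℝ (fun y => fderiv ℝ φ y v) y v) x e =
      fderiv ℝ (fun y => fderiv ℝ (fun y => fderiv ℝ φ y e) y v) x v := fun v => by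
    rw [fderiv_fderiv_comm (hD v) x v e]
    simp_rw [fun y => fderiv_fderiv_comm hφ2 y v e]
  have hgen : gen d m β α lam V φ = _ := funext fun y => gen_eq β α lam V φ y
  have H := ((HasFDerivAt.fun_sum (u := Finset.univ) fun k _ =>
    (dd (eP d m k) (eQ d m k)).hasFDerivAt.fun_sub (dd (eQ d m k) (eP d m k)).hasFDerivAt).fun_add
    (HasFDerivAt.fun_sum (u := Finset.univ) fun j _ =>
      HasFDerivAt.fun_sum (u := Finset.univ) fun k _ =>
      ((dd (eZ d m j k) (eP d m k)).hasFDerivAt.fun_sub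
        (dd (eP d m k) (eZ d m j k)).hasFDerivAt).const_mul (lam j))).fun_add
    (HasFDerivAt.fun_sum (u := Finset.univ) fun j _ =>
      HasFDerivAt.fun_sum (u := Finset.univ) fun k _ =>
      ((dd (eZ d m j k) (eZ d m j k)).hasFDerivAt.fun_sub
        ((d3 (eZ d m j k)).hasFDerivAt.const_mul β⁻¹)).const_mul (α j))
  rw [hgen, H.fderiv, gen_eq, genComm]
  simp only [add_apply, sub_apply, sum_apply, smul_apply, smul_eq_mul, f2, f3, fderiv_dHam_eP,
    fderiv_dHam_eZ, mul_sub, mul_add, Finset.sum_add_distrib, Finset.sum_sub_distrib]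
  ring

theorem fderiv_dHam_eQ (hV : ContDiff ℝ 2 V) (k : Fin d) (x e : Xsp d m) :
    fderiv ℝ (fun y => dHam V y (eQ d m k)) x e =
      fderiv ℝ (fun q => fderiv ℝ V q (Pi.single k 1)) x.1 e.1 := by
  have hc : ContDiff ℝ 1 fun q => fderiv ℝ V q (Pi.single k 1) :=
    (hV.fderiv_right (m := 1) (by norm_num)).clm_apply contDiff_const
  simp only [dHam_eQ]
  have h1 := (hc.differentiable (by norm_num) x.1).hasFDerivAt.comp x hasFDerivAt_fst
  exact congrArg (fun L : Xsp d m →L[ℝ] ℝ => L e) h1.fderiv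

theorem exists_bound_fderiv_dHam_eQ (hV : ContDiff ℝ 2 V) (hVp : PerV d V) (k : Fin d)
    (e : Xsp d m) : ∃ M : ℝ, 0 ≤ M ∧ ∀ x : Xsp d m,
      |fderiv ℝ (fun y => dHam V y (eQ d m k)) x e| ≤ M := by
  have hc : ContDiff ℝ 1 fun q => fderiv ℝ V q (Pi.single k 1) :=
    (hV.fderiv_right (m := 1) (by norm_num)).clm_apply contDiff_const
  obtain ⟨M, hM0, hM⟩ := exists_bound_of_periodic (d := d)
    (g := fun q => fderiv ℝ (fun q => fderiv ℝ V q (Pi.single k 1)) q e.1)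
    ((hc.continuous_fderiv (by norm_num)).clm_apply continuous_const) fun l q => by
      have h2 := fderiv_comp_add_right (𝕜 := ℝ)
        (f := fun q => fderiv ℝ V q (Pi.single k 1)) (x := q) (fun i => (l i : ℝ))
      rw [← h2]
      simp_rw [hVp.fderiv_eq]
  exact ⟨M, hM0, fun x => by rw [fderiv_dHam_eQ hV]; exact hM x.1⟩

variable {φ : ℝ → Xsp d m → ℝ}

theorem SobolevFamily.locL2_genComm [IsFiniteMeasure (gibbs d m β Z V)]
    (hV : ContDiff ℝ 2 V) (hVp : PerV d V) (α lam : Fin m → ℝ)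
    (h : SobolevFamily (gibbs d m β Z V) φ) (e : Xsp d m) :
    LocL2 (gibbs d m β Z V) fun t x => genComm α lam V e (φ t) x := by
  unfold genComm
  have hD := fun v => (h.fderiv v).locL2
  refine ((LocL2.sum fun k => ?_).add (LocL2.sum fun j => LocL2.sum fun k => ?_)).sub
    (LocL2.sum fun j => LocL2.sum fun k => ?_)
  · obtain ⟨M, -, hM⟩ := exists_bound_fderiv_dHam_eQ hV hVp k e
    exact ((hD _).const_mul _).sub ((hD _).bdd_mul
      (((contDiff_dHam hV _).continuous_fderiv (by norm_num)).clm_apply continuous_const) hM)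
  · exact (((hD _).const_mul _).sub ((hD _).const_mul _)).const_mul _
  · exact ((hD _).const_mul _).const_mul _

theorem dirichlet_nonneg (hβ : 0 < β) {α : Fin m → ℝ} (hα : ∀ j, 0 < α j)
    (μ : Measure (Xsp d m)) (f : Xsp d m → ℝ) : 0 ≤ dirichlet β α μ f :=
  Finset.sum_nonneg fun j _ => Finset.sum_nonneg fun _ _ =>
    mul_nonneg (hα j).le (mul_nonneg (inv_nonneg.2 hβ.le) (integral_nonneg fun _ => sq_nonneg _))

/-- Solutions of the backward Kolmogorov equation. -/
structure KolmogorovSolution (d m : ℕ) (β Z : ℝ) (α lam : Fin m → ℝ) (V : (Fin d → ℝ) → ℝ)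
    (φ : ℝ → Xsp d m → ℝ) : Prop where
  sobolev : SobolevFamily (gibbs d m β Z V) φ
  deriv_eq : ∀ t, 0 ≤ t → ∀ x, deriv (fun s => φ s x) t = - gen d m β α lam V (φ t) x

variable {α lam : Fin m → ℝ}

theorem KolmogorovSolution.deriv_fderiv (hV : ContDiff ℝ 2 V)
    (h : KolmogorovSolution d m β Z α lam V φ) (e : Xsp d m) {t : ℝ} (ht : 0 ≤ t) (x : Xsp d m) :
    deriv (fun s => fderiv ℝ (φ s) x e) t =
      - gen d m β α lam V (fun y => fderiv ℝ (φ t) y e) x + genComm α lam V e (φ t) x := by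
  rw [h.sobolev.smooth.deriv_fderiv]
  simp_rw [h.deriv_eq t ht]
  rw [fderiv_fun_neg, neg_apply, fderiv_gen hV β α lam (h.sobolev.smooth.contDiff (n := 3) t)]
  ring

theorem KolmogorovSolution.energy [IsFiniteMeasure (gibbs d m β Z V)] (hβ : 0 < β)
    (hV : ContDiff ℝ 2 V) (hVp : PerV d V) (hZ : 0 < Z)
    (h : KolmogorovSolution d m β Z α lam V φ) {s t : ℝ} (hs : 0 ≤ s) (hst : s ≤ t) :
    IntervalIntegrable (fun r => -2 * dirichlet β α (gibbs d m β Z V) (φ r)) volume s t ∧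
    ∫ x, φ t x ^ 2 ∂gibbs d m β Z V - ∫ x, φ s x ^ 2 ∂gibbs d m β Z V =
      ∫ r in s..t, -2 * dirichlet β α (gibbs d m β Z V) (φ r) := by
  simpa using h.sobolev.energy hβ hV hVp hZ (α := α) (lam := lam) (R := fun _ _ => 0)
    (locL2_const 0) (fun t ht x => by rw [h.deriv_eq t ht x, add_zero]) hs hst

theorem KolmogorovSolution.energy_fderiv [IsFiniteMeasure (gibbs d m β Z V)] (hβ : 0 < β)
    (hV : ContDiff ℝ 2 V) (hVp : PerV d V) (hZ : 0 < Z)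
    (h : KolmogorovSolution d m β Z α lam V φ) (e : Xsp d m) {s t : ℝ} (hs : 0 ≤ s)
    (hst : s ≤ t) :
    IntervalIntegrable (fun r => 2 * ∫ x, fderiv ℝ (φ r) x e * genComm α lam V e (φ r) x
        ∂gibbs d m β Z V -
      2 * dirichlet β α (gibbs d m β Z V) fun x => fderiv ℝ (φ r) x e) volume s t ∧
    ∫ x, fderiv ℝ (φ t) x e ^ 2 ∂gibbs d m β Z V -
        ∫ x, fderiv ℝ (φ s) x e ^ 2 ∂gibbs d m β Z V =
      ∫ r in s..t, (2 * ∫ x, fderiv ℝ (φ r) x e * genComm α lam V e (φ r) x ∂gibbs d m β Z V -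
        2 * dirichlet β α (gibbs d m β Z V) fun x => fderiv ℝ (φ r) x e) :=
  (h.sobolev.fderiv e).energy hβ hV hVp hZ (h.sobolev.locL2_genComm hV hVp α lam e)
    (fun _ ht x => h.deriv_fderiv hV e ht x) hs hst

theorem gen_add_const (β : ℝ) (α lam : Fin m → ℝ) (V : (Fin d → ℝ) → ℝ) (f : Xsp d m → ℝ)
    (c : ℝ) (x : Xsp d m) : gen d m β α lam V (fun y => f y + c) x = gen d m β α lam V f x := by
  simp only [gen_eq, fderiv_add_const]

theorem KolmogorovSolution.add_const [IsFiniteMeasure (gibbs d m β Z V)]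
    (h : KolmogorovSolution d m β Z α lam V φ) (c : ℝ) :
    KolmogorovSolution d m β Z α lam V fun t x => φ t x + c where
  sobolev := h.sobolev.add_const c
  deriv_eq t ht x := by
    rw [gen_add_const, ← h.deriv_eq t ht x, deriv_add_const]

/-- Conservation of the mean. -/
theorem KolmogorovSolution.integral_eq [IsProbabilityMeasure (gibbs d m β Z V)] (hβ : 0 < β)
    (hV : ContDiff ℝ 2 V) (hVp : PerV d V) (hZ : 0 < Z)
    (h : KolmogorovSolution d m β Z α lam V φ) {t : ℝ} (ht : 0 ≤ t) :
    ∫ x, φ t x ∂gibbs d m β Z V = ∫ x, φ 0 x ∂gibbs d m β Z V := by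
  have h1 := (h.energy hβ hV hVp hZ le_rfl ht).2
  have h2 := ((h.add_const 1).energy hβ hV hVp hZ le_rfl ht).2
  have e : ∀ r, dirichlet β α (gibbs d m β Z V) (fun x => φ r x + 1) =
      dirichlet β α (gibbs d m β Z V) (φ r) := fun r => by
    simp only [dirichlet, fderiv_add_const]
  simp_rw [e] at h2
  rw [← h1] at h2
  have e2 : ∀ s, 0 ≤ s → ∫ x, (φ s x + 1) ^ 2 ∂gibbs d m β Z V =
      ∫ x, φ s x ^ 2 ∂gibbs d m β Z V + 2 * ∫ x, φ s x ∂gibbs d m β Z V + 1 := fun s hs => by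
    have hm := h.sobolev.locL2.memLp hs
    have hi := hm.integrable (by norm_num)
    have e3 : ∀ x, (φ s x + 1) ^ 2 = φ s x ^ 2 + 2 * φ s x + 1 := fun x => by ring
    simp_rw [e3]
    rw [integral_add (hm.integrable_sq.fun_add (hi.const_mul 2)) (integrable_const 1),
      integral_add hm.integrable_sq (hi.const_mul 2), integral_const_mul]
    simp
  rw [e2 t ht, e2 0 le_rfl] at h2
  linarith

end Gradient

section Dissipation

variable {d m : ℕ}

theorem young_mul {ε : ℝ} (hε : 0 < ε) (a b : ℝ) : a * b ≤ ε * a ^ 2 + b ^ 2 / (4 * ε) := by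
  have h : 0 ≤ (2 * ε * a - b) ^ 2 / (4 * ε) := by positivity
  have h2 : (2 * ε * a - b) ^ 2 / (4 * ε) = ε * a ^ 2 + b ^ 2 / (4 * ε) - a * b := by
    field_simp; ring
  linarith

/-- Dissipation in a single spatial coordinate. -/
theorem dissipation_coord {δ l α₀ : ℝ} (hδ : 0 < δ) (hδ1 : δ ≤ 1) (hl : 0 < l) (hα : 0 < α₀)
    (a p z S w : ℝ) :
    p * S + (δ * p - z) * (δ * (a - S) - (l * p - α₀ * z)) +
        δ ^ 2 * ((a - p) * (-w - (a - S))) ≤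
      -(3 / 4 * δ * l) * p ^ 2 + 9 * δ ^ 2 * p ^ 2 - δ ^ 2 / 2 * a ^ 2 + 3 * δ ^ 2 * w ^ 2 +
        ((1 + (α₀ + l) ^ 2) / (4 * (δ * l / 8)) + 5) * (z ^ 2 + S ^ 2) := by
  have hε : 0 < δ * l / 8 := by positivity
  set ε := δ * l / 8 with hεd
  have hδ2 : δ ^ 2 ≤ 1 := by nlinarith
  have y1 := young_mul hε p ((1 - 2 * δ ^ 2) * S)
  have y2 := young_mul hε p ((δ * α₀ + l) * z)
  have b1 : ((1 - 2 * δ ^ 2) * S) ^ 2 / (4 * ε) ≤ 1 / (4 * ε) * S ^ 2 := by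
    rw [mul_pow, mul_div_right_comm]
    gcongr
    nlinarith [sq_nonneg δ]
  have b2 : ((δ * α₀ + l) * z) ^ 2 / (4 * ε) ≤ (α₀ + l) ^ 2 / (4 * ε) * z ^ 2 := by
    rw [mul_pow, mul_div_right_comm]
    gcongr
    nlinarith
  have b3 : 0 ≤ 1 / (4 * ε) * z ^ 2 := by positivity
  have b4 : 0 ≤ (α₀ + l) ^ 2 / (4 * ε) * S ^ 2 := by positivity
  have y3 : δ * z * S ≤ z ^ 2 + S ^ 2 := by
    nlinarith [sq_nonneg (z - S), sq_nonneg (z + S), sq_nonneg (δ * z - S), sq_nonneg z,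
      sq_nonneg S]
  have y4 : -(δ * z * a) ≤ δ ^ 2 / 8 * a ^ 2 + 2 * z ^ 2 := by
    nlinarith [sq_nonneg (δ * a + 4 * z)]
  have y5 : δ ^ 2 * (a * S) ≤ δ ^ 2 / 8 * a ^ 2 + 2 * S ^ 2 := by
    nlinarith [sq_nonneg (a - 4 * S), sq_nonneg S, mul_nonneg (sq_nonneg δ) (sq_nonneg (a - 4 * S)),
      mul_nonneg (sub_nonneg.2 hδ2) (sq_nonneg S)]
  have y6 : δ ^ 2 * (2 * (p * a)) ≤ δ ^ 2 * (a ^ 2 / 8 + 8 * p ^ 2) :=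
    mul_le_mul_of_nonneg_left (by nlinarith [sq_nonneg (a - 8 * p)]) (sq_nonneg δ)
  have y7 : δ ^ 2 * -(a * w) ≤ δ ^ 2 * (a ^ 2 / 8 + 2 * w ^ 2) :=
    mul_le_mul_of_nonneg_left (by nlinarith [sq_nonneg (a + 4 * w)]) (sq_nonneg δ)
  have y8 : δ ^ 2 * (p * w) ≤ δ ^ 2 * (p ^ 2 + w ^ 2) :=
    mul_le_mul_of_nonneg_left (by nlinarith [sq_nonneg (p - w), sq_nonneg p, sq_nonneg w])
      (sq_nonneg δ)
  have e1 : (1 + (α₀ + l) ^ 2) / (4 * ε) = 1 / (4 * ε) + (α₀ + l) ^ 2 / (4 * ε) := by ring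
  have e2 : δ * l = 8 * ε := by rw [hεd]; ring
  rw [e1]
  have e3 : 3 / 4 * δ * l = 6 * ε := by linarith
  rw [e3]
  have e4 : p * S + (δ * p - z) * (δ * (a - S) - (l * p - α₀ * z)) +
      δ ^ 2 * ((a - p) * (-w - (a - S))) =
      p * ((1 - 2 * δ ^ 2) * S) + p * ((δ * α₀ + l) * z) + δ * z * S + -(δ * z * a) +
      δ ^ 2 * (a * S) + δ ^ 2 * (2 * (p * a)) + δ ^ 2 * -(a * w) + δ ^ 2 * (p * w) -
      (δ * l) * p ^ 2 - α₀ * z ^ 2 - δ ^ 2 * a ^ 2 := by ring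
  rw [e4, e2]
  have b5 : 0 ≤ α₀ * z ^ 2 := by positivity
  have b6 : 0 ≤ z ^ 2 := sq_nonneg z
  have b7 : 0 ≤ S ^ 2 := sq_nonneg S
  have b8 : 0 ≤ δ ^ 2 * w ^ 2 := by positivity
  linarith

theorem exists_dissipation {α lam : Fin m → ℝ} (hα : ∀ j, 0 < α j) (hlam : ∀ j, 0 < lam j)
    (j₀ : Fin m) {B : ℝ} (hB : 0 ≤ B) :
    ∃ δ c K : ℝ, 0 < δ ∧ 0 < c ∧ 0 < K ∧
      ∀ (a p w : Fin d → ℝ) (z : Fin m → Fin d → ℝ), ∑ k, w k ^ 2 ≤ B * ∑ k, p k ^ 2 →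
      ∑ k, (∑ j, z j k * (lam j * p k - α j * z j k) +
        (δ * p k - z j₀ k) *
          (δ * (a k - ∑ j, lam j * z j k) - (lam j₀ * p k - α j₀ * z j₀ k)) +
        δ ^ 2 * ((a k - p k) * (-w k - (a k - ∑ j, lam j * z j k)))) ≤
      -c * (∑ k, a k ^ 2 + ∑ k, p k ^ 2) + K * ∑ j, ∑ k, z j k ^ 2 := by
  have hl := hlam j₀
  set l := lam j₀ with hld
  set δ := min 1 (l / (4 * (9 + 3 * B))) with hδd
  have hδ : 0 < δ := by rw [hδd]; positivity
  have hδ1 : δ ≤ 1 := min_le_left _ _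
  have hδ2 : δ * (9 + 3 * B) ≤ l / 4 := by
    have h1 : δ ≤ l / (4 * (9 + 3 * B)) := min_le_right _ _
    calc δ * (9 + 3 * B) ≤ l / (4 * (9 + 3 * B)) * (9 + 3 * B) := by gcongr
      _ = l / 4 := by field_simp
  set K₁ := (1 + (α j₀ + l) ^ 2) / (4 * (δ * l / 8)) + 5 with hK₁
  have hK₁0 : 0 < K₁ := by rw [hK₁]; positivity
  set Λ := ∑ j, lam j ^ 2 with hΛ
  have hΛ0 : 0 ≤ Λ := Finset.sum_nonneg fun _ _ => sq_nonneg _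
  refine ⟨δ, min (δ * l / 2) (δ ^ 2 / 2), K₁ * (1 + Λ), hδ, by positivity, by positivity,
    fun a p w z hw => ?_⟩
  set S : Fin d → ℝ := fun k => ∑ j, lam j * z j k with hS
  have hS2 : ∀ k, S k ^ 2 ≤ Λ * ∑ j, z j k ^ 2 := fun k =>
    Finset.sum_mul_sq_le_sq_mul_sq Finset.univ lam fun j => z j k
  have hz0 : ∀ k, z j₀ k ^ 2 ≤ ∑ j, z j k ^ 2 := fun k =>
    Finset.single_le_sum (f := fun j => z j k ^ 2) (fun _ _ => sq_nonneg _) (Finset.mem_univ j₀)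
  have hcoord : ∀ k, ∑ j, z j k * (lam j * p k - α j * z j k) +
        (δ * p k - z j₀ k) * (δ * (a k - S k) - (l * p k - α j₀ * z j₀ k)) +
        δ ^ 2 * ((a k - p k) * (-w k - (a k - S k))) ≤
      (-(3 / 4 * δ * l) + 9 * δ ^ 2) * p k ^ 2 - δ ^ 2 / 2 * a k ^ 2 + 3 * δ ^ 2 * w k ^ 2 +
        K₁ * (1 + Λ) * ∑ j, z j k ^ 2 := fun k => by
    have h1 := dissipation_coord hδ hδ1 hl (hα j₀) (a k) (p k) (z j₀ k) (S k) (w k)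
    have h2 : ∑ j, z j k * (lam j * p k - α j * z j k) ≤ p k * S k := by
      rw [hS, Finset.mul_sum]
      refine Finset.sum_le_sum fun j _ => ?_
      nlinarith [mul_nonneg (hα j).le (sq_nonneg (z j k))]
    have h3 : K₁ * (z j₀ k ^ 2 + S k ^ 2) ≤ K₁ * ((1 + Λ) * ∑ j, z j k ^ 2) :=
      mul_le_mul_of_nonneg_left (by linarith [hS2 k, hz0 k]) hK₁0.le
    rw [← hK₁] at h1
    linarith
  refine (Finset.sum_le_sum fun k _ => hcoord k).trans ?_
  rw [Finset.sum_add_distrib, Finset.sum_add_distrib, Finset.sum_sub_distrib,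
    ← Finset.mul_sum, ← Finset.mul_sum, ← Finset.mul_sum, ← Finset.mul_sum,
    Finset.sum_comm (f := fun k j => z j k ^ 2)]
  have hA : 0 ≤ ∑ k, a k ^ 2 := Finset.sum_nonneg fun _ _ => sq_nonneg _
  have hP : 0 ≤ ∑ k, p k ^ 2 := Finset.sum_nonneg fun _ _ => sq_nonneg _
  have hw2 : 3 * δ ^ 2 * ∑ k, w k ^ 2 ≤ 3 * δ ^ 2 * (B * ∑ k, p k ^ 2) :=
    mul_le_mul_of_nonneg_left hw (by positivity)
  have hp2 : δ * (δ * (9 + 3 * B)) * ∑ k, p k ^ 2 ≤ δ * (l / 4) * ∑ k, p k ^ 2 := by gcongr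
  have m1 : min (δ * l / 2) (δ ^ 2 / 2) * ∑ k, a k ^ 2 ≤ δ ^ 2 / 2 * ∑ k, a k ^ 2 := by
    gcongr; exact min_le_right _ _
  have m2 : min (δ * l / 2) (δ ^ 2 / 2) * ∑ k, p k ^ 2 ≤ δ * l / 2 * ∑ k, p k ^ 2 := by
    gcongr; exact min_le_left _ _
  linarith

end Dissipation

section Lyapunov

variable {d m : ℕ} {β Z : ℝ} {V : (Fin d → ℝ) → ℝ} {α lam : Fin m → ℝ}

theorem genComm_add_smul (α lam : Fin m → ℝ) (V : (Fin d → ℝ) → ℝ) (a b : ℝ) (e e' : Xsp d m)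
    (φ : Xsp d m → ℝ) (x : Xsp d m) :
    genComm α lam V (a • e + b • e') φ x =
      a * genComm α lam V e φ x + b * genComm α lam V e' φ x := by
  simp only [genComm, map_add, map_smul, smul_eq_mul, Prod.fst_add, Prod.snd_add, Prod.smul_fst,
    Prod.smul_snd, Pi.add_apply, Pi.smul_apply, add_mul, mul_add, mul_sub, Finset.mul_sum,
    Finset.sum_add_distrib, Finset.sum_sub_distrib]
  have e1 : ∀ c r s : ℝ, c * r * s = c * (r * s) := fun c r s => by ring
  simp only [e1, mul_left_comm a, mul_left_comm b]
  ring

theorem genComm_eP (hV : ContDiff ℝ 2 V) (k : Fin d) (φ : Xsp d m → ℝ) (x : Xsp d m) :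
    genComm α lam V (eP d m k) φ x =
      fderiv ℝ φ x (eQ d m k) - ∑ j, lam j * fderiv ℝ φ x (eZ d m j k) := by
  simp only [genComm, fderiv_dHam_eQ hV]
  simp [eP, Pi.single_apply]
  ring

theorem genComm_eQ (k : Fin d) (φ : Xsp d m → ℝ) (x : Xsp d m) :
    genComm α lam V (eQ d m k) φ x =
      -∑ i, fderiv ℝ (fun y => dHam V y (eQ d m i)) x (eQ d m k) * fderiv ℝ φ x (eP d m i) := by
  simp only [genComm]
  simp [eQ]

theorem sum_sum_ite_ite {ι κ : Type*} [Fintype ι] [Fintype κ] [DecidableEq ι] [DecidableEq κ]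
    (j : ι) (k : κ) (f : ι → κ → ℝ) :
    (∑ i, ∑ l, if i = j then if l = k then f i l else 0 else 0) = f j k := by
  rw [Finset.sum_eq_single j (fun i _ hi => by simp [hi]) (by simp)]
  simp

theorem genComm_eZ (j : Fin m) (k : Fin d) (φ : Xsp d m → ℝ)
    (x : Xsp d m) : genComm α lam V (eZ d m j k) φ x =
      lam j * fderiv ℝ φ x (eP d m k) - α j * fderiv ℝ φ x (eZ d m j k) := by
  have h : ∀ (i : Fin m) (l : Fin d), (eZ d m j k).2.2 i l =
      if i = j then (if l = k then 1 else 0) else 0 := fun i l => by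
    simp only [eZ, zdir, Function.update_apply]
    split_ifs <;> simp_all
  have h1 : (eZ d m j k).2.1 = 0 := rfl
  have h2 : ∀ (x : Xsp d m) l, fderiv ℝ (fun y => dHam V y (eQ d m l)) x (eZ d m j k) = 0 :=
    fun x l => by
      by_cases hc : DifferentiableAt ℝ (fun y : Xsp d m => dHam V y (eQ d m l)) x
      · exact fderiv_eq_zero_of_line hc fun r => by simp only [dHam_eQ]; simp [eZ, zdir]
      · rw [fderiv_zero_of_not_differentiableAt hc]; rfl
  simp only [genComm, h, h1, h2, Pi.zero_apply, zero_mul, sub_zero, Finset.sum_const_zero,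
    zero_add, ite_mul, one_mul, mul_ite, mul_zero]
  rw [sum_sum_ite_ite j k fun i l => lam i * fderiv ℝ φ x (eP d m l),
    sum_sum_ite_ite j k fun i l => α i * fderiv ℝ φ x (eZ d m i l)]

/-- The squared length of the gradient. -/
def gradSq (f : Xsp d m → ℝ) (x : Xsp d m) : ℝ :=
  ∑ k, fderiv ℝ f x (eQ d m k) ^ 2 + ∑ k, fderiv ℝ f x (eP d m k) ^ 2 +
    ∑ j, ∑ k, fderiv ℝ f x (eZ d m j k) ^ 2

/-- `Ψ` is locally integrable on `[0, ∞)` and is the derivative of `F` in the integrated sense. -/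
def Evolves (F Ψ : ℝ → ℝ) : Prop :=
  ∀ s t, 0 ≤ s → s ≤ t → IntervalIntegrable Ψ volume s t ∧ F t - F s = ∫ r in s..t, Ψ r

theorem Evolves.const_mul {F Ψ : ℝ → ℝ} (h : Evolves F Ψ) (c : ℝ) :
    Evolves (fun t => c * F t) fun t => c * Ψ t := fun s t hs hst => by
  obtain ⟨h1, h2⟩ := h s t hs hst
  exact ⟨h1.const_mul c, by rw [intervalIntegral.integral_const_mul, ← h2, mul_sub]⟩

theorem Evolves.add {F Ψ G Θ : ℝ → ℝ} (h : Evolves F Ψ) (h' : Evolves G Θ) :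
    Evolves (fun t => F t + G t) fun t => Ψ t + Θ t := fun s t hs hst => by
  obtain ⟨h1, h2⟩ := h s t hs hst
  obtain ⟨h3, h4⟩ := h' s t hs hst
  exact ⟨h1.add h3, by rw [intervalIntegral.integral_add h1 h3, ← h2, ← h4]; ring⟩

theorem Evolves.sum {ι : Type*} [Fintype ι] {F Ψ : ι → ℝ → ℝ} (h : ∀ i, Evolves (F i) (Ψ i)) :
    Evolves (fun t => ∑ i, F i t) fun t => ∑ i, Ψ i t := fun s t hs hst => by
  refine ⟨?_, ?_⟩
  · simpa [Finset.sum_fn] using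
      IntervalIntegrable.sum Finset.univ fun i _ => (h i s t hs hst).1
  · rw [intervalIntegral.integral_finsetSum fun i _ => (h i s t hs hst).1,
      ← Finset.sum_sub_distrib]
    exact Finset.sum_congr rfl fun i _ => (h i s t hs hst).2

/-- The modified momentum direction. -/
def modP (δ : ℝ) (j₀ : Fin m) (k : Fin d) : Xsp d m := δ • eP d m k + (-1 : ℝ) • eZ d m j₀ k

/-- The modified position direction. -/
def modQ (d m : ℕ) (k : Fin d) : Xsp d m := (1 : ℝ) • eQ d m k + (-1 : ℝ) • eP d m k

/-- The modified `H¹` energy of a function. -/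
def lyapunov (K δ : ℝ) (j₀ : Fin m) (μ : Measure (Xsp d m)) (f : Xsp d m → ℝ) : ℝ :=
  K * ∫ x, f x ^ 2 ∂μ + ∑ k, (∑ j, ∫ x, fderiv ℝ f x (eZ d m j k) ^ 2 ∂μ +
    ∫ x, fderiv ℝ f x (modP δ j₀ k) ^ 2 ∂μ + δ ^ 2 * ∫ x, fderiv ℝ f x (modQ d m k) ^ 2 ∂μ)

theorem apply_modP (L : Xsp d m →L[ℝ] ℝ) (δ : ℝ) (j₀ : Fin m) (k : Fin d) :
    L (modP δ j₀ k) = δ * L (eP d m k) - L (eZ d m j₀ k) := by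
  simp [modP, sub_eq_add_neg]

theorem apply_modQ (L : Xsp d m →L[ℝ] ℝ) (k : Fin d) :
    L (modQ d m k) = L (eQ d m k) - L (eP d m k) := by
  simp [modQ, sub_eq_add_neg]

section Comparison

variable {μ : Measure (Xsp d m)} {f : Xsp d m → ℝ}

theorem TwiceL2.integrable_gradSq (h : TwiceL2 μ f) : Integrable (gradSq f) μ := by
  have hi := fun v => (h.memLp_fderiv v).integrable_sq
  exact ((integrable_finsetSum _ fun k _ => hi _).fun_add
    (integrable_finsetSum _ fun k _ => hi _)).fun_add
    (integrable_finsetSum _ fun j _ => integrable_finsetSum _ fun k _ => hi _)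

theorem TwiceL2.integrable_lyapunov (h : TwiceL2 μ f) (K δ : ℝ) (j₀ : Fin m) :
    Integrable (fun x => K * f x ^ 2 + ∑ k, (∑ j, fderiv ℝ f x (eZ d m j k) ^ 2 +
      fderiv ℝ f x (modP δ j₀ k) ^ 2 + δ ^ 2 * fderiv ℝ f x (modQ d m k) ^ 2)) μ := by
  have hi := fun v => (h.memLp_fderiv v).integrable_sq
  exact (h.memLp.integrable_sq.const_mul K).fun_add (integrable_finsetSum _ fun k _ =>
    ((integrable_finsetSum _ fun j _ => hi _).fun_add (hi _)).fun_add ((hi _).const_mul _))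

theorem TwiceL2.lyapunov_eq (h : TwiceL2 μ f) (K δ : ℝ) (j₀ : Fin m) :
    lyapunov K δ j₀ μ f = ∫ x, (K * f x ^ 2 + ∑ k, (∑ j, fderiv ℝ f x (eZ d m j k) ^ 2 +
      fderiv ℝ f x (modP δ j₀ k) ^ 2 + δ ^ 2 * fderiv ℝ f x (modQ d m k) ^ 2)) ∂μ := by
  have hi := fun v => (h.memLp_fderiv v).integrable_sq
  have h1 := fun k => integrable_finsetSum Finset.univ fun (j : Fin m) _ => hi (eZ d m j k)
  have h2 := fun k => (h1 k).fun_add (hi (modP δ j₀ k))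
  have h3 := fun k => (hi (modQ d m k)).const_mul (δ ^ 2)
  rw [integral_add (h.memLp.integrable_sq.const_mul K)
    (integrable_finsetSum _ fun k _ => (h2 k).fun_add (h3 k)), integral_const_mul,
    integral_finsetSum _ fun k _ => (h2 k).fun_add (h3 k), lyapunov]
  congr 1
  refine Finset.sum_congr rfl fun k _ => ?_
  rw [integral_add (h2 k) (h3 k), integral_add (h1 k) (hi _), integral_const_mul,
    integral_finsetSum _ fun j _ => hi _]

theorem gradSq_eq (f : Xsp d m → ℝ) (x : Xsp d m) : gradSq f x =
    ∑ k, (fderiv ℝ f x (eQ d m k) ^ 2 + fderiv ℝ f x (eP d m k) ^ 2 +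
      ∑ j, fderiv ℝ f x (eZ d m j k) ^ 2) := by
  rw [gradSq, Finset.sum_comm, ← Finset.sum_add_distrib, ← Finset.sum_add_distrib]

theorem TwiceL2.lyapunov_le (h : TwiceL2 μ f) {K : ℝ} (hK : 1 ≤ K) (δ : ℝ) (j₀ : Fin m) :
    lyapunov K δ j₀ μ f ≤ (K + 3 + 4 * δ ^ 2) * ∫ x, (f x ^ 2 + gradSq f x) ∂μ := by
  rw [h.lyapunov_eq, ← integral_const_mul]
  refine integral_mono (h.integrable_lyapunov K δ j₀)
    ((h.memLp.integrable_sq.fun_add h.integrable_gradSq).const_mul _) fun x => ?_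
  dsimp only
  rw [gradSq_eq, mul_add, Finset.mul_sum]
  refine add_le_add (by nlinarith [sq_nonneg (f x), sq_nonneg (δ * f x)])
    (Finset.sum_le_sum fun k _ => ?_)
  rw [apply_modP, apply_modQ]
  set L := fderiv ℝ f x
  have hz : L (eZ d m j₀ k) ^ 2 ≤ ∑ j, L (eZ d m j k) ^ 2 :=
    Finset.single_le_sum (f := fun j => L (eZ d m j k) ^ 2) (fun _ _ => sq_nonneg _)
      (Finset.mem_univ j₀)
  set S := ∑ j, L (eZ d m j k) ^ 2
  have hS : 0 ≤ S := (sq_nonneg _).trans hz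
  have hδ := sq_nonneg δ
  nlinarith [mul_nonneg hδ hS, mul_nonneg (by linarith : 0 ≤ K) hS,
    mul_nonneg (by linarith : 0 ≤ K) (sq_nonneg (L (eP d m k))),
    mul_nonneg (by linarith : 0 ≤ K) (sq_nonneg (L (eQ d m k))),
    sq_nonneg (δ * L (eP d m k) + L (eZ d m j₀ k)), sq_nonneg (δ * (L (eQ d m k) + L (eP d m k))),
    sq_nonneg (L (eP d m k)), sq_nonneg (L (eQ d m k)), sq_nonneg (δ * L (eQ d m k)),
    sq_nonneg (δ * L (eP d m k))]

theorem TwiceL2.le_lyapunov (h : TwiceL2 μ f) {K δ : ℝ} (hK : 1 ≤ K) (hδ : 0 < δ) (j₀ : Fin m) :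
    ∫ x, (f x ^ 2 + gradSq f x) ∂μ ≤ (6 / δ ^ 2 + 1) * lyapunov K δ j₀ μ f := by
  rw [h.lyapunov_eq, ← integral_const_mul]
  refine integral_mono (h.memLp.integrable_sq.fun_add h.integrable_gradSq)
    ((h.integrable_lyapunov K δ j₀).const_mul _) fun x => ?_
  dsimp only
  have hc : 0 < 6 / δ ^ 2 := by positivity
  have hcδ : 6 / δ ^ 2 * δ ^ 2 = 6 := by field_simp
  set c := 6 / δ ^ 2
  rw [gradSq_eq, mul_add, Finset.mul_sum]
  refine add_le_add ?_ (Finset.sum_le_sum fun k _ => ?_)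
  · nlinarith [mul_nonneg hc.le (mul_nonneg (by linarith : 0 ≤ K) (sq_nonneg (f x))),
      mul_nonneg (by linarith : 0 ≤ K - 1) (sq_nonneg (f x))]
  rw [apply_modP, apply_modQ]
  set L := fderiv ℝ f x
  have hz : L (eZ d m j₀ k) ^ 2 ≤ ∑ j, L (eZ d m j k) ^ 2 :=
    Finset.single_le_sum (f := fun j => L (eZ d m j k) ^ 2) (fun _ _ => sq_nonneg _)
      (Finset.mem_univ j₀)
  set S := ∑ j, L (eZ d m j k) ^ 2
  set a := L (eQ d m k)
  set p := L (eP d m k)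
  set z := L (eZ d m j₀ k)
  have e1 : δ ^ 2 * p ^ 2 ≤ 2 * (δ * p - z) ^ 2 + 2 * S := by
    nlinarith [sq_nonneg (δ * p - 2 * z)]
  have e2 : 6 * p ^ 2 ≤ c * (2 * (δ * p - z) ^ 2 + 2 * S) := by
    calc 6 * p ^ 2 = c * (δ ^ 2 * p ^ 2) := by rw [← mul_assoc, hcδ]
      _ ≤ _ := mul_le_mul_of_nonneg_left e1 hc.le
  have e3 : a ^ 2 ≤ 2 * (a - p) ^ 2 + 2 * p ^ 2 := by nlinarith [sq_nonneg (a - 2 * p)]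
  have e4 : (c + 1) * (S + (δ * p - z) ^ 2 + δ ^ 2 * (a - p) ^ 2) =
      c * S + c * (δ * p - z) ^ 2 + 6 * (a - p) ^ 2 + S + (δ * p - z) ^ 2 +
        δ ^ 2 * (a - p) ^ 2 := by rw [← hcδ]; ring
  rw [e4]
  nlinarith [sq_nonneg (a - p), sq_nonneg (δ * p - z), mul_nonneg (sq_nonneg δ) (sq_nonneg (a - p))]

end Comparison

end Lyapunov

section Decay

variable {d m : ℕ} {β Z : ℝ} {V : (Fin d → ℝ) → ℝ} {α lam : Fin m → ℝ}

theorem exists_bound_sum_hess (hV : ContDiff ℝ 2 V) (hVp : PerV d V) :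
    ∃ B : ℝ, 0 ≤ B ∧ ∀ (x : Xsp d m) (p : Fin d → ℝ),
      ∑ k, (∑ i, fderiv ℝ (fun y => dHam V y (eQ d m i)) x (eQ d m k) * p i) ^ 2 ≤
        B * ∑ i, p i ^ 2 := by
  choose M hM0 hM using fun i k => exists_bound_fderiv_dHam_eQ hV hVp i (eQ d m k)
  refine ⟨∑ k, ∑ i, M i k ^ 2, Finset.sum_nonneg fun _ _ => Finset.sum_nonneg fun _ _ =>
    sq_nonneg _, fun x p => ?_⟩
  rw [Finset.sum_mul]
  refine Finset.sum_le_sum fun k _ => (Finset.sum_mul_sq_le_sq_mul_sq _ _ _).trans ?_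
  refine mul_le_mul_of_nonneg_right (Finset.sum_le_sum fun i _ => ?_)
    (Finset.sum_nonneg fun _ _ => sq_nonneg _)
  exact sq_le_sq.2 ((hM i k x).trans (le_abs_self _))

theorem le_dirichlet (hβ : 0 < β) {a : ℝ} (ha : ∀ j, a ≤ α j) {μ : Measure (Xsp d m)}
    {f : Xsp d m → ℝ} (h : TwiceL2 μ f) :
    a * β⁻¹ * ∫ x, ∑ j, ∑ k, fderiv ℝ f x (eZ d m j k) ^ 2 ∂μ ≤ dirichlet β α μ f := by
  have hi := fun v => (h.memLp_fderiv v).integrable_sq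
  rw [integral_finsetSum _ fun j _ => integrable_finsetSum _ fun k _ => hi _, dirichlet,
    Finset.mul_sum]
  refine Finset.sum_le_sum fun j _ => ?_
  rw [integral_finsetSum _ fun k _ => hi _, Finset.mul_sum]
  refine Finset.sum_le_sum fun k _ => ?_
  rw [mul_assoc]
  exact mul_le_mul_of_nonneg_right (ha j)
    (mul_nonneg (inv_nonneg.2 hβ.le) (integral_nonneg fun _ => sq_nonneg _))

variable {φ : ℝ → Xsp d m → ℝ}

theorem exists_lyapunov (hβ : 0 < β) (hα : ∀ j, 0 < α j) (hlam : ∀ j, 0 < lam j)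
    (hV : ContDiff ℝ 2 V) (hVp : PerV d V) (hZ : 0 < Z) [IsFiniteMeasure (gibbs d m β Z V)]
    (j₀ : Fin m) :
    ∃ K δ c : ℝ, 1 ≤ K ∧ 0 < δ ∧ 0 < c ∧
      ∀ φ : ℝ → Xsp d m → ℝ, KolmogorovSolution d m β Z α lam V φ →
        ∃ Ψ : ℝ → ℝ, Evolves (fun t => lyapunov K δ j₀ (gibbs d m β Z V) (φ t)) Ψ ∧
          ∀ t, 0 ≤ t → Ψ t ≤ -c * ∫ x, gradSq (φ t) x ∂gibbs d m β Z V := by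
  obtain ⟨B, hB0, hB⟩ := exists_bound_sum_hess (m := m) hV hVp
  obtain ⟨δ, c, K₁, hδ, hc, hK₁, hdis⟩ := exists_dissipation hα hlam j₀ hB0
  have : Nonempty (Fin m) := ⟨j₀⟩
  obtain ⟨i₀, hi₀⟩ := Finite.exists_min α
  set b := α i₀ * β⁻¹ with hb
  have hb0 : 0 < b := mul_pos (hα i₀) (inv_pos.2 hβ)
  set K := 1 + (K₁ + c) / b with hK
  have hKb : K₁ + c ≤ K * b := by
    rw [hK, add_mul, div_mul_cancel₀ _ hb0.ne']; linarith
  have hK1 : 1 ≤ K := by rw [hK]; have : 0 < (K₁ + c) / b := by positivity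
                         linarith
  refine ⟨K, δ, 2 * c, hK1, hδ, by positivity, fun φ h => ?_⟩
  set μ := gibbs d m β Z V with hμ
  set Θ : Xsp d m → ℝ → ℝ := fun e r =>
    2 * ∫ x, fderiv ℝ (φ r) x e * genComm α lam V e (φ r) x ∂μ -
      2 * dirichlet β α μ fun x => fderiv ℝ (φ r) x e with hΘ
  have hev : ∀ e, Evolves (fun t => ∫ x, fderiv ℝ (φ t) x e ^ 2 ∂μ) (Θ e) :=
    fun e s t hs hst => h.energy_fderiv hβ hV hVp hZ e hs hst
  have hev0 : Evolves (fun t => ∫ x, φ t x ^ 2 ∂μ) fun r => -2 * dirichlet β α μ (φ r) :=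
    fun s t hs hst => h.energy hβ hV hVp hZ hs hst
  refine ⟨_, (hev0.const_mul K).add (Evolves.sum fun k => ((Evolves.sum fun j =>
    hev (eZ d m j k)).add (hev (modP δ j₀ k))).add ((hev (modQ d m k)).const_mul (δ ^ 2))),
    fun t ht => ?_⟩
  have h2 := h.sobolev.twiceL2 ht
  set I : Xsp d m → ℝ := fun e => ∫ x, fderiv ℝ (φ t) x e * genComm α lam V e (φ t) x ∂μ with hI
  have hint : ∀ e, Integrable (fun x => fderiv ℝ (φ t) x e * genComm α lam V e (φ t) x) μ :=
    fun e => ((h.sobolev.fderiv e).locL2.memLp ht).integrable_mul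
      ((h.sobolev.locL2_genComm hV hVp α lam e).memLp ht)
  have hle : ∀ e, Θ e t ≤ 2 * I e := fun e => by
    have := dirichlet_nonneg hβ hα μ fun x => fderiv ℝ (φ t) x e
    simp only [hΘ, hI]; linarith
  have hi := fun v => (h2.memLp_fderiv v).integrable_sq
  have s1 := fun k => integrable_finsetSum Finset.univ fun (j : Fin m) _ => hint (eZ d m j k)
  have s2 := fun k => (s1 k).fun_add (hint (modP δ j₀ k))
  have s3 := fun k => (hint (modQ d m k)).const_mul (δ ^ 2)
  have iA := integrable_finsetSum Finset.univ fun (k : Fin d) _ => hi (eQ d m k)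
  have iP := integrable_finsetSum Finset.univ fun (k : Fin d) _ => hi (eP d m k)
  have iZ := integrable_finsetSum Finset.univ fun (j : Fin m) _ =>
    integrable_finsetSum Finset.univ fun (k : Fin d) _ => hi (eZ d m j k)
  have key : ∑ k, (∑ j, I (eZ d m j k) + I (modP δ j₀ k) + δ ^ 2 * I (modQ d m k)) ≤
      -c * ∫ x, gradSq (φ t) x ∂μ +
        (K₁ + c) * ∫ x, ∑ j, ∑ k, fderiv ℝ (φ t) x (eZ d m j k) ^ 2 ∂μ := by
    have e1 : ∑ k, (∑ j, I (eZ d m j k) + I (modP δ j₀ k) + δ ^ 2 * I (modQ d m k)) =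
        ∫ x, ∑ k, (∑ j, fderiv ℝ (φ t) x (eZ d m j k) * genComm α lam V (eZ d m j k) (φ t) x +
          fderiv ℝ (φ t) x (modP δ j₀ k) * genComm α lam V (modP δ j₀ k) (φ t) x +
          δ ^ 2 * (fderiv ℝ (φ t) x (modQ d m k) *
            genComm α lam V (modQ d m k) (φ t) x)) ∂μ := by
      rw [integral_finsetSum _ fun k _ => (s2 k).fun_add (s3 k)]
      refine Finset.sum_congr rfl fun k _ => ?_
      rw [integral_add (s2 k) (s3 k), integral_add (s1 k) (hint _), integral_const_mul,
        integral_finsetSum _ fun j _ => hint _]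
    rw [e1, ← integral_const_mul, ← integral_const_mul,
      ← integral_add (h2.integrable_gradSq.const_mul _) (iZ.const_mul _)]
    refine integral_mono (integrable_finsetSum _ fun k _ => (s2 k).fun_add (s3 k))
      ((h2.integrable_gradSq.const_mul _).fun_add (iZ.const_mul _)) fun x => ?_
    have hd := hdis (fun k => fderiv ℝ (φ t) x (eQ d m k)) (fun k => fderiv ℝ (φ t) x (eP d m k))
      (fun k => ∑ i, fderiv ℝ (fun y => dHam V y (eQ d m i)) x (eQ d m k) *
        fderiv ℝ (φ t) x (eP d m i)) (fun j k => fderiv ℝ (φ t) x (eZ d m j k))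
      (hB x fun i => fderiv ℝ (φ t) x (eP d m i))
    simp only [apply_modP, apply_modQ]
    simp only [modP, modQ, genComm_add_smul, genComm_eZ, genComm_eP hV, genComm_eQ]
    rw [gradSq]
    refine le_trans (le_of_eq (Finset.sum_congr rfl fun k _ => ?_)) (hd.trans (le_of_eq ?_))
    · ring
    · ring
  have hdir := mul_le_mul_of_nonneg_left (le_dirichlet hβ hi₀ h2) (by linarith : 0 ≤ K)
  have hZ0 : 0 ≤ ∫ x, ∑ j, ∑ k, fderiv ℝ (φ t) x (eZ d m j k) ^ 2 ∂μ :=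
    integral_nonneg fun _ => Finset.sum_nonneg fun _ _ => Finset.sum_nonneg fun _ _ => sq_nonneg _
  have hKz := mul_le_mul_of_nonneg_right hKb hZ0
  have hsum : ∑ k, (∑ j, Θ (eZ d m j k) t + Θ (modP δ j₀ k) t + δ ^ 2 * Θ (modQ d m k) t) ≤
      2 * ∑ k, (∑ j, I (eZ d m j k) + I (modP δ j₀ k) + δ ^ 2 * I (modQ d m k)) := by
    rw [Finset.mul_sum]
    refine Finset.sum_le_sum fun k _ => ?_
    rw [mul_add, mul_add, Finset.mul_sum]
    refine add_le_add (add_le_add (Finset.sum_le_sum fun j _ => hle _) (hle _)) ?_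
    linarith [mul_le_mul_of_nonneg_left (hle (modQ d m k)) (sq_nonneg δ)]
  rw [← hb] at hdir
  linarith

end Decay

section Gaussian

/-- Rotation in the plane spanned by the two factors of a product. -/
def planeRotation (E : Type*) [AddCommGroup E] [Module ℝ E] (θ : ℝ) : E × E →ₗ[ℝ] E × E :=
  LinearMap.prod (cos θ • LinearMap.fst ℝ E E + sin θ • LinearMap.snd ℝ E E)
    (-sin θ • LinearMap.fst ℝ E E + cos θ • LinearMap.snd ℝ E E)

theorem planeRotation_apply {E : Type*} [AddCommGroup E] [Module ℝ E] (θ : ℝ) (y : E × E) :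
    planeRotation E θ y = (cos θ • y.1 + sin θ • y.2, -sin θ • y.1 + cos θ • y.2) := rfl

theorem abs_det_planeRotation {E : Type*} [AddCommGroup E] [Module ℝ E] (θ : ℝ) :
    |LinearMap.det (planeRotation E θ)| = 1 := by
  have h1 : planeRotation E θ ∘ₗ planeRotation E (-θ) = LinearMap.id := by
    refine LinearMap.ext fun y => Prod.ext ?_ ?_ <;>
    simp only [LinearMap.comp_apply, planeRotation_apply, cos_neg, sin_neg, LinearMap.id_apply]
    · calc _ = (cos θ ^ 2 + sin θ ^ 2) • y.1 := by module
        _ = y.1 := by rw [cos_sq_add_sin_sq, one_smul]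
    · calc _ = (cos θ ^ 2 + sin θ ^ 2) • y.2 := by module
        _ = y.2 := by rw [cos_sq_add_sin_sq, one_smul]
  have h2 : planeRotation E (-θ) = (LinearEquiv.prodComm ℝ E E : E × E →ₗ[ℝ] E × E) ∘ₗ
      planeRotation E θ ∘ₗ (LinearEquiv.prodComm ℝ E E).symm := by
    refine LinearMap.ext fun y => Prod.ext ?_ ?_ <;>
    simp [planeRotation_apply] <;> module
  have h3 := congrArg LinearMap.det h1
  rw [LinearMap.det_comp, h2, LinearMap.det_conj, LinearMap.det_id] at h3
  rcases mul_self_eq_one_iff.1 h3 with h | h <;> simp [h]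

theorem map_planeRotation {E : Type*} [NormedAddCommGroup E] [NormedSpace ℝ E] [MeasurableSpace E]
    [BorelSpace E] [FiniteDimensional ℝ E] (μ : Measure E) [μ.IsAddHaarMeasure] (θ : ℝ) :
    (μ.prod μ).map (planeRotation E θ) = μ.prod μ := by
  have h := abs_det_planeRotation (E := E) θ
  rw [Measure.map_linearMap_addHaar_eq_smul_addHaar (μ.prod μ) fun h0 => by simp [h0] at h,
    abs_inv, h]
  simp

variable {d m : ℕ}

/-- The momentum and auxiliary variables. -/
abbrev Ysp (d m : ℕ) := (Fin d → ℝ) × (Fin m → Fin d → ℝ)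

/-- The squared Euclidean norm. -/
def normSqY (y : Ysp d m) : ℝ := ∑ i, y.1 i ^ 2 + ∑ j, ∑ i, y.2 j i ^ 2

theorem continuous_normSqY : Continuous (normSqY : Ysp d m → ℝ) := by
  unfold normSqY; fun_prop

theorem normSqY_nonneg (y : Ysp d m) : 0 ≤ normSqY y :=
  add_nonneg (Finset.sum_nonneg fun _ _ => sq_nonneg _)
    (Finset.sum_nonneg fun _ _ => Finset.sum_nonneg fun _ _ => sq_nonneg _)

theorem normSqY_rotate (θ : ℝ) (y y' : Ysp d m) :
    normSqY (cos θ • y + sin θ • y') + normSqY (-sin θ • y + cos θ • y') =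
      normSqY y + normSqY y' := by
  have key : ∀ a b : ℝ, (cos θ * a + sin θ * b) ^ 2 + (-sin θ * a + cos θ * b) ^ 2 =
      a ^ 2 + b ^ 2 := fun a b => by
    linear_combination (a ^ 2 + b ^ 2) * cos_sq_add_sin_sq θ
  simp only [normSqY, Prod.fst_add, Prod.snd_add, Prod.smul_fst, Prod.smul_snd, Pi.add_apply,
    Pi.smul_apply, smul_eq_mul]
  rw [add_add_add_comm, add_add_add_comm (∑ i, y.1 i ^ 2)]
  simp only [← Finset.sum_add_distrib, key]

/-- The Gaussian weight. -/
def gaussWeight (β : ℝ) (y : Ysp d m) : ENNReal := ENNReal.ofReal (exp (-β / 2 * normSqY y))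

theorem measurable_gaussWeight (β : ℝ) : Measurable (gaussWeight β : Ysp d m → ENNReal) := by
  have := continuous_normSqY (d := d) (m := m)
  unfold gaussWeight
  fun_prop

/-- The unnormalised Gaussian measure. -/
def gaussY (d m : ℕ) (β : ℝ) : Measure (Ysp d m) := volume.withDensity (gaussWeight β)

instance (β : ℝ) : SFinite (gaussY d m β) := by
  unfold gaussY; infer_instance

theorem lintegral_gaussY_rotate (β θ : ℝ) {G : Ysp d m × Ysp d m → ENNReal} (hG : Measurable G) :
    ∫⁻ y, G (planeRotation _ θ y) ∂(gaussY d m β).prod (gaussY d m β) =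
      ∫⁻ y, G y ∂(gaussY d m β).prod (gaussY d m β) := by
  have hw := measurable_gaussWeight (d := d) (m := m) β
  have hR : Measurable (planeRotation (Ysp d m) θ) :=
    (LinearMap.continuous_of_finiteDimensional _).measurable
  have hww : Measurable fun z : Ysp d m × Ysp d m => gaussWeight β z.1 * gaussWeight β z.2 := by
    fun_prop
  rw [gaussY, prod_withDensity hw hw, lintegral_withDensity_eq_lintegral_mul _ hww
      (g := fun y => G (planeRotation _ θ y)) (hG.comp hR),
    lintegral_withDensity_eq_lintegral_mul _ hww hG]
  conv_rhs => rw [← map_planeRotation (volume : Measure (Ysp d m)) θ,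
    lintegral_map (hww.mul hG) hR]
  refine lintegral_congr fun y => ?_
  simp only [Pi.mul_apply]
  congr 1
  simp only [gaussWeight, planeRotation_apply]
  rw [← ENNReal.ofReal_mul (exp_pos _).le, ← ENNReal.ofReal_mul (exp_pos _).le, ← exp_add,
    ← exp_add, ← mul_add, ← mul_add, normSqY_rotate]

/-- Lebesgue measure on the torus times the Gaussian measure. -/
def flatGibbs (d m : ℕ) (β : ℝ) : Measure (Xsp d m) :=
  ((volume : Measure (Fin d → ℝ)).restrict (cube d)).prod (gaussY d m β)

instance (β : ℝ) : SFinite (flatGibbs d m β) := by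
  unfold flatGibbs; infer_instance

theorem flatGibbs_eq (β : ℝ) : flatGibbs d m β =
    (volX d m).withDensity fun x => gaussWeight β x.2 := by
  rw [flatGibbs, gaussY, prod_withDensity_right (measurable_gaussWeight β), volX_eq_prod]

theorem lintegral_flatGibbs_translate (β : ℝ) {F : Xsp d m → ENNReal} (hFm : Measurable F)
    (hF : ∀ (k : Fin d → ℤ) (x : Xsp d m), F (x.1 + (fun i => (k i : ℝ)), x.2) = F x)
    (w : Fin d → ℝ) :
    ∫⁻ x, F (x.1 + w, x.2) ∂flatGibbs d m β = ∫⁻ x, F x ∂flatGibbs d m β := by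
  rw [flatGibbs, lintegral_prod_symm' _ (by fun_prop), lintegral_prod_symm' _ hFm]
  exact lintegral_congr fun y => lintegral_cube_translate (fun q => F (q, y))
    (fun k q => hF k (q, y)) w

/-- The rotation of two independent copies of the Gaussian variable, combined with a shift
of the position. -/
def rotShift (θ : ℝ) (u : Xsp d m × Xsp d m) : Xsp d m × Xsp d m :=
  ((u.1.1 + sin θ • u.2.1, cos θ • u.1.2 + sin θ • u.2.2),
    (u.2.1, -sin θ • u.1.2 + cos θ • u.2.2))

theorem lintegral_rotShift (β θ : ℝ) {G : Xsp d m × Xsp d m → ENNReal} (hG : Measurable G)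
    (hp : ∀ (k : Fin d → ℤ) (x x' : Xsp d m),
      G ((x.1 + (fun i => (k i : ℝ)), x.2), x') = G (x, x')) :
    ∫⁻ u, G (rotShift θ u) ∂(flatGibbs d m β).prod (flatGibbs d m β) =
      ∫⁻ u, G u ∂(flatGibbs d m β).prod (flatGibbs d m β) := by
  have expand : ∀ H : Xsp d m × Xsp d m → ENNReal, Measurable H →
      ∫⁻ u, H u ∂(flatGibbs d m β).prod (flatGibbs d m β) =
        ∫⁻ w in cube d, ∫⁻ q in cube d, ∫⁻ y, H ((q, y.1), (w, y.2))
          ∂(gaussY d m β).prod (gaussY d m β) := fun H hH => by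
    rw [lintegral_prod _ hH.aemeasurable, flatGibbs,
      lintegral_prod _ hH.lintegral_prod_right'.aemeasurable,
      lintegral_lintegral_swap (f := fun w q => ∫⁻ y, H ((q, y.1), (w, y.2))
          ∂(gaussY d m β).prod (gaussY d m β))]
    · refine lintegral_congr fun q => ?_
      have h1 : ∀ y, ∫⁻ x', H ((q, y), x')
          ∂((volume.restrict (cube d)).prod (gaussY d m β)) =
          ∫⁻ w in cube d, ∫⁻ y', H ((q, y), (w, y')) ∂gaussY d m β := fun y =>
        lintegral_prod _ (by fun_prop)
      simp_rw [h1]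
      rw [lintegral_lintegral_swap]
      · exact lintegral_congr fun w =>
          (lintegral_prod (fun y => H ((q, y.1), (w, y.2))) (by fun_prop)).symm
      · exact (Measurable.lintegral_prod_right (f := fun (z : Ysp d m × (Fin d → ℝ)) y' =>
          H ((q, z.1), (z.2, y'))) (by fun_prop)).aemeasurable
    · exact (Measurable.lintegral_prod_right
        (f := fun (z : (Fin d → ℝ) × (Fin d → ℝ)) (y : Ysp d m × Ysp d m) =>
          H ((z.2, y.1), (z.1, y.2))) (by fun_prop)).aemeasurable
  have hr : Measurable (rotShift (d := d) (m := m) θ) := by unfold rotShift; fun_prop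
  rw [expand (fun u => G (rotShift θ u)) (hG.comp hr), expand _ hG]
  refine lintegral_congr fun w => ?_
  refine Eq.trans ?_ (lintegral_cube_translate (fun q => ∫⁻ y, G ((q, y.1), (w, y.2))
    ∂(gaussY d m β).prod (gaussY d m β)) ?_ (sin θ • w))
  · exact lintegral_congr fun q => lintegral_gaussY_rotate β θ
      (G := fun y => G ((q + sin θ • w, y.1), (w, y.2))) (by fun_prop)
  · intro k q
    exact lintegral_congr fun y => hp k (q, y.1) (w, y.2)

end Gaussian

section Poincare

theorem ofReal_sq_sub_le_lintegral {h h' : ℝ → ℝ} {L : ℝ} (hL : 0 < L)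
    (hd : ∀ θ, HasDerivAt h (h' θ) θ) (hc : Continuous h') :
    ENNReal.ofReal ((h L - h 0) ^ 2) ≤
      ENNReal.ofReal L * ∫⁻ θ in Set.Ioc 0 L, ENNReal.ofReal (h' θ ^ 2) := by
  have h1 : ∫ θ in (0:ℝ)..L, h' θ = h L - h 0 :=
    intervalIntegral.integral_eq_sub_of_hasDerivAt (fun θ _ => hd θ) (hc.intervalIntegrable _ _)
  have hi : IntervalIntegrable (fun θ => h' θ ^ 2) volume 0 L :=
    (hc.pow 2).intervalIntegrable _ _
  have h2 : (h L - h 0) ^ 2 ≤ L * ∫ θ in (0:ℝ)..L, h' θ ^ 2 := by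
    set a := (h L - h 0) / L with ha
    have h3 : 0 ≤ ∫ θ in (0:ℝ)..L, (h' θ - a) ^ 2 :=
      intervalIntegral.integral_nonneg hL.le fun _ _ => sq_nonneg _
    have h4 : ∫ θ in (0:ℝ)..L, (h' θ - a) ^ 2 =
        (∫ θ in (0:ℝ)..L, h' θ ^ 2) - 2 * a * (h L - h 0) + a ^ 2 * L := by
      have e : ∀ θ, (h' θ - a) ^ 2 = h' θ ^ 2 - 2 * a * h' θ + a ^ 2 := fun θ => by ring
      simp_rw [e]
      have i2 : IntervalIntegrable (fun θ => 2 * a * h' θ) volume 0 L :=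
        (hc.const_mul _).intervalIntegrable _ _
      rw [intervalIntegral.integral_add (hi.sub i2) (by simp),
        intervalIntegral.integral_sub hi i2, intervalIntegral.integral_const_mul, h1,
        intervalIntegral.integral_const, smul_eq_mul]
      ring
    have h5 : a * L = h L - h 0 := div_mul_cancel₀ _ hL.ne'
    rw [h4] at h3
    rw [← h5] at h3 ⊢
    nlinarith [mul_nonneg hL.le h3]
  rw [intervalIntegral.integral_of_le hL.le] at h2
  rw [← ofReal_integral_eq_lintegral_ofReal
    ((intervalIntegrable_iff_integrableOn_Ioc_of_le hL.le).1 hi)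
    (Eventually.of_forall fun _ => sq_nonneg _), ← ENNReal.ofReal_mul hL.le]
  exact ENNReal.ofReal_le_ofReal h2

variable {d m : ℕ} {β Z : ℝ} {V : (Fin d → ℝ) → ℝ}

theorem gradSq_nonneg (f : Xsp d m → ℝ) (x : Xsp d m) : 0 ≤ gradSq f x :=
  add_nonneg (add_nonneg (Finset.sum_nonneg fun _ _ => sq_nonneg _)
    (Finset.sum_nonneg fun _ _ => sq_nonneg _))
    (Finset.sum_nonneg fun _ _ => Finset.sum_nonneg fun _ _ => sq_nonneg _)

theorem sq_fderiv_apply_le (f : Xsp d m → ℝ) (x v : Xsp d m) :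
    fderiv ℝ f x v ^ 2 ≤ gradSq f x * (∑ k, v.1 k ^ 2 + normSqY v.2) := by
  rw [apply_eq_sum, gradSq, normSqY]
  set L := fderiv ℝ f x
  have h := Finset.sum_mul_sq_le_sq_mul_sq Finset.univ
    (Sum.elim (fun k => v.1 k) (Sum.elim (fun k => v.2.1 k) fun jk : Fin m × Fin d =>
      v.2.2 jk.1 jk.2))
    (Sum.elim (fun k => L (eQ d m k)) (Sum.elim (fun k => L (eP d m k))
      fun jk : Fin m × Fin d => L (eZ d m jk.1 jk.2)))
  simp only [Fintype.sum_sum_type, Sum.elim_inl, Sum.elim_inr, Fintype.sum_prod_type] at h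
  simp only [← add_assoc] at h ⊢
  rwa [mul_comm] at h

theorem continuous_gradSq {f : Xsp d m → ℝ} (hf : ContDiff ℝ 1 f) : Continuous (gradSq f) := by
  have h : ∀ v, Continuous fun x => fderiv ℝ f x v := fun v =>
    (hf.continuous_fderiv (by norm_num)).clm_apply continuous_const
  unfold gradSq
  fun_prop

theorem hasDerivAt_rotShift (u : Xsp d m × Xsp d m) (θ : ℝ) :
    HasDerivAt (fun θ => (rotShift θ u).1) (cos θ • u.2.1, (rotShift θ u).2.2) θ := by
  unfold rotShift
  exact (((hasDerivAt_sin θ).smul_const u.2.1).const_add u.1.1).prodMk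
    (((hasDerivAt_cos θ).smul_const u.1.2).add ((hasDerivAt_sin θ).smul_const u.2.2))

theorem continuous_rotShift :
    Continuous fun z : ℝ × Xsp d m × Xsp d m => rotShift z.1 z.2 := by
  unfold rotShift; fun_prop

theorem lintegral_sq_sub_flatGibbs_le (β : ℝ) {f : Xsp d m → ℝ} (hf : ContDiff ℝ 1 f)
    (hp : PerQ d m f) :
    ∫⁻ x, ∫⁻ x', ENNReal.ofReal ((f x' - f x) ^ 2) ∂flatGibbs d m β ∂flatGibbs d m β ≤
      ENNReal.ofReal (π / 2) ^ 2 *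
        ((∫⁻ x, ENNReal.ofReal (gradSq f x) ∂flatGibbs d m β) *
          ∫⁻ x, ENNReal.ofReal (∑ k, x.1 k ^ 2 + normSqY x.2) ∂flatGibbs d m β) := by
  have hfc := hf.continuous
  have hgc := continuous_gradSq hf
  have hNc := continuous_normSqY (d := d) (m := m)
  set ν := flatGibbs d m β
  set G : Xsp d m × Xsp d m → ENNReal := fun u =>
    ENNReal.ofReal (gradSq f u.1) * ENNReal.ofReal (∑ k, u.2.1 k ^ 2 + normSqY u.2.2) with hG
  have hGm : Measurable G := by fun_prop
  have hGp : ∀ (k : Fin d → ℤ) (x x' : Xsp d m),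
      G ((x.1 + (fun i => (k i : ℝ)), x.2), x') = G (x, x') := fun k x x' => by
    simp only [hG, gradSq, hp.fderiv_eq k x]
  have hRm : Measurable fun z : ℝ × Xsp d m × Xsp d m => rotShift z.1 z.2 :=
    continuous_rotShift.measurable
  have step : ∀ u : Xsp d m × Xsp d m,
      ENNReal.ofReal ((f (u.2.1 + u.1.1, u.2.2) - f u.1) ^ 2) ≤
        ENNReal.ofReal (π / 2) * ∫⁻ θ in Set.Ioc 0 (π / 2), G (rotShift θ u) := fun u => by
    have hcu : Continuous fun θ => rotShift θ u :=
      continuous_rotShift.comp (by fun_prop : Continuous fun θ : ℝ => (θ, u))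
    have h := ofReal_sq_sub_le_lintegral (h := fun θ => f (rotShift θ u).1)
      (h' := fun θ => fderiv ℝ f (rotShift θ u).1 (cos θ • u.2.1, (rotShift θ u).2.2))
      (by positivity : 0 < π / 2)
      (fun θ => ((hf.differentiable (by norm_num) _).hasFDerivAt.comp_hasDerivAt θ
        (hasDerivAt_rotShift u θ)))
      (((hf.continuous_fderiv (by norm_num)).comp (by fun_prop)).clm_apply (by fun_prop))
    have e1 : rotShift (π / 2) u = ((u.2.1 + u.1.1, u.2.2), (u.2.1, -u.1.2)) := by
      simp [rotShift, add_comm]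
    have e0 : rotShift 0 u = ((u.1.1, u.1.2), (u.2.1, u.2.2)) := by simp [rotShift]
    simp only [e1, e0] at h
    refine h.trans ?_
    gcongr with θ
    rw [hG]
    dsimp only
    rw [← ENNReal.ofReal_mul (gradSq_nonneg _ _)]
    refine ENNReal.ofReal_le_ofReal ((sq_fderiv_apply_le _ _ _).trans ?_)
    refine mul_le_mul_of_nonneg_left (add_le_add_left ?_ _) (gradSq_nonneg _ _)
    refine Finset.sum_le_sum fun k _ => ?_
    change (cos θ * u.2.1 k) ^ 2 ≤ u.2.1 k ^ 2
    rw [mul_pow]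
    exact mul_le_of_le_one_left (sq_nonneg _) (cos_sq_le_one θ)
  calc ∫⁻ x, ∫⁻ x', ENNReal.ofReal ((f x' - f x) ^ 2) ∂ν ∂ν
      = ∫⁻ x, ∫⁻ x', ENNReal.ofReal ((f (x'.1 + x.1, x'.2) - f x) ^ 2) ∂ν ∂ν :=
        lintegral_congr fun x => (lintegral_flatGibbs_translate β
          (F := fun x' => ENNReal.ofReal ((f x' - f x) ^ 2)) (by fun_prop)
          (fun k x' => by simp only [hp k x']) x.1).symm
    _ = ∫⁻ u, ENNReal.ofReal ((f (u.2.1 + u.1.1, u.2.2) - f u.1) ^ 2) ∂ν.prod ν :=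
        (lintegral_prod (fun u : Xsp d m × Xsp d m =>
          ENNReal.ofReal ((f (u.2.1 + u.1.1, u.2.2) - f u.1) ^ 2)) (by fun_prop)).symm
    _ ≤ ∫⁻ u, (ENNReal.ofReal (π / 2) * ∫⁻ θ in Set.Ioc 0 (π / 2), G (rotShift θ u)) ∂ν.prod ν :=
        lintegral_mono step
    _ = ENNReal.ofReal (π / 2) *
          ∫⁻ θ in Set.Ioc 0 (π / 2), ∫⁻ u, G (rotShift θ u) ∂ν.prod ν := by
        rw [lintegral_const_mul' _ _ ENNReal.ofReal_ne_top, lintegral_lintegral_swap]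
        exact ((hGm.comp hRm).comp measurable_swap).aemeasurable
    _ = ENNReal.ofReal (π / 2) * ((∫⁻ u, G u ∂ν.prod ν) * ENNReal.ofReal (π / 2)) := by
        simp_rw [ν, lintegral_rotShift β _ hGm hGp]
        simp
    _ = _ := by
        rw [hG, lintegral_prod_mul (f := fun x => ENNReal.ofReal (gradSq f x))
          (g := fun x : Xsp d m => ENNReal.ofReal (∑ k, x.1 k ^ 2 + normSqY x.2))
          (by fun_prop) (by fun_prop)]
        ring

theorem exists_gibbs_comparison (hV : ContDiff ℝ 2 V) (hVp : PerV d V) (β : ℝ) (hZ : 0 < Z) :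
    ∃ C : ℝ, 0 < C ∧ ∀ F : Xsp d m → ENNReal, Measurable F →
      ∫⁻ x, F x ∂gibbs d m β Z V ≤ ENNReal.ofReal C * ∫⁻ x, F x ∂flatGibbs d m β ∧
      ∫⁻ x, F x ∂flatGibbs d m β ≤ ENNReal.ofReal C * ∫⁻ x, F x ∂gibbs d m β Z V := by
  obtain ⟨M, hM0, hM⟩ := exists_bound_of_periodic (g := fun q => -β * V q)
    (hV.continuous.const_mul _) fun k q => by rw [hVp]
  have hsplit : ∀ x : Xsp d m, gdens d m β V x =
      exp (-β * V x.1) * exp (-β / 2 * normSqY x.2) := fun x => by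
    rw [gdens, ← exp_add, normSqY]; congr 1; ring
  have hw : Measurable fun x : Xsp d m => gaussWeight β x.2 :=
    (measurable_gaussWeight β).comp measurable_snd
  have hden := measurable_gibbs_density (m := m) hV β Z
  have hC1 : 0 < Z⁻¹ * exp M := by positivity
  have hC2 : 0 < Z * exp M := by positivity
  refine ⟨Z⁻¹ * exp M + Z * exp M, by positivity, fun F hF => ?_⟩
  rw [gibbs, flatGibbs_eq, lintegral_withDensity_eq_lintegral_mul _ hden hF,
    lintegral_withDensity_eq_lintegral_mul _ hw hF]
  constructor
  · rw [← lintegral_const_mul' _ _ ENNReal.ofReal_ne_top]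
    refine lintegral_mono fun x => ?_
    simp only [Pi.mul_apply, gaussWeight]
    rw [← mul_assoc, ← ENNReal.ofReal_mul (by positivity)]
    refine mul_le_mul' (ENNReal.ofReal_le_ofReal ?_) le_rfl
    rw [hsplit, ← mul_assoc]
    refine mul_le_mul_of_nonneg_right ?_ (exp_pos _).le
    have : exp (-β * V x.1) ≤ exp M := exp_le_exp.2 ((le_abs_self _).trans (hM x.1))
    have := mul_le_mul_of_nonneg_left this (inv_nonneg.2 hZ.le)
    linarith
  · rw [← lintegral_const_mul' _ _ ENNReal.ofReal_ne_top]
    refine lintegral_mono fun x => ?_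
    simp only [Pi.mul_apply, gaussWeight]
    rw [← mul_assoc, ← ENNReal.ofReal_mul (by positivity)]
    refine mul_le_mul' (ENNReal.ofReal_le_ofReal ?_) le_rfl
    rw [hsplit, ← mul_assoc, ← mul_assoc]
    refine le_mul_of_one_le_left (exp_pos _).le ?_
    have h1 : exp (-M) ≤ exp (-β * V x.1) := exp_le_exp.2 (abs_le.1 (hM x.1)).1
    have h2 : 1 = Z * exp M * Z⁻¹ * exp (-M) := by
      rw [exp_neg]; field_simp
    rw [h2]
    gcongr
    linarith

theorem lintegral_weight_flatGibbs_lt_top [IsFiniteMeasure (gibbs d m β Z V)] (hβ : 0 < β)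
    (hV : ContDiff ℝ 2 V) (hVp : PerV d V) (hZ : 0 < Z) :
    ∫⁻ x : Xsp d m, ENNReal.ofReal (∑ k, x.1 k ^ 2 + normSqY x.2) ∂flatGibbs d m β < ⊤ := by
  set μ := gibbs d m β Z V
  have hNc := continuous_normSqY (d := d) (m := m)
  obtain ⟨C, -, hC⟩ := exists_gibbs_comparison (m := m) hV hVp β hZ
  refine ((hC _ (by fun_prop)).2).trans_lt (ENNReal.mul_lt_top ENNReal.ofReal_lt_top ?_)
  have tame : ∀ v, Tame μ V v → Integrable (fun x => dHam V x v ^ 2) μ := fun v hv => by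
    obtain ⟨C, hC⟩ := hv
    have h := hC (fun _ => 1) contDiff_const fun _ _ => rfl
    simp only [mul_one] at h
    refine (memLp_two_of_sqNorm
      (contDiff_dHam hV v).continuous.aestronglyMeasurable (h.trans_lt ?_)).integrable_sq
    simp [sqNorm, ENNReal.mul_lt_top_iff, measure_lt_top]
  have iP := fun k => tame _ (tame_eP (m := m) hβ hV hVp hZ k)
  have iZ := fun j k => tame _ (tame_eZ (m := m) hβ hV hVp hZ j k)
  simp only [dHam_eP] at iP
  simp only [dHam_eZ] at iZ
  have hi : Integrable (fun x : Xsp d m => (d : ℝ) + normSqY x.2) μ :=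
    (integrable_const _).fun_add ((integrable_finsetSum _ fun k _ => iP k).fun_add
      (integrable_finsetSum _ fun j _ => integrable_finsetSum _ fun k _ => iZ j k))
  refine lt_of_le_of_lt (lintegral_mono_ae ?_)
    ((hasFiniteIntegral_iff_ofReal (Eventually.of_forall fun x =>
      add_nonneg (Nat.cast_nonneg d) (normSqY_nonneg _))).1 hi.2)
  have hcube : ∀ᵐ x : Xsp d m ∂μ, x.1 ∈ cube d :=
    (withDensity_absolutelyContinuous _ _).ae_le
      (ae_restrict_mem (measurable_fst (measurableSet_cube d)))
  filter_upwards [hcube] with x hx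
  refine ENNReal.ofReal_le_ofReal (add_le_add_left ?_ _)
  calc ∑ k, x.1 k ^ 2 ≤ ∑ _k : Fin d, (1 : ℝ) :=
        Finset.sum_le_sum fun k _ => pow_le_one₀ (hx k).1 (hx k).2.le
    _ = d := by simp

/-- The Poincaré inequality for the Gibbs measure. -/
theorem exists_poincare [IsProbabilityMeasure (gibbs d m β Z V)] (hβ : 0 < β)
    (hV : ContDiff ℝ 2 V) (hVp : PerV d V) (hZ : 0 < Z) :
    ∃ C : ℝ, 0 ≤ C ∧ ∀ f : Xsp d m → ℝ, TwiceL2 (gibbs d m β Z V) f →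
      ∫ x, f x ∂gibbs d m β Z V = 0 →
        ∫ x, f x ^ 2 ∂gibbs d m β Z V ≤ C * ∫ x, gradSq f x ∂gibbs d m β Z V := by
  obtain ⟨A, hA0, hA⟩ := exists_gibbs_comparison (m := m) hV hVp β hZ
  have hW := lintegral_weight_flatGibbs_lt_top (m := m) hβ hV hVp hZ
  set W := ∫⁻ x : Xsp d m, ENNReal.ofReal (∑ k, x.1 k ^ 2 + normSqY x.2) ∂flatGibbs d m β
  set μ := gibbs d m β Z V with hμ
  refine ⟨A ^ 3 * ((π / 2) ^ 2 * W.toReal), by positivity, fun f hf hmean => ?_⟩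
  have hfc := hf.contDiff.continuous
  have hf1 : ContDiff ℝ 1 f := hf.contDiff.of_le (by norm_num)
  have hgc := continuous_gradSq hf1
  have hi := hf.memLp.integrable (by norm_num)
  have h1 : ∀ x, ENNReal.ofReal (∫ x', f x' ^ 2 ∂μ) ≤
      ∫⁻ x', ENNReal.ofReal ((f x' - f x) ^ 2) ∂μ := fun x => by
    have e : ∀ x', (f x' - f x) ^ 2 = f x' ^ 2 - 2 * f x * f x' + f x ^ 2 := fun x' => by ring
    have i1 : Integrable (fun x' => f x' ^ 2 - 2 * f x * f x') μ :=
      hf.memLp.integrable_sq.sub (hi.const_mul _)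
    have i2 : Integrable (fun x' => (f x' - f x) ^ 2) μ := by
      simp_rw [e]; exact i1.add (integrable_const _)
    rw [← ofReal_integral_eq_lintegral_ofReal i2 (Eventually.of_forall fun _ => sq_nonneg _)]
    refine ENNReal.ofReal_le_ofReal ?_
    simp_rw [e]
    rw [integral_add i1 (integrable_const _),
      integral_sub hf.memLp.integrable_sq (hi.const_mul _), integral_const_mul, hmean]
    simp [sq_nonneg]
  have h2 : ENNReal.ofReal (∫ x, f x ^ 2 ∂μ) ≤
      ENNReal.ofReal A * (ENNReal.ofReal A *
        (ENNReal.ofReal (π / 2) ^ 2 * ((ENNReal.ofReal A *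
          ENNReal.ofReal (∫ x, gradSq f x ∂μ)) * W))) := by
    calc ENNReal.ofReal (∫ x, f x ^ 2 ∂μ) = ∫⁻ _, ENNReal.ofReal (∫ x', f x' ^ 2 ∂μ) ∂μ := by simp
      _ ≤ ∫⁻ x, ∫⁻ x', ENNReal.ofReal ((f x' - f x) ^ 2) ∂μ ∂μ := lintegral_mono h1
      _ ≤ ∫⁻ x, ENNReal.ofReal A *
            ∫⁻ x', ENNReal.ofReal ((f x' - f x) ^ 2) ∂flatGibbs d m β ∂μ :=
          lintegral_mono fun x => (hA _ (by fun_prop)).1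
      _ ≤ ENNReal.ofReal A * (ENNReal.ofReal A *
            ∫⁻ x, ∫⁻ x', ENNReal.ofReal ((f x' - f x) ^ 2) ∂flatGibbs d m β
              ∂flatGibbs d m β) := by
          rw [lintegral_const_mul' _ _ ENNReal.ofReal_ne_top]
          gcongr
          exact (hA _ (Measurable.lintegral_prod_right (f := fun x x' =>
            ENNReal.ofReal ((f x' - f x) ^ 2)) (by fun_prop))).1
      _ ≤ _ := by
          gcongr
          refine (lintegral_sq_sub_flatGibbs_le β hf1 hf.perQ).trans ?_
          gcongr
          rw [ofReal_integral_eq_lintegral_ofReal hf.integrable_gradSq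
            (Eventually.of_forall (gradSq_nonneg f))]
          exact (hA _ (by fun_prop)).2
  have hg0 : 0 ≤ ∫ x, gradSq f x ∂μ := integral_nonneg (gradSq_nonneg f)
  have hpi := pi_pos.le
  rw [← ENNReal.ofReal_toReal hW.ne, ← ENNReal.ofReal_pow (by positivity),
    ← ENNReal.ofReal_mul (by positivity), ← ENNReal.ofReal_mul (by positivity),
    ← ENNReal.ofReal_mul (by positivity), ← ENNReal.ofReal_mul (by positivity),
    ← ENNReal.ofReal_mul (by positivity), ENNReal.ofReal_le_ofReal_iff (by positivity)] at h2
  linarith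

end Poincare

section Main

variable {d m : ℕ} {β Z : ℝ} {V : (Fin d → ℝ) → ℝ}

/-- A Grönwall inequality for the integrated differential inequality `F' ≤ -κ F`. -/
theorem Evolves.le_exp_mul {F Ψ : ℝ → ℝ} (h : Evolves F Ψ) (hF : ∀ t, 0 ≤ t → 0 ≤ F t) {κ : ℝ}
    (hκ : 0 ≤ κ) (hΨ : ∀ t, 0 ≤ t → Ψ t ≤ -κ * F t) {t : ℝ} (ht : 0 ≤ t) :
    F t ≤ exp (-κ * t) * F 0 := by
  have anti : ∀ s r, 0 ≤ s → s ≤ r → F r ≤ F s := fun s r hs hsr => by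
    obtain ⟨hi, he⟩ := h s r hs hsr
    have : ∫ u in s..r, Ψ u ≤ ∫ _ in s..r, (0 : ℝ) :=
      intervalIntegral.integral_mono_on hsr hi intervalIntegrable_const fun u hu =>
        (hΨ u (hs.trans hu.1)).trans (by nlinarith [hF u (hs.trans hu.1)])
    rw [intervalIntegral.integral_zero] at this
    linarith
  have step : ∀ s r, 0 ≤ s → s ≤ r → (1 + κ * (r - s)) * F r ≤ F s := fun s r hs hsr => by
    obtain ⟨hi, he⟩ := h s r hs hsr
    have : ∫ u in s..r, Ψ u ≤ ∫ _ in s..r, -κ * F r :=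
      intervalIntegral.integral_mono_on hsr hi intervalIntegrable_const fun u hu =>
        (hΨ u (hs.trans hu.1)).trans (by nlinarith [anti u r (hs.trans hu.1) hu.2])
    rw [intervalIntegral.integral_const, smul_eq_mul] at this
    linarith
  have iter : ∀ n : ℕ, (1 + κ * t / n) ^ n * F t ≤ F 0 := fun n => by
    rcases n.eq_zero_or_pos with rfl | hn
    · simpa using anti 0 t le_rfl ht
    have hn' : (0 : ℝ) < n := Nat.cast_pos.2 hn
    have key : ∀ k : ℕ, (1 + κ * t / n) ^ k * F (k * (t / n)) ≤ F 0 := fun k => by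
      induction k with
      | zero => simp
      | succ k ih =>
        refine le_trans ?_ ih
        have h0 : 0 ≤ t / n := by positivity
        have := step (k * (t / n)) ((k + 1 : ℕ) * (t / n)) (by positivity)
          (by push_cast; linarith)
        have e : 1 + κ * ((k + 1 : ℕ) * (t / n) - k * (t / n)) = 1 + κ * t / n := by
          push_cast; ring
        rw [e] at this
        rw [pow_succ, mul_assoc]
        exact mul_le_mul_of_nonneg_left this (by positivity)
    have := key n
    rwa [mul_div_cancel₀ _ hn'.ne'] at this
  have lim := le_of_tendsto' ((tendsto_one_add_div_pow_exp (κ * t)).mul_const (F t)) iter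
  calc F t = exp (-κ * t) * (exp (κ * t) * F t) := by
        rw [← mul_assoc, ← exp_add]; simp
    _ ≤ _ := mul_le_mul_of_nonneg_left lim (exp_pos _).le

theorem H1sq_eq (μ : Measure (Xsp d m)) (f : Xsp d m → ℝ) :
    H1sq d m μ f = ∫ x, (f x ^ 2 + gradSq f x) ∂μ := by
  refine integral_congr_ae (Eventually.of_forall fun x => ?_)
  simp only [gradSq, pQ, pP, pZ, eQ, eP, eZ]
  ring

theorem SobolevFamily.of_integral_le {μ : Measure (Xsp d m)} {h : ℝ → Xsp d m → ℝ}
    (hs : ContDiff ℝ (⊤ : ℕ∞) fun tx : ℝ × Xsp d m => h tx.1 tx.2)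
    (hper : ∀ t, 0 ≤ t → PerQ d m (h t))
    (hL : ∀ (n : ℕ) (v : Fin n → Xsp d m) (T : ℝ), 0 < T → ∃ M : ℝ, ∀ t ∈ Set.Icc (0 : ℝ) T,
      Integrable (fun x => (iteratedFDeriv ℝ n (h t) x v) ^ 2) μ ∧
        ∫ x, (iteratedFDeriv ℝ n (h t) x v) ^ 2 ∂μ ≤ M) :
    SobolevFamily μ h where
  smooth := hs
  perQ := hper
  locL2_iteratedFDeriv n v T hT := by
    obtain ⟨M, hM⟩ := hL n v T hT
    refine ⟨M.toNNReal, fun t ht => ?_⟩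
    obtain ⟨hi, hle⟩ := hM t ht
    have hc : Continuous fun x => iteratedFDeriv ℝ n (h t) x v :=
      (ContinuousMultilinearMap.apply ℝ (fun _ : Fin n => Xsp d m) ℝ v).continuous.comp
        ((SmoothFamily.contDiff hs t (n := n)).continuous_iteratedFDeriv le_rfl)
    refine ⟨(memLp_two_iff_integrable_sq hc.aestronglyMeasurable).2 hi, ?_⟩
    rw [sqNorm_eq_ofReal hi]
    exact ENNReal.ofReal_le_ofReal hle

/-- Hypocoercive decay of the squared `H¹` norm along mean-zero solutions. -/
theorem exists_H1sq_decay [IsProbabilityMeasure (gibbs d m β Z V)] {α lam : Fin m → ℝ}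
    (hβ : 0 < β) (hα : ∀ j, 0 < α j) (hlam : ∀ j, 0 < lam j) (hV : ContDiff ℝ 2 V)
    (hVp : PerV d V) (hZ : 0 < Z) (j₀ : Fin m) :
    ∃ C κ : ℝ, 0 < C ∧ 0 < κ ∧ ∀ φ, KolmogorovSolution d m β Z α lam V φ →
      ∫ x, φ 0 x ∂gibbs d m β Z V = 0 → ∀ t, 0 ≤ t →
        H1sq d m (gibbs d m β Z V) (φ t) ≤
          C * exp (-κ * t) * H1sq d m (gibbs d m β Z V) (φ 0) := by
  obtain ⟨K, δ, c, hK, hδ, hc, hdecay⟩ := exists_lyapunov hβ hα hlam hV hVp hZ j₀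
  obtain ⟨P, hP0, hP⟩ := exists_poincare (m := m) hβ hV hVp hZ
  have hB : 0 < K + 3 + 4 * δ ^ 2 := by positivity
  have hD : 0 < (K + 3 + 4 * δ ^ 2) * (P + 1) := by positivity
  refine ⟨(6 / δ ^ 2 + 1) * (K + 3 + 4 * δ ^ 2), c / ((K + 3 + 4 * δ ^ 2) * (P + 1)),
    by positivity, by positivity, fun φ hφ hmean t ht => ?_⟩
  set κ := c / ((K + 3 + 4 * δ ^ 2) * (P + 1)) with hκ
  obtain ⟨Ψ, hev, hΨ⟩ := hdecay φ hφ
  set μ := gibbs d m β Z V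
  have hreg := fun {r : ℝ} (hr : 0 ≤ r) => hφ.sobolev.twiceL2 hr
  have hH0 : ∀ r, 0 ≤ H1sq d m μ (φ r) := fun r => by
    rw [H1sq_eq]
    exact integral_nonneg fun x => add_nonneg (sq_nonneg _) (gradSq_nonneg _ _)
  have hlow : ∀ r, 0 ≤ r → H1sq d m μ (φ r) ≤ (6 / δ ^ 2 + 1) * lyapunov K δ j₀ μ (φ r) :=
    fun r hr => by rw [H1sq_eq]; exact (hreg hr).le_lyapunov hK hδ j₀
  have hup : ∀ r, 0 ≤ r → lyapunov K δ j₀ μ (φ r) ≤ (K + 3 + 4 * δ ^ 2) * H1sq d m μ (φ r) :=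
    fun r hr => by rw [H1sq_eq]; exact (hreg hr).lyapunov_le hK δ j₀
  have hpos : ∀ r, 0 ≤ r → 0 ≤ lyapunov K δ j₀ μ (φ r) := fun r hr =>
    nonneg_of_mul_nonneg_right ((hH0 r).trans (hlow r hr)) (by positivity)
  have hcoer : ∀ r, 0 ≤ r → Ψ r ≤ -κ * lyapunov K δ j₀ μ (φ r) := fun r hr => by
    have hp := hP (φ r) (hreg hr) ((hφ.integral_eq hβ hV hVp hZ hr).trans hmean)
    have h1 : H1sq d m μ (φ r) ≤ (P + 1) * ∫ x, gradSq (φ r) x ∂μ := by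
      rw [H1sq_eq, integral_add (hreg hr).memLp.integrable_sq (hreg hr).integrable_gradSq]
      linarith
    have h2 : lyapunov K δ j₀ μ (φ r) ≤
        (K + 3 + 4 * δ ^ 2) * (P + 1) * ∫ x, gradSq (φ r) x ∂μ := by
      rw [mul_assoc]
      exact (hup r hr).trans (mul_le_mul_of_nonneg_left h1 hB.le)
    have h3 : κ * lyapunov K δ j₀ μ (φ r) ≤ c * ∫ x, gradSq (φ r) x ∂μ := by
      rw [hκ, div_mul_eq_mul_div, div_le_iff₀ hD]
      nlinarith
    linarith [hΨ r hr]
  calc H1sq d m μ (φ t) ≤ (6 / δ ^ 2 + 1) * lyapunov K δ j₀ μ (φ t) := hlow t ht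
    _ ≤ (6 / δ ^ 2 + 1) * (exp (-κ * t) * ((K + 3 + 4 * δ ^ 2) * H1sq d m μ (φ 0))) := by
        gcongr
        exact (hev.le_exp_mul hpos (by positivity) hcoer ht).trans
          (mul_le_mul_of_nonneg_left (hup 0 le_rfl) (exp_pos _).le)
    _ = _ := by ring

end Main

/-- (Hypocoercive decay in `H¹`, periodic case.) Assume `V ∈ C²(𝕋^d)`.
There are `C, λ > 0` such that every smooth solution of the backward Kolmogorov equation
`∂_t h = −𝓛 h` (with all spatial derivatives in `L²(μ_β)`, locally uniformly in time)
with mean-zero initial datum satisfies `‖h(t)‖_{H¹(μ_β)} ≤ C e^{−λt} ‖h(0)‖_{H¹(μ_β)}`. -/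
theorem hypocoercive_H1_periodic
    (d m : ℕ) (hd : 1 ≤ d) (hm : 1 ≤ m)
    (β : ℝ) (hβ : 0 < β)
    (α lam : Fin m → ℝ) (hα : ∀ j, 0 < α j) (hlam : ∀ j, 0 < lam j)
    (V : (Fin d → ℝ) → ℝ) (hV : ContDiff ℝ 2 V) (hVper : PerV d V)
    (Z : ℝ) (hZ : 0 < Z)
    (hprob : IsProbabilityMeasure (gibbs d m β Z V)) :
    ∃ C lam0 : ℝ, 0 < C ∧ 0 < lam0 ∧
      ∀ h : ℝ → Xsp d m → ℝ,
        ContDiff ℝ (⊤ : ℕ∞) (fun tx : ℝ × Xsp d m => h tx.1 tx.2) →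
        (∀ t, 0 ≤ t → PerQ d m (h t)) →
        (∀ (n : ℕ) (v : Fin n → Xsp d m) (T : ℝ), 0 < T → ∃ M : ℝ,
          ∀ t ∈ Set.Icc (0 : ℝ) T,
            Integrable (fun x => (iteratedFDeriv ℝ n (h t) x v) ^ 2) (gibbs d m β Z V) ∧
            ∫ x, (iteratedFDeriv ℝ n (h t) x v) ^ 2 ∂(gibbs d m β Z V) ≤ M) →
        (∀ t, 0 ≤ t → ∀ x, deriv (fun s => h s x) t = - gen d m β α lam V (h t) x) →
        (∫ x, h 0 x ∂(gibbs d m β Z V)) = 0 →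
        ∀ t, 0 ≤ t →
          Real.sqrt (H1sq d m (gibbs d m β Z V) (h t))
            ≤ C * Real.exp (-lam0 * t) * Real.sqrt (H1sq d m (gibbs d m β Z V) (h 0)) := by
  obtain ⟨C, κ, hC, hκ, hdecay⟩ :=
    exists_H1sq_decay (m := m) hβ hα hlam hV hVper hZ ⟨0, hm⟩
  refine ⟨√C, κ / 2, Real.sqrt_pos.2 hC, by positivity, fun h hs hper hL hsol hmean t ht => ?_⟩
  have hexp : √(exp (-κ * t)) = exp (-(κ / 2) * t) := by
    rw [Real.sqrt_eq_iff_mul_self_eq (exp_pos _).le (exp_pos _).le, ← exp_add]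
    ring_nf
  rw [← hexp, ← Real.sqrt_mul hC.le, ← Real.sqrt_mul (by positivity)]
  exact Real.sqrt_le_sqrt
    (hdecay h ⟨SobolevFamily.of_integral_le hs hper hL, hsol⟩ hmean t ht)
end
end

section
/- (Lyapunov condition, confining potential.) Let V ∈ C²(ℝ^d) be confining (V(q) → +∞ as |q| → ∞ and e^{−V} ∈ L¹(ℝ^d)), bounded below, and suppose there exist σ, b > 0 with ⟨∇V(q), q⟩ ≥ σ V(q) + b|q|² for all q, and a constant c with ‖∇²V(q)‖ ≤ c for all q. Then there exist positive constants Ĉ, A, B, C, D, E, F, H, M and a, d̂ > 0 such that the function G(q,p,r) = Ĉ + (A/2)|q|² + (B/2)|p|² + (C/2)|r|² + D V(q) + E⟨p,q⟩ + F⟨q,r⟩ + H⟨p,r⟩ + M⟨∇V(q), p⟩ satisfies G(x) ≥ 1 for all x ∈ ℝ^{3d}, G(x) → +∞ as |x| → ∞, and LG(x) ≤ −a G(x) + d̂ for all x ∈ ℝ^{3d}. -/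
open MeasureTheory Real Filter

noncomputable section

/-- The phase space `ℝ^{3d}` with coordinates `(q, p, r)`. -/
abbrev Y3 (d : ℕ) := (Fin d → ℝ) × (Fin d → ℝ) × (Fin d → ℝ)

/-- The generator of the generalized Langevin dynamics (all constants set to `1`):
`LG = p·∇_qG − ∇V(q)·∇_pG + r·∇_pG − p·∇_rG − r·∇_rG + Δ_rG`. -/
def Lgle (d : ℕ) (V : (Fin d → ℝ) → ℝ) (G : Y3 d → ℝ) (x : Y3 d) : ℝ :=
  fderiv ℝ G x (x.2.1, 0, 0)
  - fderiv ℝ G x (0, (fun i => fderiv ℝ V x.1 (Pi.single i 1)), 0)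
  + fderiv ℝ G x (0, x.2.2, 0)
  - fderiv ℝ G x (0, 0, x.2.1)
  - fderiv ℝ G x (0, 0, x.2.2)
  + ∑ i, fderiv ℝ (fun y => fderiv ℝ G y (0, 0, Pi.single i 1)) x (0, 0, Pi.single i 1)

/-- The quadratic-plus-potential Lyapunov candidate on phase space. -/
def lyapunovCandidate (d : ℕ) (V : (Fin d → ℝ) → ℝ) (k A B C D E F H M : ℝ) (y : Y3 d) : ℝ :=
  k + A / 2 * ∑ i, (y.1 i) ^ 2 + B / 2 * ∑ i, (y.2.1 i) ^ 2
    + C / 2 * ∑ i, (y.2.2 i) ^ 2 + D * V y.1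
    + E * ∑ i, y.2.1 i * y.1 i + F * ∑ i, y.1 i * y.2.2 i
    + H * ∑ i, y.2.1 i * y.2.2 i + M * fderiv ℝ V y.1 y.2.1

lemma exists_hasFDerivAt_sum_mul {E : Type*} [NormedAddCommGroup E] [NormedSpace ℝ E] {d : ℕ}
    (f g : E →L[ℝ] (Fin d → ℝ)) (x : E) :
    ∃ L : E →L[ℝ] ℝ, HasFDerivAt (fun y => ∑ i, f y i * g y i) L x ∧
      ∀ v, L v = ∑ i, (f x i * g v i + f v i * g x i) := by
  have h (f : E →L[ℝ] (Fin d → ℝ)) (i : Fin d) : HasFDerivAt (fun y => f y i)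
      ((ContinuousLinearMap.proj (R := ℝ) (φ := fun _ : Fin d => ℝ) i).comp f) x :=
    ((ContinuousLinearMap.proj (R := ℝ) (φ := fun _ : Fin d => ℝ) i).comp f).hasFDerivAt
  refine ⟨_, HasFDerivAt.fun_sum fun i _ => (h f i).mul (h g i), fun v => ?_⟩
  simp only [sum_apply, add_apply,
    smul_apply, ContinuousLinearMap.comp_apply,
    ContinuousLinearMap.proj_apply, smul_eq_mul]
  exact Finset.sum_congr rfl fun i _ => by ring

lemma fderiv_lyapunovCandidate {d : ℕ} {V : (Fin d → ℝ) → ℝ} (hV : ContDiff ℝ 2 V)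
    (k A B C D E F H M : ℝ) (x v : Y3 d) :
    fderiv ℝ (lyapunovCandidate d V k A B C D E F H M) x v =
      A * ∑ i, x.1 i * v.1 i + B * ∑ i, x.2.1 i * v.2.1 i + C * ∑ i, x.2.2 i * v.2.2 i
      + D * fderiv ℝ V x.1 v.1
      + E * ∑ i, (x.2.1 i * v.1 i + v.2.1 i * x.1 i)
      + F * ∑ i, (x.1 i * v.2.2 i + v.1 i * x.2.2 i)
      + H * ∑ i, (x.2.1 i * v.2.2 i + v.2.1 i * x.2.2 i)
      + M * (fderiv ℝ (fderiv ℝ V) x.1 v.1 x.2.1 + fderiv ℝ V x.1 v.2.1) := by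
  have hV1 : DifferentiableAt ℝ V x.1 := hV.differentiable (by norm_num) x.1
  have hV2 : DifferentiableAt ℝ (fderiv ℝ V) x.1 :=
    (hV.fderiv_right (m := 1) (by norm_num)).differentiable (by norm_num) x.1
  let Pq : Y3 d →L[ℝ] (Fin d → ℝ) := ContinuousLinearMap.fst ℝ _ _
  let Ppr : Y3 d →L[ℝ] (Fin d → ℝ) × (Fin d → ℝ) := ContinuousLinearMap.snd ℝ _ _
  let Pp : Y3 d →L[ℝ] (Fin d → ℝ) := (ContinuousLinearMap.fst ℝ _ _).comp Ppr
  let Pr : Y3 d →L[ℝ] (Fin d → ℝ) := (ContinuousLinearMap.snd ℝ _ _).comp Ppr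
  obtain ⟨Lqq, hqq, eqq⟩ := exists_hasFDerivAt_sum_mul Pq Pq x
  obtain ⟨Lpp, hpp, epp⟩ := exists_hasFDerivAt_sum_mul Pp Pp x
  obtain ⟨Lrr, hrr, err⟩ := exists_hasFDerivAt_sum_mul Pr Pr x
  obtain ⟨Lpq, hpq, epq⟩ := exists_hasFDerivAt_sum_mul Pp Pq x
  obtain ⟨Lqr, hqr, eqr⟩ := exists_hasFDerivAt_sum_mul Pq Pr x
  obtain ⟨Lpr, hpr, epr⟩ := exists_hasFDerivAt_sum_mul Pp Pr x
  have hq : HasFDerivAt (fun y : Y3 d => y.1) Pq x := Pq.hasFDerivAt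
  have hp : HasFDerivAt (fun y : Y3 d => y.2.1) Pp x := Pp.hasFDerivAt
  have hv : HasFDerivAt (fun y : Y3 d => V y.1) ((fderiv ℝ V x.1).comp Pq) x :=
    hV1.hasFDerivAt.comp x hq
  have hg : HasFDerivAt (fun y : Y3 d => fderiv ℝ V y.1)
      ((fderiv ℝ (fderiv ℝ V) x.1).comp Pq) x := hV2.hasFDerivAt.comp x hq
  have key := ((((((((hqq.const_mul (A / 2)).const_add k).add (hpp.const_mul (B / 2))).add
    (hrr.const_mul (C / 2))).add (hv.const_mul D)).add (hpq.const_mul E)).add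
    (hqr.const_mul F)).add (hpr.const_mul H)).add ((hg.clm_apply hp).const_mul M)
  have hG := key.congr_of_eventuallyEq
    (f₁ := lyapunovCandidate d V k A B C D E F H M) (Eventually.of_forall fun y => by
      simp only [lyapunovCandidate, pow_two]
      rfl)
  rw [hG.fderiv]
  have e (f : Fin d → ℝ) (g : Fin d → ℝ) :
      ∑ i, (f i * g i + g i * f i) = 2 * ∑ i, f i * g i := by
    rw [Finset.mul_sum]
    exact Finset.sum_congr rfl fun i _ => by ring
  simp only [add_apply, smul_apply, smul_eq_mul,
    eqq, epp, err, epq, eqr, epr, e, ContinuousLinearMap.comp_apply,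
    ContinuousLinearMap.flip_apply]
  simp only [Pq, Pp, Pr, Ppr, ContinuousLinearMap.comp_apply, ContinuousLinearMap.coe_fst',
    ContinuousLinearMap.coe_snd']
  ring

lemma clm_apply_eq_sum_mul {d : ℕ} (L : (Fin d → ℝ) →L[ℝ] ℝ) (v : Fin d → ℝ) :
    L v = ∑ i, L (Pi.single i 1) * v i := by
  conv_lhs => rw [pi_eq_sum_univ' v]
  simp [mul_comm]

lemma Lgle_lyapunovCandidate {d : ℕ} {V : (Fin d → ℝ) → ℝ} (hV : ContDiff ℝ 2 V)
    (k A B C D E F H M : ℝ) (x : Y3 d) :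
    Lgle d V (lyapunovCandidate d V k A B C D E F H M) x =
      (E - H) * ∑ i, (x.2.1 i) ^ 2 + M * fderiv ℝ (fderiv ℝ V) x.1 x.2.1 x.2.1
      + (H - C) * ∑ i, (x.2.2 i) ^ 2 - M * ∑ i, (fderiv ℝ V x.1 (Pi.single i 1)) ^ 2
      - E * fderiv ℝ V x.1 x.1 + (D - B) * fderiv ℝ V x.1 x.2.1
      + (M - H) * fderiv ℝ V x.1 x.2.2
      + (A - F) * ∑ i, x.2.1 i * x.1 i + (E - F) * ∑ i, x.1 i * x.2.2 i
      + (F + B - C - H) * ∑ i, x.2.1 i * x.2.2 i + C * d := by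
  have hlap (i : Fin d) :
      fderiv ℝ (fun y => fderiv ℝ (lyapunovCandidate d V k A B C D E F H M) y
        (0, 0, Pi.single i 1)) x (0, 0, Pi.single i 1) = C := by
    have h : (fun y => fderiv ℝ (lyapunovCandidate d V k A B C D E F H M) y
        (0, 0, Pi.single i 1)) = fun y : Y3 d => C * y.2.2 i + F * y.1 i + H * y.2.1 i := by
      funext y
      rw [fderiv_lyapunovCandidate hV]
      simp [Pi.single_apply]
    let T : Y3 d →ₗ[ℝ] ℝ :=
      { toFun := fun y => C * y.2.2 i + F * y.1 i + H * y.2.1 i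
        map_add' := fun y z => by simp; ring
        map_smul' := fun a y => by simp; ring }
    rw [h, show (fun y : Y3 d => C * y.2.2 i + F * y.1 i + H * y.2.1 i) =
      T.toContinuousLinearMap from rfl, ContinuousLinearMap.fderiv]
    simp [T]
  rw [Lgle]
  simp only [hlap]
  simp only [fderiv_lyapunovCandidate hV, Pi.zero_apply, mul_zero, zero_mul, add_zero, zero_add,
    Finset.sum_const_zero, map_zero, zero_apply, Finset.sum_const, Finset.card_univ,
    Fintype.card_fin, nsmul_eq_mul]
  obtain ⟨g, hg⟩ : ∃ g : Fin d → ℝ, ∀ i, fderiv ℝ V x.1 (Pi.single i 1) = g i :=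
    ⟨_, fun _ => rfl⟩
  have e (v : Fin d → ℝ) : fderiv ℝ V x.1 v = ∑ i, g i * v i := by
    simp only [clm_apply_eq_sum_mul _ v, hg]
  simp only [hg, e, pow_two, mul_comm]
  ring

lemma sum_sq_nonneg {d : ℕ} (v : Fin d → ℝ) : 0 ≤ ∑ i, (v i) ^ 2 :=
  Finset.sum_nonneg fun _ _ => sq_nonneg _

lemma sq_norm_le_sum_sq {d : ℕ} (v : Fin d → ℝ) : ‖v‖ ^ 2 ≤ ∑ i, (v i) ^ 2 := by
  rw [← Real.le_sqrt (norm_nonneg v) (sum_sq_nonneg v), pi_norm_le_iff_of_nonneg (Real.sqrt_nonneg _)]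
  exact fun i => Real.abs_le_sqrt
    (Finset.single_le_sum (f := fun i => (v i) ^ 2) (fun i _ => sq_nonneg _) (Finset.mem_univ i))

lemma abs_sum_mul_le {d : ℕ} (u v : Fin d → ℝ) {ε : ℝ} (hε : 0 < ε) :
    |∑ i, u i * v i| ≤ ε * ∑ i, (u i) ^ 2 + 1 / (4 * ε) * ∑ i, (v i) ^ 2 := by
  refine (Finset.abs_sum_le_sum_abs _ _).trans ?_
  rw [Finset.mul_sum, Finset.mul_sum, ← Finset.sum_add_distrib]
  refine Finset.sum_le_sum fun i _ => ?_
  rw [abs_mul, ← sq_abs (u i), ← sq_abs (v i)]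
  have h : ε * |u i| ^ 2 + 1 / (4 * ε) * |v i| ^ 2 - |u i| * |v i| =
      1 / (4 * ε) * (2 * ε * |u i| - |v i|) ^ 2 := by
    field_simp
    ring
  have : 0 ≤ 1 / (4 * ε) * (2 * ε * |u i| - |v i|) ^ 2 := by positivity
  linarith

/-- A bounded Hessian makes `⟨∇V(q), p⟩` quadratically bounded, with small weight on `q`. -/
lemma abs_fderiv_apply_le {d : ℕ} {V : (Fin d → ℝ) → ℝ} (hV : ContDiff ℝ 2 V) {c : ℝ}
    (hc : ∀ q, ‖fderiv ℝ (fderiv ℝ V) q‖ ≤ c) (q p : Fin d → ℝ) :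
    |fderiv ℝ V q p| ≤ ‖fderiv ℝ V 0‖ ^ 2 + 1 / 16 * ∑ i, (q i) ^ 2
      + (1 + 4 * c ^ 2) * ∑ i, (p i) ^ 2 := by
  have hV2 : Differentiable ℝ (fderiv ℝ V) :=
    (hV.fderiv_right (m := 1) (by norm_num)).differentiable (by norm_num)
  have h1 : ‖fderiv ℝ V q - fderiv ℝ V 0‖ ≤ c * ‖q - 0‖ :=
    Convex.norm_image_sub_le_of_norm_fderiv_le (fun x _ => hV2 x) (fun x _ => hc x)
      convex_univ (Set.mem_univ 0) (Set.mem_univ q)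
  rw [sub_zero] at h1
  have h2 : ‖fderiv ℝ V q‖ ≤ ‖fderiv ℝ V 0‖ + c * ‖q‖ := by
    have := norm_sub_norm_le (fderiv ℝ V q) (fderiv ℝ V 0)
    linarith
  have h3 : |fderiv ℝ V q p| ≤ (‖fderiv ℝ V 0‖ + c * ‖q‖) * ‖p‖ :=
    ((fderiv ℝ V q).le_opNorm p).trans (mul_le_mul_of_nonneg_right h2 (norm_nonneg p))
  have hq := sq_norm_le_sum_sq q
  have hp := mul_le_mul_of_nonneg_left (sq_norm_le_sum_sq p)
    (by positivity : 0 ≤ 1 + 4 * c ^ 2)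
  nlinarith [sq_nonneg (‖fderiv ℝ V 0‖ - ‖p‖), sq_nonneg (‖q‖ / 4 - 2 * c * ‖p‖),
    sq_nonneg ‖fderiv ℝ V 0‖, sq_nonneg ‖p‖]

lemma one_sub_mul_clm_apply_le {d : ℕ} (L : (Fin d → ℝ) →L[ℝ] ℝ) (v : Fin d → ℝ) (h : ℝ) :
    (1 - h) * L v ≤ ∑ i, (L (Pi.single i 1)) ^ 2 + (h - 1) ^ 2 / 4 * ∑ i, (v i) ^ 2 := by
  rw [clm_apply_eq_sum_mul L v, Finset.mul_sum, Finset.mul_sum, ← Finset.sum_add_distrib]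
  refine Finset.sum_le_sum fun i _ => ?_
  nlinarith [sq_nonneg (L (Pi.single i 1) + (h - 1) / 2 * v i)]

lemma fderiv_fderiv_apply_apply_le {d : ℕ} {V : (Fin d → ℝ) → ℝ} {c : ℝ}
    (hc : ∀ q, ‖fderiv ℝ (fderiv ℝ V) q‖ ≤ c) (q p : Fin d → ℝ) :
    fderiv ℝ (fderiv ℝ V) q p p ≤ c * ∑ i, (p i) ^ 2 := by
  have hc0 : 0 ≤ c := (norm_nonneg (fderiv ℝ (fderiv ℝ V) q)).trans (hc q)
  calc fderiv ℝ (fderiv ℝ V) q p p ≤ ‖fderiv ℝ (fderiv ℝ V) q p p‖ := Real.le_norm_self _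
    _ ≤ ‖fderiv ℝ (fderiv ℝ V) q‖ * ‖p‖ * ‖p‖ := ContinuousLinearMap.le_opNorm₂ _ _ _
    _ ≤ c * ‖p‖ * ‖p‖ := by gcongr; exact hc q
    _ = c * ‖p‖ ^ 2 := by ring
    _ ≤ c * ∑ i, (p i) ^ 2 := mul_le_mul_of_nonneg_left (sq_norm_le_sum_sq p) hc0

lemma le_lyapunovCandidate {d : ℕ} {V : (Fin d → ℝ) → ℝ} (hV : ContDiff ℝ 2 V) {c : ℝ}
    (hc : ∀ q, ‖fderiv ℝ (fderiv ℝ V) q‖ ≤ c) {B C D H : ℝ} (k : ℝ) (hH : 0 ≤ H)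
    (hB : 21 / 2 + H + 8 * c ^ 2 ≤ B) (hC : 17 / 2 + H ≤ C) (x : Y3 d) :
    k - ‖fderiv ℝ V 0‖ ^ 2 + D * V x.1 + 1 / 4 * (∑ i, (x.1 i) ^ 2 + ∑ i, (x.2.1 i) ^ 2
      + ∑ i, (x.2.2 i) ^ 2) ≤ lyapunovCandidate d V k 1 B C D 1 1 H 1 x := by
  have hpr := (abs_le.mp (abs_sum_mul_le x.2.1 x.2.2 (ε := 1 / 2) (by norm_num))).1
  have hHpr := mul_le_mul_of_nonneg_left hpr hH
  have hpq := (abs_le.mp (abs_sum_mul_le x.2.1 x.1 (ε := 4) (by norm_num))).1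
  have hqr := (abs_le.mp (abs_sum_mul_le x.1 x.2.2 (ε := 1 / 16) (by norm_num))).1
  have hgp := (abs_le.mp (abs_fderiv_apply_le hV hc x.1 x.2.1)).1
  have hp := mul_le_mul_of_nonneg_right hB (sum_sq_nonneg x.2.1)
  have hr := mul_le_mul_of_nonneg_right hC (sum_sq_nonneg x.2.2)
  have hq := sum_sq_nonneg x.1
  rw [lyapunovCandidate]
  linarith

lemma lyapunovCandidate_le {d : ℕ} {V : (Fin d → ℝ) → ℝ} (hV : ContDiff ℝ 2 V) {c : ℝ}
    (hc : ∀ q, ‖fderiv ℝ (fderiv ℝ V) q‖ ≤ c) {B C D H K : ℝ} (k : ℝ) (hH : 0 ≤ H)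
    (hK : 1 ≤ K) (hB : B / 2 + 5 + H / 2 + 4 * c ^ 2 ≤ K) (hC : C / 2 + 4 + H / 2 ≤ K)
    (x : Y3 d) :
    lyapunovCandidate d V k 1 B C D 1 1 H 1 x ≤ k + ‖fderiv ℝ V 0‖ ^ 2 + D * V x.1
      + K * (∑ i, (x.1 i) ^ 2 + ∑ i, (x.2.1 i) ^ 2 + ∑ i, (x.2.2 i) ^ 2) := by
  have hpr := (abs_le.mp (abs_sum_mul_le x.2.1 x.2.2 (ε := 1 / 2) (by norm_num))).2
  have hHpr := mul_le_mul_of_nonneg_left hpr hH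
  have hpq := (abs_le.mp (abs_sum_mul_le x.2.1 x.1 (ε := 4) (by norm_num))).2
  have hqr := (abs_le.mp (abs_sum_mul_le x.1 x.2.2 (ε := 1 / 16) (by norm_num))).2
  have hgp := (abs_le.mp (abs_fderiv_apply_le hV hc x.1 x.2.1)).2
  have hp := mul_le_mul_of_nonneg_right hB (sum_sq_nonneg x.2.1)
  have hr := mul_le_mul_of_nonneg_right hC (sum_sq_nonneg x.2.2)
  have hq := mul_le_mul_of_nonneg_right hK (sum_sq_nonneg x.1)
  have hq' := sum_sq_nonneg x.1
  rw [lyapunovCandidate]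
  linarith

lemma Lgle_lyapunovCandidate_le {d : ℕ} {V : (Fin d → ℝ) → ℝ} (hV : ContDiff ℝ 2 V)
    {c : ℝ} (hc : ∀ q, ‖fderiv ℝ (fderiv ℝ V) q‖ ≤ c) {σ b : ℝ}
    (hcoer : ∀ q : Fin d → ℝ, σ * V q + b * ∑ i, (q i) ^ 2 ≤ fderiv ℝ V q q)
    {B C H : ℝ} (k : ℝ) (hH : 2 + c ≤ H) (hC : H + (H - 1) ^ 2 / 4 + 1 ≤ C)
    (hB : B = C + H - 1) (x : Y3 d) :
    Lgle d V (lyapunovCandidate d V k 1 B C B 1 1 H 1) x ≤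
      C * d - σ * V x.1 - b * ∑ i, (x.1 i) ^ 2 - ∑ i, (x.2.1 i) ^ 2 - ∑ i, (x.2.2 i) ^ 2 := by
  have hgr := one_sub_mul_clm_apply_le (fderiv ℝ V x.1) x.2.2 H
  have hhess := fderiv_fderiv_apply_apply_le hc x.1 x.2.1
  have hco := hcoer x.1
  have hp := mul_le_mul_of_nonneg_right hH (sum_sq_nonneg x.2.1)
  have hr := mul_le_mul_of_nonneg_right hC (sum_sq_nonneg x.2.2)
  have hBC : 1 + B - C - H = 0 := by rw [hB]; ring
  rw [Lgle_lyapunovCandidate hV, hBC]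
  linarith

/-- (Lyapunov condition, confining potential.) Let `V ∈ C²(ℝ^d)` be
confining, bounded below, with `⟨∇V(q), q⟩ ≥ σV(q) + b|q|²` and `‖∇²V‖ ≤ c`. Then there
are positive constants `Ĉ, A, B, C, D, E, F, H, M` and `a, d̂ > 0` such that
`G = Ĉ + (A/2)|q|² + (B/2)|p|² + (C/2)|r|² + DV(q) + E⟨p,q⟩ + F⟨q,r⟩ + H⟨p,r⟩ + M⟨∇V(q),p⟩`
satisfies `G ≥ 1`, `G → ∞` as `|x| → ∞`, and `LG ≤ −aG + d̂` everywhere. -/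
theorem lyapunov_confining
    (d : ℕ) (hd : 1 ≤ d)
    (V : (Fin d → ℝ) → ℝ) (hV : ContDiff ℝ 2 V)
    (hVconf : Filter.Tendsto V (Filter.cocompact (Fin d → ℝ)) Filter.atTop)
    (hVint : Integrable (fun q : Fin d → ℝ => Real.exp (-V q)) volume)
    (Kb : ℝ) (hKb : ∀ q, Kb ≤ V q)
    (σ b : ℝ) (hσ : 0 < σ) (hb : 0 < b)
    (hcoer : ∀ q : Fin d → ℝ, σ * V q + b * ∑ i, (q i) ^ 2 ≤ fderiv ℝ V q q)
    (c : ℝ) (hHess : ∀ q : Fin d → ℝ, ‖fderiv ℝ (fderiv ℝ V) q‖ ≤ c) :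
    ∃ Chat cA cB cC cD cE cF cH cM a dhat : ℝ,
      0 < Chat ∧ 0 < cA ∧ 0 < cB ∧ 0 < cC ∧ 0 < cD ∧ 0 < cE ∧ 0 < cF ∧ 0 < cH ∧
      0 < cM ∧ 0 < a ∧ 0 < dhat ∧
      (∀ x : Y3 d,
        1 ≤ Chat + cA / 2 * ∑ i, (x.1 i) ^ 2 + cB / 2 * ∑ i, (x.2.1 i) ^ 2
            + cC / 2 * ∑ i, (x.2.2 i) ^ 2 + cD * V x.1
            + cE * ∑ i, x.2.1 i * x.1 i + cF * ∑ i, x.1 i * x.2.2 i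
            + cH * ∑ i, x.2.1 i * x.2.2 i + cM * fderiv ℝ V x.1 x.2.1) ∧
      (∀ M : ℝ, ∃ R : ℝ, ∀ x : Y3 d,
        R ≤ ∑ i, (x.1 i) ^ 2 + ∑ i, (x.2.1 i) ^ 2 + ∑ i, (x.2.2 i) ^ 2 →
        M ≤ Chat + cA / 2 * ∑ i, (x.1 i) ^ 2 + cB / 2 * ∑ i, (x.2.1 i) ^ 2
            + cC / 2 * ∑ i, (x.2.2 i) ^ 2 + cD * V x.1
            + cE * ∑ i, x.2.1 i * x.1 i + cF * ∑ i, x.1 i * x.2.2 i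
            + cH * ∑ i, x.2.1 i * x.2.2 i + cM * fderiv ℝ V x.1 x.2.1) ∧
      (∀ x : Y3 d,
        Lgle d V
          (fun y => Chat + cA / 2 * ∑ i, (y.1 i) ^ 2 + cB / 2 * ∑ i, (y.2.1 i) ^ 2
            + cC / 2 * ∑ i, (y.2.2 i) ^ 2 + cD * V y.1
            + cE * ∑ i, y.2.1 i * y.1 i + cF * ∑ i, y.1 i * y.2.2 i
            + cH * ∑ i, y.2.1 i * y.2.2 i + cM * fderiv ℝ V y.1 y.2.1) x
        ≤ -a * (Chat + cA / 2 * ∑ i, (x.1 i) ^ 2 + cB / 2 * ∑ i, (x.2.1 i) ^ 2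
            + cC / 2 * ∑ i, (x.2.2 i) ^ 2 + cD * V x.1
            + cE * ∑ i, x.2.1 i * x.1 i + cF * ∑ i, x.1 i * x.2.2 i
            + cH * ∑ i, x.2.1 i * x.2.2 i + cM * fderiv ℝ V x.1 x.2.1) + dhat) := by
  have hc0 : 0 ≤ c := (norm_nonneg (fderiv ℝ (fderiv ℝ V) 0)).trans (hHess 0)
  set N := ‖fderiv ℝ V 0‖ with hN
  obtain ⟨C, hC⟩ : ∃ C, C = 20 + 10 * c + 10 * c ^ 2 := ⟨_, rfl⟩
  obtain ⟨H, hH⟩ : ∃ H, H = 3 + c := ⟨_, rfl⟩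
  obtain ⟨B, hB⟩ : ∃ B, B = C + H - 1 := ⟨_, rfl⟩
  obtain ⟨k, hk⟩ : ∃ k, k = 1 + N ^ 2 + B * |Kb| := ⟨_, rfl⟩
  obtain ⟨K, hK⟩ : ∃ K, K = B + C + H + 20 + 4 * c ^ 2 := ⟨_, rfl⟩
  obtain ⟨a, ha⟩ : ∃ a, a = min (min 1 b / K) (σ / B) := ⟨_, rfl⟩
  obtain ⟨e, he⟩ : ∃ e, e = C * d + a * k + a * N ^ 2 + |σ - a * B| * |Kb| + 1 := ⟨_, rfl⟩
  have hC0 : 0 < C := by rw [hC]; positivity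
  have hH0 : 0 < H := by rw [hH]; positivity
  have hB0 : 0 < B := by rw [hB, hH]; linarith
  have hk0 : 0 < k := by rw [hk]; positivity
  have hK0 : 0 < K := by rw [hK]; positivity
  have ha0 : 0 < a := by
    rw [ha]
    exact lt_min (div_pos (lt_min one_pos hb) hK0) (div_pos hσ hB0)
  have he0 : 0 < e := by rw [he]; positivity
  have haK : a * K ≤ min 1 b := by
    rw [← le_div_iff₀ hK0, ha]
    exact min_le_left _ _
  have haB : a * B ≤ σ := by
    rw [← le_div_iff₀ hB0, ha]
    exact min_le_right _ _
  have hlow (x : Y3 d) : 1 + 1 / 4 * (∑ i, (x.1 i) ^ 2 + ∑ i, (x.2.1 i) ^ 2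
      + ∑ i, (x.2.2 i) ^ 2) ≤ lyapunovCandidate d V k 1 B C B 1 1 H 1 x := by
    have hVx := mul_le_mul_of_nonneg_left ((neg_abs_le Kb).trans (hKb x.1)) hB0.le
    have := le_lyapunovCandidate hV hHess (B := B) (C := C) (D := B) k hH0.le
      (by rw [hB, hH, hC]; nlinarith) (by rw [hH, hC]; nlinarith) x
    rw [← hN] at this
    linarith
  refine ⟨k, 1, B, C, B, 1, 1, H, 1, a, e, hk0, one_pos, hB0, hC0, hB0, one_pos, one_pos,
    hH0, one_pos, ha0, he0, fun x => ?_, fun M => ⟨4 * M, fun x hx => ?_⟩, fun x => ?_⟩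
  · have := hlow x
    rw [lyapunovCandidate] at this
    linarith [sum_sq_nonneg x.1, sum_sq_nonneg x.2.1, sum_sq_nonneg x.2.2]
  · have := hlow x
    rw [lyapunovCandidate] at this
    linarith
  · change Lgle d V (lyapunovCandidate d V k 1 B C B 1 1 H 1) x ≤
      -a * lyapunovCandidate d V k 1 B C B 1 1 H 1 x + e
    have hup := mul_le_mul_of_nonneg_left (lyapunovCandidate_le hV hHess (B := B) (C := C)
      (D := B) (K := K) k hH0.le (by rw [hK]; nlinarith) (by rw [hK]; nlinarith)
      (by rw [hK]; nlinarith) x) ha0.le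
    have hL := Lgle_lyapunovCandidate_le hV hHess hcoer (B := B) (C := C) (H := H) k
      (by rw [hH]; linarith) (by rw [hH, hC]; nlinarith) hB x
    have hpot : -(|σ - a * B| * |Kb|) ≤ (σ - a * B) * V x.1 := by
      rw [abs_of_nonneg (sub_nonneg.mpr haB)]
      have := mul_le_mul_of_nonneg_left ((neg_abs_le Kb).trans (hKb x.1)) (sub_nonneg.mpr haB)
      linarith
    have haq := mul_le_mul_of_nonneg_right (haK.trans (min_le_right _ _)) (sum_sq_nonneg x.1)
    have hap := mul_le_mul_of_nonneg_right (haK.trans (min_le_left _ _)) (sum_sq_nonneg x.2.1)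
    have har := mul_le_mul_of_nonneg_right (haK.trans (min_le_left _ _)) (sum_sq_nonneg x.2.2)
    rw [← hN] at hup
    rw [he]
    linarith
end
end
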